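/- Fix an integer d ≥ 2 and p > p̂_c(d). Then bond percolation on the torus T^d_N satisfies ℙ_p(S^□) → 1 as N → ∞. -/

import Mathlib

/-!
Bond percolation on the torus `T^d_N`.  A configuration assigns `true`/`false`
(open/closed) to each edge of the graph on `(ℤ/Nℤ)^d` in which a vertex is joined
to its translates by standard basis vectors; edges are indexed by a vertex together
with a direction.  A configuration lifts `N`-periodically to `ℤ^d`, and the
giant-cycle event `A^□` asks for two distinct points of `ℤ^d`, congruent mod `N`,
joined by a path of open edges of the periodic lift.
-/

namespace TorusPerc

/-- The standard basis vector `e i` of `ℤ^d`. -/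
def stdVec (d : ℕ) (i : Fin d) : Fin d → ℤ := fun j => if j = i then 1 else 0

/-- An edge of the cubical torus: a vertex of `(ℤ/Nℤ)^d` together with a direction. -/
abbrev Edge (d N : ℕ) := (Fin d → ZMod N) × Fin d

/-- A bond configuration on the torus. -/
abbrev Config (d N : ℕ) := Edge d N → Bool

/-- Reduction of a point of `ℤ^d` modulo `N`. -/
def proj (d N : ℕ) (x : Fin d → ℤ) : Fin d → ZMod N := fun i => (x i : ZMod N)

/-- The edge of the periodic lift going from `x` in direction `i` is open. -/
def liftOpen (d N : ℕ) (ω : Config d N) (x : Fin d → ℤ) (i : Fin d) : Prop :=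
  ω (proj d N x, i) = true

/-- One step along an open edge of the periodic lift. -/
def step (d N : ℕ) (ω : Config d N) (x y : Fin d → ℤ) : Prop :=
  (∃ i, y = x + stdVec d i ∧ liftOpen d N ω x i) ∨
  (∃ i, x = y + stdVec d i ∧ liftOpen d N ω y i)

/-- Connectivity by paths of open edges in the periodic lift. -/
def connected (d N : ℕ) (ω : Config d N) : (Fin d → ℤ) → (Fin d → ℤ) → Prop :=
  Relation.ReflTransGen (step d N ω)

/-- The giant-cycle event `A^□`: some two distinct points of `ℤ^d` which are congruent
modulo `N` are joined by an open path of the periodic lift. -/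
def giantEvent (d N : ℕ) : Set (Config d N) :=
  {ω | ∃ x y : Fin d → ℤ, x ≠ y ∧ proj d N x = proj d N y ∧ connected d N ω x y}

/-- The set of winding vectors realized by a configuration. -/
def winding (d N : ℕ) (ω : Config d N) : Set (Fin d → ℤ) :=
  {w | ∃ x : Fin d → ℤ, connected d N ω x (x + (N : ℤ) • w)}

/-- The realized winding vectors, regarded as vectors in `ℚ^d`. -/
def windingQ (d N : ℕ) (ω : Config d N) : Set (Fin d → ℚ) :=
  (fun w : Fin d → ℤ => fun i => (w i : ℚ)) '' winding d N ω

/-- The spanning event `S^□`: the realized winding vectors span `ℚ^d`. -/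
def spanEvent (d N : ℕ) : Set (Config d N) :=
  {ω | Submodule.span ℚ (windingQ d N ω) = ⊤}

/-- The probability of an event under Bernoulli(`p`) bond percolation on the torus:
each edge is open independently with probability `p`. -/
noncomputable def prob (d N : ℕ) (p : ℝ) (S : Set (Config d N)) : ℝ :=
  ∑ᶠ ω ∈ S, ∏ᶠ e : Edge d N, (if ω e then p else 1 - p)

end TorusPerc


/-!
Bond percolation on `ℤ^d` and its critical probability `p̂_c(d)`.
The event that the origin lies in an infinite open cluster has probability
`θ(p) = inf_M ℙ_p(0 ↔ ∂[-M,M]^d)`, where the connection event depends only on the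
(finitely many) edges with both endpoints in the box `[-M,M]^d`, so that its
probability is a finite Bernoulli sum.  `p̂_c(d)` is the supremum of the `p ∈ [0,1]`
with `θ(p) = 0`.
-/

namespace ZLattice

/-- The edge of `ℤ^d` from `e.1` in direction `e.2` has both endpoints in `[-M,M]^d`. -/
def inBox (d M : ℕ) (e : (Fin d → ℤ) × Fin d) : Prop :=
  (∀ j, |e.1 j| ≤ (M : ℤ)) ∧ (∀ j, |(e.1 + TorusPerc.stdVec d e.2) j| ≤ (M : ℤ))

/-- A bond configuration on the edges of the box `[-M,M]^d`. -/
abbrev BoxConfig (d M : ℕ) := {e : (Fin d → ℤ) × Fin d // inBox d M e} → Bool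

/-- The edge from `x` in direction `i` lies in the box and is open. -/
def edgeOpen (d M : ℕ) (η : BoxConfig d M) (x : Fin d → ℤ) (i : Fin d) : Prop :=
  ∃ h : inBox d M (x, i), η ⟨(x, i), h⟩ = true

/-- One step along an open edge of the box. -/
def step (d M : ℕ) (η : BoxConfig d M) (x y : Fin d → ℤ) : Prop :=
  (∃ i, y = x + TorusPerc.stdVec d i ∧ edgeOpen d M η x i) ∨
  (∃ i, x = y + TorusPerc.stdVec d i ∧ edgeOpen d M η y i)

/-- Connectivity by open paths inside the box. -/
def connected (d M : ℕ) (η : BoxConfig d M) : (Fin d → ℤ) → (Fin d → ℤ) → Prop :=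
  Relation.ReflTransGen (step d M η)

/-- The origin is joined to the boundary of the box `[-M,M]^d` by an open path. -/
def reachBoundary (d M : ℕ) : Set (BoxConfig d M) :=
  {η | ∃ y : Fin d → ℤ, (∃ j, |y j| = (M : ℤ)) ∧ connected d M η 0 y}

/-- Probability of an event for Bernoulli(`p`) bond percolation on the box. -/
noncomputable def prob (d M : ℕ) (p : ℝ) (S : Set (BoxConfig d M)) : ℝ :=
  ∑ᶠ η ∈ S, ∏ᶠ e : {e : (Fin d → ℤ) × Fin d // inBox d M e}, (if η e then p else 1 - p)

/-- `θ(p)`: the probability that the origin of `ℤ^d` lies in an infinite open cluster. -/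
noncomputable def theta (d : ℕ) (p : ℝ) : ℝ := ⨅ M : ℕ, prob d M p (reachBoundary d M)

/-- The critical probability `p̂_c(d)` of Bernoulli bond percolation on `ℤ^d`. -/
noncomputable def hatPc (d : ℕ) : ℝ := sSup {p : ℝ | p ∈ Set.Icc (0 : ℝ) 1 ∧ theta d p = 0}

end ZLattice

namespace TP

section ExLib

variable {α : Type*} [DecidableEq α]

/-- Expectation of `f` of a random subset of `F`, each `a` present independently with
probability `p a`. -/
noncomputable def Ex (F : Finset α) (p : α → ℝ) (f : Finset α → ℝ) : ℝ :=
  ∑ A ∈ F.powerset, (∏ a ∈ F, if a ∈ A then p a else 1 - p a) * f A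

lemma Ex_empty (p : α → ℝ) (f : Finset α → ℝ) : Ex ∅ p f = f ∅ := by
  simp [Ex]

lemma Ex_insert {a : α} {F : Finset α} (h : a ∉ F) (p : α → ℝ) (f : Finset α → ℝ) :
    Ex (insert a F) p f = p a * Ex F p (fun A => f (insert a A)) + (1 - p a) * Ex F p f := by
  unfold Ex
  rw [Finset.sum_powerset_insert h, add_comm, Finset.mul_sum, Finset.mul_sum]
  congr 1
  · refine Finset.sum_congr rfl fun A hA => ?_
    rw [Finset.prod_insert h]
    have : (∏ x ∈ F, if x ∈ insert a A then p x else 1 - p x)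
        = ∏ x ∈ F, if x ∈ A then p x else 1 - p x := by
      refine Finset.prod_congr rfl fun x hx => ?_
      have : x ≠ a := fun e => h (e ▸ hx)
      simp [this]
    rw [this]; simp [mul_assoc]
  · refine Finset.sum_congr rfl fun A hA => ?_
    rw [Finset.prod_insert h]
    have : a ∉ A := fun e => h (Finset.mem_powerset.1 hA e)
    simp [this, mul_assoc]

lemma Ex_congr {F : Finset α} {p : α → ℝ} {f g : Finset α → ℝ}
    (h : ∀ A, A ⊆ F → f A = g A) : Ex F p f = Ex F p g := by
  unfold Ex
  exact Finset.sum_congr rfl fun A hA => by rw [h A (Finset.mem_powerset.1 hA)]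

lemma Ex_congr_p {F : Finset α} {p q : α → ℝ} {f : Finset α → ℝ}
    (h : ∀ a ∈ F, p a = q a) : Ex F p f = Ex F q f := by
  unfold Ex
  refine Finset.sum_congr rfl fun A hA => ?_
  congr 1
  exact Finset.prod_congr rfl fun a ha => by rw [h a ha]

lemma Ex_add (F : Finset α) (p : α → ℝ) (f g : Finset α → ℝ) :
    Ex F p (fun A => f A + g A) = Ex F p f + Ex F p g := by
  unfold Ex; rw [← Finset.sum_add_distrib]
  exact Finset.sum_congr rfl fun A hA => by ring

lemma Ex_mul_left (F : Finset α) (p : α → ℝ) (c : ℝ) (f : Finset α → ℝ) :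
    Ex F p (fun A => c * f A) = c * Ex F p f := by
  unfold Ex; rw [Finset.mul_sum]
  exact Finset.sum_congr rfl fun A hA => by ring

lemma Ex_mul_right (F : Finset α) (p : α → ℝ) (c : ℝ) (f : Finset α → ℝ) :
    Ex F p (fun A => f A * c) = Ex F p f * c := by
  rw [mul_comm, ← Ex_mul_left]; simp [mul_comm]

lemma Ex_sub (F : Finset α) (p : α → ℝ) (f g : Finset α → ℝ) :
    Ex F p (fun A => f A - g A) = Ex F p f - Ex F p g := by
  unfold Ex; rw [← Finset.sum_sub_distrib]
  exact Finset.sum_congr rfl fun A hA => by ring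

lemma Ex_sum {κ : Type*} (s : Finset κ) (F : Finset α) (p : α → ℝ) (f : κ → Finset α → ℝ) :
    Ex F p (fun A => ∑ k ∈ s, f k A) = ∑ k ∈ s, Ex F p (f k) := by
  unfold Ex; rw [Finset.sum_comm]
  exact Finset.sum_congr rfl fun A hA => by rw [Finset.mul_sum]

lemma Ex_const (F : Finset α) (p : α → ℝ) (c : ℝ) : Ex F p (fun _ => c) = c := by
  induction F using Finset.induction_on with
  | empty => rw [Ex_empty]
  | insert a F h ih => rw [Ex_insert h, ih]; ring

/-- the parameters are probabilities -/
def IsP (p : α → ℝ) : Prop := ∀ a, 0 ≤ p a ∧ p a ≤ 1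

lemma Ex_mono {F : Finset α} {p : α → ℝ} (hp : IsP p) {f g : Finset α → ℝ}
    (h : ∀ A, A ⊆ F → f A ≤ g A) : Ex F p f ≤ Ex F p g := by
  unfold Ex
  refine Finset.sum_le_sum fun A hA => ?_
  refine mul_le_mul_of_nonneg_left (h A (Finset.mem_powerset.1 hA)) ?_
  refine Finset.prod_nonneg fun a _ => ?_
  split_ifs
  · exact (hp a).1
  · linarith [(hp a).2]

lemma Ex_nonneg {F : Finset α} {p : α → ℝ} (hp : IsP p) {f : Finset α → ℝ}
    (h : ∀ A, A ⊆ F → 0 ≤ f A) : 0 ≤ Ex F p f := by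
  have := Ex_mono (F := F) hp (f := fun _ => 0) (g := f) h
  rwa [Ex_const] at this

lemma Ex_union {F G : Finset α} (h : Disjoint F G) (p : α → ℝ) (f : Finset α → ℝ) :
    Ex (F ∪ G) p f = Ex F p (fun A => Ex G p (fun B => f (A ∪ B))) := by
  induction F using Finset.induction_on generalizing f with
  | empty => simp [Ex_empty]
  | insert a F ha ih =>
    rw [Finset.disjoint_insert_left] at h
    have h2 : a ∉ F ∪ G := by simp [ha, h.1]
    rw [Finset.insert_union, Ex_insert h2, Ex_insert ha, ih h.2, ih h.2]
    simp [Finset.insert_union]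

lemma Ex_inter {F G : Finset α} (h : G ⊆ F) (p : α → ℝ) (f : Finset α → ℝ) :
    Ex F p (fun A => f (A ∩ G)) = Ex G p f := by
  have : F = G ∪ (F \ G) := by simp [h]
  rw [this, Ex_union Finset.disjoint_sdiff]
  refine Ex_congr fun A hA => ?_
  trans Ex (F \ G) p (fun _ => f A)
  · refine Ex_congr fun B hB => ?_
    congr 1
    ext x; simp only [Finset.mem_inter, Finset.mem_union]
    constructor
    · rintro ⟨h1 | h1, h2⟩
      · exact h1
      · have := hB h1; simp [h2] at this
    · exact fun h1 => ⟨Or.inl h1, hA h1⟩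
  · rw [Ex_const]

/-- `f` depends only on the coordinates in `D`. -/
def DepOn (D : Set α) {β : Type*} (f : Finset α → β) : Prop :=
  ∀ A B : Finset α, (∀ a ∈ D, a ∈ A ↔ a ∈ B) → f A = f B

open Classical in
lemma Ex_indep {F : Finset α} {p : α → ℝ} {f g : Finset α → ℝ} (D : Set α)
    (hf : DepOn D f) (hg : DepOn Dᶜ g) :
    Ex F p (fun A => f A * g A) = Ex F p f * Ex F p g := by
  have hF : F = F.filter (· ∈ D) ∪ F.filter (¬ · ∈ D) := by
    rw [Finset.filter_union_filter_not_eq]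
  have hd : Disjoint (F.filter (· ∈ D)) (F.filter (¬ · ∈ D)) :=
    Finset.disjoint_filter_filter_not _ _ _
  rw [hF]
  generalize hG : F.filter (· ∈ D) = G at *
  generalize hH : F.filter (¬ · ∈ D) = H at *
  have hG' : ∀ x ∈ G, x ∈ D := by subst hG; simp
  have hH' : ∀ x ∈ H, x ∉ D := by subst hH; simp
  have e1 : ∀ A B, A ⊆ G → B ⊆ H → f (A ∪ B) = f A := by
    intro A B hA hB
    refine hf _ _ fun a ha => ?_
    have : a ∉ B := fun h => hH' a (hB h) ha
    simp [this]
  have e2 : ∀ A B, A ⊆ G → B ⊆ H → g (A ∪ B) = g B := by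
    intro A B hA hB
    refine hg _ _ fun a ha => ?_
    have : a ∉ A := fun h => ha (hG' a (hA h))
    simp [this]
  rw [Ex_union hd, Ex_union hd, Ex_union hd]
  have l1 : Ex G p (fun A => Ex H p fun B => f (A ∪ B) * g (A ∪ B)) = Ex G p f * Ex H p g := by
    rw [← Ex_mul_right]
    refine Ex_congr fun A hA => ?_
    rw [← Ex_mul_left]
    refine Ex_congr fun B hB => ?_
    rw [e1 A B hA hB, e2 A B hA hB]
  have l2 : Ex G p (fun A => Ex H p fun B => f (A ∪ B)) = Ex G p f := by
    refine Ex_congr fun A hA => ?_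
    rw [← Ex_const H p (f A)]
    exact Ex_congr fun B hB => e1 A B hA hB
  have l3 : Ex G p (fun A => Ex H p fun B => g (A ∪ B)) = Ex H p g := by
    rw [← Ex_const G p (Ex H p g)]
    refine Ex_congr fun A hA => Ex_congr fun B hB => e2 A B hA hB
  rw [l1, l2, l3]

lemma Ex_or (F : Finset α) (p q : α → ℝ) (f : Finset α → ℝ) :
    Ex F (fun a => 1 - (1 - p a) * (1 - q a)) f
      = Ex F p (fun A => Ex F q (fun B => f (A ∪ B))) := by
  induction F using Finset.induction_on generalizing f with
  | empty => simp [Ex_empty]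
  | insert a F ha ih =>
    rw [Ex_insert ha, ih, ih, Ex_insert ha]
    have h1 : Ex F p (fun A => Ex (insert a F) q fun B => f (insert a A ∪ B))
        = Ex F p (fun A => Ex F q fun B => f (insert a (A ∪ B))) := by
      refine Ex_congr fun A hA => ?_
      rw [Ex_insert ha]
      have : ∀ B : Finset α, insert a A ∪ insert a B = insert a (A ∪ B) := by
        intro B; ext x; simp; try tauto
      simp only [this, Finset.insert_union]; ring
    have h2 : Ex F p (fun A => Ex (insert a F) q fun B => f (A ∪ B))
        = q a * Ex F p (fun A => Ex F q fun B => f (insert a (A ∪ B)))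
          + (1 - q a) * Ex F p (fun A => Ex F q fun B => f (A ∪ B)) := by
      rw [← Ex_mul_left, ← Ex_mul_left, ← Ex_add]
      refine Ex_congr fun A hA => ?_
      rw [Ex_insert ha]
      simp only [Finset.union_insert]
    rw [h1, h2]; ring

lemma Ex_mono_p {F : Finset α} {p q : α → ℝ} (hp : IsP p) (hq : IsP q)
    (hpq : ∀ a ∈ F, p a ≤ q a) {f : Finset α → ℝ} (hf : Monotone f) :
    Ex F p f ≤ Ex F q f := by
  induction F using Finset.induction_on generalizing f with
  | empty => simp [Ex_empty]
  | insert a F ha ih =>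
    rw [Ex_insert ha, Ex_insert ha]
    have hm : Monotone (fun A => f (insert a A)) :=
      fun A B h => hf (Finset.insert_subset_insert a h)
    have i1 := ih (fun b hb => hpq b (Finset.mem_insert_of_mem hb)) hm
    have i2 := ih (fun b hb => hpq b (Finset.mem_insert_of_mem hb)) hf
    have i3 : Ex F q f ≤ Ex F q (fun A => f (insert a A)) :=
      Ex_mono hq fun A _ => hf (Finset.subset_insert a A)
    have h4 := hpq a (Finset.mem_insert_self a F)
    have := (hp a).1
    have := (hp a).2
    nlinarith

lemma Ex_image {β : Type*} [DecidableEq β] {F : Finset α} {j : α → β} (hj : Set.InjOn j F)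
    (p : β → ℝ) (f : Finset β → ℝ) :
    Ex (F.image j) p f = Ex F (fun a => p (j a)) (fun A => f (A.image j)) := by
  induction F using Finset.induction_on generalizing f with
  | empty => simp [Ex_empty]
  | insert a F ha ih =>
    have hj' : Set.InjOn j F := hj.mono (by simp)
    have : j a ∉ F.image j := by
      simp only [Finset.mem_image, not_exists, not_and]
      intro x hx e
      have := hj (by simp [hx]) (by simp) e
      exact ha (this ▸ hx)
    rw [Finset.image_insert, Ex_insert this, Ex_insert ha, ih hj', ih hj']
    simp [Finset.image_insert]

/-- Harris inequality for two decreasing functions -/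
lemma harris {F : Finset α} {p : α → ℝ} (hp : IsP p) {f g : Finset α → ℝ}
    (hf : Antitone f) (hg : Antitone g) :
    Ex F p f * Ex F p g ≤ Ex F p (fun A => f A * g A) := by
  induction F using Finset.induction_on generalizing f g with
  | empty => simp [Ex_empty]
  | insert a F ha ih =>
    rw [Ex_insert ha, Ex_insert ha, Ex_insert ha]
    have hmf : Antitone (fun A => f (insert a A)) :=
      fun A B h => hf (Finset.insert_subset_insert a h)
    have hmg : Antitone (fun A => g (insert a A)) :=
      fun A B h => hg (Finset.insert_subset_insert a h)
    have i1 := ih hmf hmg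
    have i2 := ih hf hg
    have i3 : Ex F p (fun A => f (insert a A)) ≤ Ex F p f :=
      Ex_mono hp fun A _ => hf (Finset.subset_insert a A)
    have i4 : Ex F p (fun A => g (insert a A)) ≤ Ex F p g :=
      Ex_mono hp fun A _ => hg (Finset.subset_insert a A)
    have h0 := (hp a).1
    have h1 : 0 ≤ 1 - p a := by linarith [(hp a).2]
    have := mul_le_mul_of_nonneg_left i1 h0
    have := mul_le_mul_of_nonneg_left i2 h1
    nlinarith [mul_nonneg (mul_nonneg h0 h1) (mul_nonneg (sub_nonneg.2 i3) (sub_nonneg.2 i4))]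

lemma harris_prod {κ : Type*} (s : Finset κ) {F : Finset α} {p : α → ℝ} (hp : IsP p)
    {f : κ → Finset α → ℝ} (hf : ∀ k, Antitone (f k)) (h0 : ∀ k A, 0 ≤ f k A) :
    ∏ k ∈ s, Ex F p (f k) ≤ Ex F p (fun A => ∏ k ∈ s, f k A) := by
  classical
  induction s using Finset.induction_on with
  | empty => simp [Ex_const]
  | insert k s hk ih =>
    simp only [Finset.prod_insert hk]
    have hm : Antitone (fun A => ∏ k ∈ s, f k A) := fun A B h =>
      Finset.prod_le_prod (fun i _ => h0 i B) (fun i _ => hf i h)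
    refine le_trans ?_ (harris hp (hf k) hm)
    exact mul_le_mul_of_nonneg_left ih (Ex_nonneg hp fun A _ => h0 k A)

/-- probability of an event -/
noncomputable def Pr (F : Finset α) (p : α → ℝ) (S : Finset α → Prop) : ℝ :=
  Ex F p (Set.indicator {A | S A} (fun _ => 1))

lemma Pr_mono {F : Finset α} {p : α → ℝ} (hp : IsP p) {S T : Finset α → Prop}
    (h : ∀ A, A ⊆ F → S A → T A) : Pr F p S ≤ Pr F p T := by
  refine Ex_mono hp fun A hA => ?_
  by_cases h1 : S A
  · simp [h1, h A hA h1]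
  · simp only [Set.indicator, Set.mem_ofPred_eq, h1, if_false]; split_ifs <;> norm_num

lemma Pr_congr {F : Finset α} {p : α → ℝ} {S T : Finset α → Prop}
    (h : ∀ A, A ⊆ F → (S A ↔ T A)) : Pr F p S = Pr F p T := by
  refine Ex_congr fun A hA => ?_
  have h1 := h A hA
  by_cases h2 : S A
  · simp [h2, h1.1 h2]
  · have h3 : ¬ T A := fun h => h2 (h1.2 h)
    simp [h2, h3]

lemma Pr_nonneg {F : Finset α} {p : α → ℝ} (hp : IsP p) (S : Finset α → Prop) :
    0 ≤ Pr F p S :=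
  Ex_nonneg hp fun A _ => Set.indicator_nonneg (fun _ _ => zero_le_one) _

lemma Pr_le_one {F : Finset α} {p : α → ℝ} (hp : IsP p) (S : Finset α → Prop) :
    Pr F p S ≤ 1 := by
  rw [← Ex_const F p 1]
  refine Ex_mono hp fun A _ => ?_
  simp only [Set.indicator]; split_ifs <;> norm_num

lemma Pr_not (F : Finset α) (p : α → ℝ) (S : Finset α → Prop) :
    Pr F p (fun A => ¬ S A) = 1 - Pr F p S := by
  unfold Pr
  rw [← Ex_const F p 1, ← Ex_sub]
  refine Ex_congr fun A _ => ?_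
  by_cases h : S A <;> simp [h, Set.indicator, Ex_const]

lemma Pr_or_le {F : Finset α} {p : α → ℝ} (hp : IsP p) (S T : Finset α → Prop) :
    Pr F p (fun A => S A ∨ T A) ≤ Pr F p S + Pr F p T := by
  unfold Pr
  rw [← Ex_add]
  refine Ex_mono hp fun A _ => ?_
  by_cases h : S A <;> by_cases h' : T A <;> simp [h, h', Set.indicator]

lemma Pr_exists_le {κ : Type*} (s : Finset κ) {F : Finset α} {p : α → ℝ} (hp : IsP p)
    (S : κ → Finset α → Prop) :
    Pr F p (fun A => ∃ k ∈ s, S k A) ≤ ∑ k ∈ s, Pr F p (S k) := by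
  unfold Pr
  rw [← Ex_sum]
  refine Ex_mono hp fun A _ => ?_
  by_cases h : ∃ k ∈ s, S k A
  · obtain ⟨k, hk, hS⟩ := h
    have h1 : ∀ i ∈ s, 0 ≤ Set.indicator {A | S i A} (fun _ => (1:ℝ)) A :=
      fun i _ => Set.indicator_nonneg (fun _ _ => zero_le_one) _
    have h2 := Finset.single_le_sum h1 hk
    refine le_trans ?_ h2
    have : ∃ k ∈ s, S k A := ⟨k, hk, hS⟩
    simp [hS, Set.indicator, this]
  · simp only [Set.indicator, Set.mem_ofPred_eq, h, if_false]
    exact Finset.sum_nonneg fun i _ => by split_ifs <;> norm_num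

lemma Pr_indep {F : Finset α} {p : α → ℝ} {S T : Finset α → Prop} (D : Set α)
    (hS : DepOn D S) (hT : DepOn Dᶜ T) :
    Pr F p (fun A => S A ∧ T A) = Pr F p S * Pr F p T := by
  unfold Pr
  rw [← Ex_indep D]
  · refine Ex_congr fun A _ => ?_
    by_cases h : S A <;> by_cases h' : T A <;> simp [h, h', Set.indicator]
  · intro A B h
    have h1 : S A ↔ S B := by rw [hS A B h]
    by_cases h2 : S A
    · simp [h2, h1.1 h2]
    · have h3 : ¬ S B := fun h => h2 (h1.2 h)
      simp [h2, h3]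
  · intro A B h
    have h1 : T A ↔ T B := by rw [hT A B h]
    by_cases h2 : T A
    · simp [h2, h1.1 h2]
    · have h3 : ¬ T B := fun h => h2 (h1.2 h)
      simp [h2, h3]

lemma Pr_markov {F : Finset α} {p : α → ℝ} (hp : IsP p) {f : Finset α → ℝ}
    (h0 : ∀ A, 0 ≤ f A) {c : ℝ} (hc : 0 < c) :
    Pr F p (fun A => c ≤ f A) ≤ Ex F p f / c := by
  rw [le_div_iff₀ hc, Pr, ← Ex_mul_right]
  refine Ex_mono hp fun A _ => ?_
  by_cases h : c ≤ f A
  · simp [h, Set.indicator]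
  · simp [h, Set.indicator, h0 A]

lemma Pr_subset {F : Finset α} {p : α → ℝ} {S : Finset α} (h : S ⊆ F) :
    Pr F p (fun A => S ⊆ A) = ∏ a ∈ S, p a := by
  have e : Pr F p (fun A => S ⊆ A) = Pr S p (fun A => S ⊆ A) := by
    unfold Pr
    rw [← Ex_inter h]
    refine Ex_congr fun A _ => ?_
    simp [Set.indicator, Finset.subset_inter_iff]
  rw [e]
  clear e h
  unfold Pr Ex
  rw [Finset.sum_eq_single S]
  · simp +contextual [Finset.prod_ite_mem, Finset.prod_congr]
  · intro B hB hne
    have : ¬ S ⊆ B := fun h => hne (Finset.Subset.antisymm (Finset.mem_powerset.1 hB) h)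
    simp [this]
  · simp

lemma Pr_none_full {κ : Type*} (I : Finset κ) {F : Finset α} {p : α → ℝ} (hp : IsP p)
    (S : κ → Finset α) (hS : ∀ k ∈ I, S k ⊆ F)
    (hd : ∀ k ∈ I, ∀ l ∈ I, k ≠ l → Disjoint (S k) (S l)) {c : ℝ} 
    (hq : ∀ k ∈ I, c ≤ ∏ a ∈ S k, p a) (hc : c ≤ 1) :
    Pr F p (fun A => ∀ k ∈ I, ¬ S k ⊆ A) ≤ (1 - c) ^ I.card := by
  classical
  induction I using Finset.induction_on with
  | empty => simpa using Pr_le_one hp _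
  | insert k I hk ih =>
    have e : Pr F p (fun A => ∀ l ∈ insert k I, ¬ S l ⊆ A)
        = Pr F p (fun A => (¬ S k ⊆ A) ∧ ∀ l ∈ I, ¬ S l ⊆ A) := by
      refine Pr_congr fun A _ => by simp
    rw [e, Pr_indep (D := (S k : Set α))]
    · rw [Finset.card_insert_of_notMem hk, pow_succ, mul_comm]
      have i1 := ih (fun l hl => hS l (Finset.mem_insert_of_mem hl))
        (fun l hl m hm => hd l (Finset.mem_insert_of_mem hl) m (Finset.mem_insert_of_mem hm))
        (fun l hl => hq l (Finset.mem_insert_of_mem hl))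
      have i2 : Pr F p (fun A => ¬ S k ⊆ A) ≤ 1 - c := by
        rw [Pr_not, Pr_subset (hS k (Finset.mem_insert_self k I))]
        linarith [hq k (Finset.mem_insert_self k I)]
      exact mul_le_mul i1 i2 (Pr_nonneg hp _) (pow_nonneg (by linarith) _)
    · intro A B h
      have : S k ⊆ A ↔ S k ⊆ B := 
        ⟨fun h1 a ha => (h a ha).1 (h1 ha), fun h1 a ha => (h a ha).2 (h1 ha)⟩
      simp [this]
    · intro A B h
      have : ∀ l ∈ I, (S l ⊆ A ↔ S l ⊆ B) := by
        intro l hl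
        have hdis := hd k (Finset.mem_insert_self k I) l (Finset.mem_insert_of_mem hl)
          (fun e => hk (e ▸ hl))
        have hh : ∀ a ∈ S l, a ∈ ((S k : Set α))ᶜ := fun a ha h2 =>
          Finset.disjoint_left.1 hdis h2 ha
        exact ⟨fun h1 a ha => (h a (hh a ha)).1 (h1 ha), fun h1 a ha => (h a (hh a ha)).2 (h1 ha)⟩
      simp only [eq_iff_iff]
      exact forall₂_congr fun l hl => not_congr (this l hl)

/-- pushing forward by a projection: the image is dominated by a product measure. -/
lemma Ex_proj {β : Type*} [DecidableEq β] (π : α → β) (F : Finset β) (G : Finset α)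
    (hG : ∀ a ∈ G, π a ∈ F) {p : α → ℝ} {q : β → ℝ} (hp : IsP p) (hq : IsP q)
    (h : ∀ b ∈ F, 1 - q b ≤ ∏ a ∈ G with π a = b, (1 - p a))
    {f : Finset β → ℝ} (hf : Monotone f) :
    Ex G p (fun A => f (A.image π)) ≤ Ex F q f := by
  induction F using Finset.induction_on generalizing f G with
  | empty =>
    have : G = ∅ := Finset.eq_empty_of_forall_notMem fun a ha => by simpa using hG a ha
    simp [this, Ex_empty]
  | insert b F hb ih =>
    have hGs : G = G.filter (π · = b) ∪ G.filter (¬ π · = b) := by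
      rw [Finset.filter_union_filter_not_eq]
    have hd : Disjoint (G.filter (π · = b)) (G.filter (¬ π · = b)) :=
      Finset.disjoint_filter_filter_not _ _ _
    have hprod := h b (Finset.mem_insert_self b F)
    have key : ∀ f : Finset β → ℝ, Monotone f → 
        Ex (G.filter (¬ π · = b)) p (fun A => f (A.image π)) ≤ Ex F q f := by
      intro f hf
      refine ih _ ?_ ?_ hf
      · intro a ha
        simp only [Finset.mem_filter] at ha
        have := hG a ha.1
        simpa [ha.2] using this
      · intro c hc
        have hcb : c ≠ b := fun e => hb (e ▸ hc)
        have := h c (Finset.mem_insert_of_mem hc)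
        rw [Finset.filter_filter]
        convert this using 2
        ext a; simp; intro _
        intro h; rw [h]; exact hcb
    rw [hGs, Ex_union hd, Ex_insert hb]
    set H := G.filter (π · = b) with hH
    set H' := G.filter (¬ π · = b) with hH'
    have k1 := key f hf
    have k2 := key (fun A => f (insert b A)) (fun A B h => hf (Finset.insert_subset_insert b h))
    set x1 := Ex H' p (fun A => f (A.image π)) with hx1
    set x2 := Ex H' p (fun A => f (insert b (A.image π))) with hx2
    have hx12 : x1 ≤ x2 := Ex_mono hp fun A _ => hf (Finset.subset_insert _ _)
    have hle : Ex H p (fun A => Ex H' p (fun B => f ((A ∪ B).image π)))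
        = Ex H p (fun A => (if A = ∅ then x1 - x2 else 0) + x2) := by
      refine Ex_congr fun A hA => ?_
      by_cases hA0 : A = ∅
      · simp [hA0, hx1]
      · have : A.image π = {b} := by
          ext x; simp only [Finset.mem_image, Finset.mem_singleton]
          constructor
          · rintro ⟨a, ha, rfl⟩
            exact (Finset.mem_filter.1 (hA ha)).2
          · rintro rfl
            obtain ⟨a, ha⟩ := Finset.nonempty_of_ne_empty hA0
            exact ⟨a, ha, (Finset.mem_filter.1 (hA ha)).2⟩
        simp only [Finset.image_union, this, hA0, if_false, zero_add, hx2]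
        simp
    rw [hle, Ex_add, Ex_const]
    have hemp : Ex H p (fun A => if A = ∅ then x1 - x2 else 0)
        = (∏ a ∈ H, (1 - p a)) * (x1 - x2) := by
      unfold Ex
      rw [Finset.sum_eq_single ∅]
      · simp
      · intro B _ hB; simp [hB]
      · simp
    rw [hemp]
    have hP1 : ∏ a ∈ H, (1 - p a) ≤ 1 :=
      Finset.prod_le_one (fun a _ => by linarith [(hp a).2]) (fun a _ => by linarith [(hp a).1])
    have := (hq b).1
    have := (hq b).2
    nlinarith

end ExLib

end TP

namespace TP

open TorusPerc (stdVec)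

section Geo

variable {d : ℕ}

abbrev V (d : ℕ) := Fin d → ℤ
abbrev E (d : ℕ) := (Fin d → ℤ) × Fin d

/-- one step along an edge of `A` -/
def stp (A : Set (E d)) (x y : V d) : Prop :=
  (∃ i, y = x + stdVec d i ∧ (x, i) ∈ A) ∨ (∃ i, x = y + stdVec d i ∧ (y, i) ∈ A)

/-- connectivity by edges of `A` -/
def cn (A : Set (E d)) : V d → V d → Prop := Relation.ReflTransGen (stp A)

lemma stp_mono {A B : Set (E d)} (h : A ⊆ B) {x y : V d} (hs : stp A x y) : stp B x y := by
  rcases hs with ⟨i, h1, h2⟩ | ⟨i, h1, h2⟩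
  · exact Or.inl ⟨i, h1, h h2⟩
  · exact Or.inr ⟨i, h1, h h2⟩

lemma stp_symm {A : Set (E d)} {x y : V d} (hs : stp A x y) : stp A y x := Or.symm hs

lemma cn_mono {A B : Set (E d)} (h : A ⊆ B) {x y : V d} (hs : cn A x y) : cn B x y :=
  Relation.ReflTransGen.mono (fun _ _ h1 => stp_mono h h1) _ _ hs

lemma cn_symm {A : Set (E d)} {x y : V d} (hs : cn A x y) : cn A y x := by
  unfold cn at *
  induction hs with
  | refl => exact Relation.ReflTransGen.refl
  | tail _ h ih => exact Relation.ReflTransGen.head (stp_symm h) ih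

lemma cn_refl (A : Set (E d)) (x : V d) : cn A x x := Relation.ReflTransGen.refl

lemma cn_trans {A : Set (E d)} {x y z : V d} (h : cn A x y) (h' : cn A y z) : cn A x z :=
  Relation.ReflTransGen.trans h h'

lemma cn_of_stp {A : Set (E d)} {x y : V d} (h : stp A x y) : cn A x y :=
  Relation.ReflTransGen.single h

/-- edges with both endpoints in `W` -/
def inn (W : Set (V d)) : Set (E d) := {e | e.1 ∈ W ∧ e.1 + stdVec d e.2 ∈ W}

lemma mem_inn {W : Set (V d)} {e : E d} : e ∈ inn W ↔ e.1 ∈ W ∧ e.1 + stdVec d e.2 ∈ W := Iff.rfl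

lemma inn_mono {W W' : Set (V d)} (h : W ⊆ W') : inn W ⊆ inn W' := fun _ he => ⟨h he.1, h he.2⟩

lemma stp_inn {A : Set (E d)} {W : Set (V d)} (hA : A ⊆ inn W) {x y : V d} (h : stp A x y) :
    x ∈ W ∧ y ∈ W := by
  rcases h with ⟨i, rfl, h2⟩ | ⟨i, rfl, h2⟩
  · exact hA h2
  · exact (hA h2).symm

lemma stp_inter_inn {A : Set (E d)} {W : Set (V d)} {x y : V d} (h : stp A x y) (hx : x ∈ W)
    (hy : y ∈ W) : stp (A ∩ inn W) x y := by
  rcases h with ⟨i, rfl, h2⟩ | ⟨i, rfl, h2⟩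
  · exact Or.inl ⟨i, rfl, h2, hx, hy⟩
  · exact Or.inr ⟨i, rfl, h2, hy, hx⟩

lemma stp_coord {A : Set (E d)} {x y : V d} (h : stp A x y) (k : Fin d) :
    |y k - x k| ≤ 1 := by
  rcases h with ⟨i, rfl, h2⟩ | ⟨i, rfl, h2⟩ <;>
    (simp only [stdVec, Pi.add_apply]; split_ifs <;> simp)

/-- last exit decomposition -/
lemma last_exit {A : Set (E d)} {R : Set (V d)} {x y : V d} (h : cn A x y) (hx : x ∈ R)
    (hy : y ∉ R) : ∃ u w, u ∈ R ∧ w ∉ R ∧ stp A u w ∧ cn (A ∩ inn Rᶜ) w y ∧ cn A x u := by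
  have key : (x ∉ R ∧ cn (A ∩ inn Rᶜ) x y) ∨
      ∃ u w, u ∈ R ∧ w ∉ R ∧ stp A u w ∧ cn (A ∩ inn Rᶜ) w y ∧ cn A x u := by
    clear hx
    induction h using Relation.ReflTransGen.head_induction_on with
    | refl => exact Or.inl ⟨hy, cn_refl _ _⟩
    | head h1 h2 ih =>
      rename_i a c
      rcases ih with ⟨hc, h3⟩ | ⟨u, w, h4, h5, h6, h7, h8⟩
      · by_cases ha : a ∈ R
        · exact Or.inr ⟨a, c, ha, hc, h1, h3, cn_refl _ _⟩
        · exact Or.inl ⟨ha, Relation.ReflTransGen.head (stp_inter_inn h1 ha hc) h3⟩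
      · exact Or.inr ⟨u, w, h4, h5, h6, h7, Relation.ReflTransGen.head h1 h8⟩
  rcases key with ⟨h1, _⟩ | h1
  · exact absurd hx h1
  · exact h1

lemma first_exit {A : Set (E d)} {W : Set (V d)} {x y : V d} (h : cn A x y) (hx : x ∈ W)
    (hy : y ∉ W) : ∃ u w, u ∈ W ∧ w ∉ W ∧ stp A u w ∧ cn (A ∩ inn W) x u := by
  obtain ⟨u, w, h1, h2, h3, h4, -⟩ := last_exit (R := Wᶜ) (cn_symm h) hy (by simpa using hx)
  refine ⟨w, u, by simpa using h2, h1, stp_symm h3, cn_symm ?_⟩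
  simpa using h4

/-- the box of radius `n` about `z` -/
noncomputable def bx (z : V d) (n : ℕ) : Finset (V d) := Finset.Icc (fun k => z k - n) (fun k => z k + n)

lemma mem_bx {z : V d} {n : ℕ} {v : V d} : v ∈ bx z n ↔ ∀ k, |v k - z k| ≤ n := by
  simp only [bx, Finset.mem_Icc, Pi.le_def, abs_le]
  rw [← forall_and]
  refine forall_congr' fun k => ?_
  constructor <;> rintro ⟨h1, h2⟩ <;> constructor <;> linarith

/-- edges inside a finite vertex set -/
def ew (W : Finset (V d)) : Finset (E d) :=
  (W ×ˢ Finset.univ).filter (fun e => e.1 + stdVec d e.2 ∈ W)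

lemma mem_ew {W : Finset (V d)} {e : E d} : e ∈ ew W ↔ e.1 ∈ W ∧ e.1 + stdVec d e.2 ∈ W := by
  simp [ew]

lemma coe_ew (W : Finset (V d)) : (ew W : Set (E d)) = inn (W : Set (V d)) := by
  ext e; simp [mem_ew, mem_inn]

lemma ew_mono {W W' : Finset (V d)} (h : W ⊆ W') : ew W ⊆ ew W' := fun e he => by
  rw [mem_ew] at *; exact ⟨h he.1, h he.2⟩

/-- edges in a box -/
noncomputable def eb (z : V d) (n : ℕ) : Finset (E d) := ew (bx z n)

lemma mem_eb {z : V d} {n : ℕ} {e : E d} :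
    e ∈ eb z n ↔ e.1 ∈ bx z n ∧ e.1 + stdVec d e.2 ∈ bx z n := mem_ew

lemma coe_eb (z : V d) (n : ℕ) : (eb z n : Set (E d)) = inn (bx z n : Set (V d)) := coe_ew _

lemma bx_mono {z : V d} {n m : ℕ} (h : n ≤ m) : bx z n ⊆ bx z m := fun v hv => by
  rw [mem_bx] at *; intro k; exact (hv k).trans (by exact_mod_cast h)

lemma bx_self (z : V d) (n : ℕ) : z ∈ bx z n := by rw [mem_bx]; simp

lemma eb_mono {z : V d} {n m : ℕ} (h : n ≤ m) : eb z n ⊆ eb z m := ew_mono (bx_mono h)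

/-- boundary of the box centred at the origin -/
noncomputable def sph (d n : ℕ) : Finset (V d) := (bx 0 n).filter (fun y => ∃ j, |y j| = (n : ℤ))

lemma mem_sph {n : ℕ} {y : V d} : y ∈ sph d n ↔ y ∈ bx 0 n ∧ ∃ j, |y j| = (n : ℤ) := by
  simp [sph]

lemma sph_of_exit {A : Set (E d)} {n : ℕ} {u w : V d} (hu : u ∈ bx 0 n) (hw : w ∉ bx 0 n)
    (h : stp A u w) : u ∈ sph d n := by
  rw [mem_sph]
  refine ⟨hu, ?_⟩
  rw [mem_bx] at hu hw
  push Not at hw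
  obtain ⟨k, hk⟩ := hw
  refine ⟨k, ?_⟩
  have h1 := hu k
  have h2 := stp_coord h k
  simp only [Pi.zero_apply, sub_zero] at *
  rw [abs_le] at h2
  rcases abs_cases (w k) with h3 | h3 <;> rcases abs_cases (u k) with h4 | h4 <;> omega

lemma sph_not_mem {n m : ℕ} (h : n < m) {y : V d} (hy : y ∈ sph d m) : y ∉ bx 0 n := by
  rw [mem_sph] at hy
  obtain ⟨-, j, hj⟩ := hy
  rw [mem_bx]; intro h1
  have := h1 j
  simp only [Pi.zero_apply, sub_zero] at this
  omega

/-- all edges open in an order interval: everything is connected -/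
lemma cn_Icc (a b : V d) (x y : V d) (hx : x ∈ Finset.Icc a b) (hy : y ∈ Finset.Icc a b) :
    cn (ew (Finset.Icc a b) : Set (E d)) x y := by
  rw [coe_ew]
  rw [Finset.mem_Icc] at hx hy
  have one : ∀ (m : ℕ) (x : V d) (i : Fin d), a ≤ x → x + (m : ℤ) • stdVec d i ≤ b →
      cn (inn ((Finset.Icc a b : Finset (V d)) : Set (V d))) x (x + (m : ℤ) • stdVec d i) := by
    intro m
    induction m with
    | zero => intro x i _ _; simpa using cn_refl _ _
    | succ m ih =>
      intro x i h1 h2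
      have hs : (0 : V d) ≤ stdVec d i := fun k => by simp only [stdVec]; split_ifs <;> simp
      have e : x + ((m + 1 : ℕ) : ℤ) • stdVec d i = x + (m : ℤ) • stdVec d i + stdVec d i := by
        push_cast; rw [add_smul, one_smul, add_assoc]
      rw [e] at h2 ⊢
      have h3 : x + (m : ℤ) • stdVec d i ≤ b := le_trans (le_add_of_nonneg_right hs) h2
      refine Relation.ReflTransGen.tail (ih x i h1 h3) (Or.inl ⟨i, rfl, ?_⟩)
      have h4 : a ≤ x + (m : ℤ) • stdVec d i := 
        le_trans h1 (le_add_of_nonneg_right (smul_nonneg (by positivity) hs))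
      have h5 : a ≤ x + (m : ℤ) • stdVec d i + stdVec d i := 
        le_trans h4 (le_add_of_nonneg_right hs)
      exact ⟨Finset.mem_coe.2 (Finset.mem_Icc.2 ⟨h4, h3⟩), Finset.mem_coe.2 (Finset.mem_Icc.2 ⟨h5, h2⟩)⟩
  -- change one coordinate
  have upd : ∀ (x : V d) (i : Fin d) (c : ℤ), a ≤ x → x ≤ b → a i ≤ c → c ≤ b i →
      cn (inn ((Finset.Icc a b : Finset (V d)) : Set (V d))) x (Function.update x i c) := by
    intro x i c h1 h2 h3 h4
    rcases le_total (x i) c with h | h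
    · have e : Function.update x i c = x + (((c - x i).toNat : ℕ) : ℤ) • stdVec d i := by
        ext k; by_cases hk : k = i
        · subst hk; simp [stdVec, h]
        · simp [stdVec, hk]
      rw [e]; apply one _ _ _ h1; rw [← e]
      exact update_le_iff.2 ⟨h4, fun k _ => h2 k⟩
    · have e : x = Function.update x i c + (((x i - c).toNat : ℕ) : ℤ) • stdVec d i := by
        ext k; by_cases hk : k = i
        · subst hk; simp [stdVec, h]
        · simp [stdVec, hk]
      apply cn_symm
      have := one ((x i - c).toNat) (Function.update x i c) i
        (le_update_iff.2 ⟨h3, fun k _ => h1 k⟩) (by rw [← e]; exact h2)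
      rwa [← e] at this
  have main : ∀ s : Finset (Fin d), cn (inn ((Finset.Icc a b : Finset (V d)) : Set (V d))) x
      (fun k => if k ∈ s then y k else x k) := by
    intro s
    induction s using Finset.induction_on with
    | empty => simpa using cn_refl _ _
    | insert i s hi ih =>
      have hm1 : a ≤ (fun k => if k ∈ s then y k else x k) := fun k => by
        dsimp; split_ifs; exacts [hy.1 k, hx.1 k]
      have hm2 : (fun k => if k ∈ s then y k else x k) ≤ b := fun k => by
        dsimp; split_ifs; exacts [hy.2 k, hx.2 k]
      have := cn_trans ih (upd _ i (y i) hm1 hm2 (hy.1 i) (hy.2 i))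
      convert this using 1
      ext k; by_cases hk : k = i
      · subst hk; simp
      · simp [hk]
  simpa using main Finset.univ

lemma cn_bx {z : V d} {n : ℕ} {x y : V d} (hx : x ∈ bx z n) (hy : y ∈ bx z n) :
    cn (eb z n : Set (E d)) x y := cn_Icc _ _ _ _ hx hy

end Geo

/-- bridge between the `finsum` probability and `Pr` -/
lemma bridge {ι : Type*} [Fintype ι] [DecidableEq ι] (p : ℝ) (S : Set (ι → Bool)) :
    (∑ᶠ ω ∈ S, ∏ᶠ e : ι, (if ω e then p else 1 - p))
      = Pr Finset.univ (fun _ : ι => p) (fun A => (fun e => decide (e ∈ A)) ∈ S) := by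
  classical
  rw [finsum_mem_def, finsum_eq_sum_of_fintype]
  unfold Pr Ex
  rw [Finset.powerset_univ]
  symm
  refine Finset.sum_bij' (fun A _ => (fun e => decide (e ∈ A)))
    (fun ω _ => Finset.univ.filter (fun e => ω e = true)) ?_ ?_ ?_ ?_ ?_
  · simp
  · simp
  · intro A _; ext; simp
  · intro ω _; ext; simp
  · intro A _
    rw [Set.indicator_apply, Set.indicator_apply, finprod_eq_prod_of_fintype]
    simp

end TP

namespace TP

open TorusPerc (stdVec)

section More
variable {α : Type*} [DecidableEq α]

lemma Pr_inter {F G : Finset α} (h : G ⊆ F) (p : α → ℝ) (S : Finset α → Prop) :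
    Pr F p (fun A => S (A ∩ G)) = Pr G p S := by
  unfold Pr
  rw [← Ex_inter h]
  rfl

lemma Pr_add_le {F : Finset α} {p : α → ℝ} (hp : IsP p) {S T Q : Finset α → Prop}
    (h1 : ∀ A, A ⊆ F → S A → Q A) (h2 : ∀ A, A ⊆ F → T A → Q A)
    (h3 : ∀ A, A ⊆ F → S A → ¬ T A) : Pr F p S + Pr F p T ≤ Pr F p Q := by
  unfold Pr
  rw [← Ex_add]
  refine Ex_mono hp fun A hA => ?_
  by_cases hS : S A
  · simp [hS, h1 A hA hS, h3 A hA hS]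
  · by_cases hT : T A
    · simp [hS, hT, h2 A hA hT]
    · simp only [Set.indicator, Set.mem_ofPred_eq, hS, hT, if_false]
      split_ifs <;> norm_num

lemma Pr_disjoint {F : Finset α} {p : α → ℝ} {S : Finset α} (h : S ⊆ F) :
    Pr F p (fun A => Disjoint S A) = ∏ a ∈ S, (1 - p a) := by
  have e : Pr F p (fun A => Disjoint S A) = Pr S p (fun A => A = ∅) := by
    rw [← Pr_inter h]
    refine Pr_congr fun A _ => ?_
    rw [Finset.disjoint_iff_inter_eq_empty, Finset.inter_comm]
  rw [e]
  unfold Pr Ex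
  rw [Finset.sum_eq_single ∅]
  · simp
  · intro B hB hne; simp [hne]
  · simp

end More

section PartA

variable {d : ℕ}

lemma cn_inn {A : Set (E d)} {W : Set (V d)} (hA : A ⊆ inn W) {x y : V d} (hx : x ∈ W)
    (h : cn A x y) : y ∈ W := by
  induction h with
  | refl => exact hx
  | tail _ h _ => exact (stp_inn hA h).2

/-- probability to reach the boundary -/
noncomputable def th (d : ℕ) (p : ℝ) (m : ℕ) : ℝ :=
  Pr (eb (0 : V d) m) (fun _ => p) (fun A => ∃ y ∈ sph d m, cn (A : Set (E d)) 0 y)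

lemma inBox_iff (M : ℕ) (e : E d) : ZLattice.inBox d M e ↔ e ∈ eb (0 : V d) M := by
  simp [ZLattice.inBox, mem_eb, mem_bx]

lemma theta_bridge (M : ℕ) (p : ℝ) :
    ZLattice.prob d M p (ZLattice.reachBoundary d M) = th d p M := by
  classical
  have : Fintype {e : E d // ZLattice.inBox d M e} :=
    Fintype.ofFinset (p := {e | ZLattice.inBox d M e}) (eb 0 M) (fun e => (inBox_iff M e).symm)
  have him : eb (0 : V d) M
      = (Finset.univ : Finset {e : E d // ZLattice.inBox d M e}).image Subtype.val := by
    ext e; simp [← inBox_iff]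
  unfold ZLattice.prob th
  rw [bridge]
  conv_rhs => rw [him]
  unfold Pr
  rw [Ex_image (Subtype.val_injective.injOn)]
  refine Ex_congr fun A _ => ?_
  have hstep : ∀ x y, ZLattice.step d M (fun e => decide (e ∈ A)) x y
      ↔ stp ((A.image Subtype.val : Finset (E d)) : Set (E d)) x y := by
    intro x y
    simp [ZLattice.step, ZLattice.edgeOpen, stp]
  have hcn : ZLattice.connected d M (fun e => decide (e ∈ A))
      = cn ((A.image Subtype.val : Finset (E d)) : Set (E d)) := by
    unfold ZLattice.connected cn
    congr 1
    ext x y; exact hstep x y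
  have hsub : ((A.image Subtype.val : Finset (E d)) : Set (E d))
      ⊆ inn (bx (0 : V d) M : Set (V d)) := by
    rw [← coe_eb, him]
    exact_mod_cast Finset.image_subset_image (Finset.subset_univ _)
  have : ((fun e => decide (e ∈ A)) ∈ ZLattice.reachBoundary d M) ↔
      ∃ y ∈ sph d M, cn ((A.image Subtype.val : Finset (E d)) : Set (E d)) 0 y := by
    simp only [ZLattice.reachBoundary, Set.mem_ofPred_eq, hcn]
    constructor
    · rintro ⟨y, h1, h2⟩
      refine ⟨y, mem_sph.2 ⟨?_, h1⟩, h2⟩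
      exact_mod_cast cn_inn hsub (by exact_mod_cast bx_self 0 M) h2
    · rintro ⟨y, h1, h2⟩
      exact ⟨y, (mem_sph.1 h1).2, h2⟩
  simp only [Set.indicator, Set.mem_ofPred_eq]
  exact if_congr this rfl rfl

open Classical in
/-- boundary points connected to the small box -/
noncomputable def XS (K m : ℕ) (A : Finset (E d)) : Finset (V d) :=
  (sph d m).filter (fun y => ∃ x ∈ bx (0 : V d) K, cn (A : Set (E d)) x y)

lemma mem_XS {K m : ℕ} {A : Finset (E d)} {y : V d} : y ∈ XS K m A ↔
    y ∈ sph d m ∧ ∃ x ∈ bx (0 : V d) K, cn (A : Set (E d)) x y := by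
  simp [XS]

lemma isP_const {α : Type*} {p : ℝ} (h0 : 0 ≤ p) (h1 : p ≤ 1) : IsP (fun _ : α => p) :=
  fun _ => ⟨h0, h1⟩

lemma A1 {p : ℝ} (h0 : 0 ≤ p) (h1 : p ≤ 1) {K m : ℕ} (hKm : K < m) :
    th d p m ≤ th d p K * 
      Pr (eb (0 : V d) m) (fun _ => p) (fun A => (XS K m A).Nonempty) := by
  have hp : IsP (fun _ : E d => p) := isP_const h0 h1
  have hsub : eb (0 : V d) K ⊆ eb 0 m := eb_mono hKm.le
  set D : Set (E d) := (eb (0 : V d) K : Set (E d)) with hD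
  -- event using only outer edges
  set H : Finset (E d) → Prop := fun A =>
    ∃ x ∈ bx (0 : V d) K, ∃ y ∈ sph d m, cn ((A : Set (E d)) ∩ Dᶜ) x y with hH
  have e1 : th d p m ≤ Pr (eb (0 : V d) m) (fun _ => p)
      (fun A => (∃ y ∈ sph d K, cn ((A ∩ eb (0 : V d) K : Finset (E d)) : Set (E d)) 0 y) ∧ H A) := by
    refine Pr_mono hp fun A hA => ?_
    rintro ⟨y, hy, hc⟩
    have hyK := sph_not_mem hKm hy
    have hx : (0 : V d) ∈ (bx (0 : V d) K : Set (V d)) := by exact_mod_cast bx_self 0 K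
    have hyK' : y ∉ (bx (0 : V d) K : Set (V d)) := by exact_mod_cast hyK
    constructor
    · obtain ⟨u, w, hu, hw, hs, hcu⟩ := first_exit hc hx hyK'
      refine ⟨u, sph_of_exit (by exact_mod_cast hu) (by exact_mod_cast hw) hs, ?_⟩
      rw [Finset.coe_inter, coe_eb]; exact hcu
    · obtain ⟨u, w, hu, hw, hs, hcw, -⟩ := last_exit hc hx hyK'
      refine ⟨u, by exact_mod_cast hu, y, hy, ?_⟩
      refine Relation.ReflTransGen.head (b := w) ?_ (cn_mono ?_ hcw)
      · rcases hs with ⟨i, h1, h2⟩ | ⟨i, h1, h2⟩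
        · refine Or.inl ⟨i, h1, h2, ?_⟩
          rw [hD, coe_eb]; rintro ⟨h3, h4⟩; exact hw (h1 ▸ h4)
        · refine Or.inr ⟨i, h1, h2, ?_⟩
          rw [hD, coe_eb]; rintro ⟨h3, h4⟩; exact hw h3
      · rintro e ⟨h1, h2⟩
        refine ⟨h1, ?_⟩
        rw [hD, coe_eb]; exact fun h => h2.1 h.1
  rw [Pr_indep D] at e1
  · rw [Pr_inter hsub (fun _ => p) (fun A => ∃ y ∈ sph d K, cn (A : Set (E d)) 0 y)] at e1
    refine e1.trans (mul_le_mul_of_nonneg_left ?_ (Pr_nonneg hp _))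
    refine Pr_mono hp fun A hA => ?_
    rintro ⟨x, hx, y, hy, hc⟩
    exact ⟨y, mem_XS.2 ⟨hy, x, hx, cn_mono Set.inter_subset_left hc⟩⟩
  · intro A B hAB
    have : A ∩ eb (0 : V d) K = B ∩ eb (0 : V d) K := by
      ext e; simp only [Finset.mem_inter]
      constructor
      · rintro ⟨h1, h2⟩; exact ⟨(hAB e h2).1 h1, h2⟩
      · rintro ⟨h1, h2⟩; exact ⟨(hAB e h2).2 h1, h2⟩
    simp only [this]
  · intro A B hAB
    have : (A : Set (E d)) ∩ Dᶜ = (B : Set (E d)) ∩ Dᶜ := by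
      ext e
      constructor
      · rintro ⟨h1, h2⟩; exact ⟨(hAB e h2).1 h1, h2⟩
      · rintro ⟨h1, h2⟩; exact ⟨(hAB e h2).2 h1, h2⟩
    simp only [hH, this]

open Classical in
lemma A2 {p : ℝ} (h0 : 0 ≤ p) (h1 : p ≤ 1) {K m : ℕ} (hKm : K < m) (t : ℕ) :
    (1 - p) ^ (2 * d * t) * Pr (eb (0 : V d) m) (fun _ => p)
        (fun A => (XS K m A).Nonempty ∧ (XS K m A).card < t)
      ≤ Pr (eb (0 : V d) m) (fun _ => p) (fun A => (XS K m A).Nonempty)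
        - Pr (eb (0 : V d) (m+1)) (fun _ => p) (fun A => (XS K (m+1) A).Nonempty) := by
  have hp : IsP (fun _ : E d => p) := isP_const h0 h1
  have hsub : eb (0 : V d) m ⊆ eb 0 (m+1) := eb_mono (Nat.le_succ m)
  set G := eb (0 : V d) (m+1) \ eb 0 m with hG
  set S : Finset (V d) → Finset (E d) := fun X =>
    G.filter (fun e => e.1 ∈ X ∨ e.1 + stdVec d e.2 ∈ X) with hS
  have hScard : ∀ X : Finset (V d), (S X).card ≤ 2 * d * X.card := by
    intro X
    have : S X ⊆ (X ×ˢ Finset.univ) ∪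
        (X ×ˢ (Finset.univ : Finset (Fin d))).image (fun e => (e.1 - stdVec d e.2, e.2)) := by
      intro e he
      rcases (Finset.mem_filter.1 he).2 with h | h
      · simp [h]
      · refine Finset.mem_union_right _ (Finset.mem_image.2 ⟨(e.1 + stdVec d e.2, e.2), ?_, ?_⟩)
        · simp [h]
        · simp
    refine (Finset.card_le_card this).trans ((Finset.card_union_le _ _).trans ?_)
    have := Finset.card_image_le (s := X ×ˢ (Finset.univ : Finset (Fin d)))
      (f := fun e : E d => ((e.1 - stdVec d e.2, e.2) : E d))
    simp only [Finset.card_product, Finset.card_univ, Fintype.card_fin] at *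
    linarith [mul_comm X.card d, mul_assoc 2 d X.card]
  have hexit : ∀ A, A ⊆ eb (0 : V d) (m+1) → (XS K (m+1) A).Nonempty →
      ∃ u ∈ XS K m (A ∩ eb (0 : V d) m), ∃ e ∈ A, e ∈ S (XS K m (A ∩ eb (0 : V d) m)) := by
    rintro A hA ⟨y, hy⟩
    obtain ⟨hy, x, hx, hc⟩ := mem_XS.1 hy
    have hxm : x ∈ (bx (0 : V d) m : Set (V d)) := by exact_mod_cast bx_mono hKm.le hx
    have hym : y ∉ (bx (0 : V d) m : Set (V d)) := by
      exact_mod_cast sph_not_mem (Nat.lt_succ_self m) hy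
    obtain ⟨u, w, hu, hw, hs, hcu⟩ := first_exit hc hxm hym
    have huX : u ∈ XS K m (A ∩ eb (0 : V d) m) := by
      refine mem_XS.2 ⟨sph_of_exit (by exact_mod_cast hu) (by exact_mod_cast hw) hs, x, hx, ?_⟩
      rw [Finset.coe_inter, coe_eb]; exact hcu
    refine ⟨u, huX, ?_⟩
    rcases hs with ⟨i, h1, h2⟩ | ⟨i, h1, h2⟩
    · refine ⟨(u, i), h2, Finset.mem_filter.2 ⟨?_, Or.inl huX⟩⟩
      rw [hG, Finset.mem_sdiff]
      refine ⟨hA h2, fun h => hw ?_⟩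
      have := (mem_eb.1 h).2
      rw [h1]; exact_mod_cast this
    · refine ⟨(w, i), h2, Finset.mem_filter.2 ⟨?_, Or.inr (by rw [← h1]; exact huX)⟩⟩
      rw [hG, Finset.mem_sdiff]
      exact ⟨hA h2, fun h => hw (mem_eb.1 h).1⟩
  have hadd : Pr (eb (0 : V d) (m+1)) (fun _ => p) (fun A => (XS K (m+1) A).Nonempty)
      + Pr (eb (0 : V d) (m+1)) (fun _ => p) (fun A =>
        ((XS K m (A ∩ eb (0 : V d) m)).Nonempty ∧ (XS K m (A ∩ eb (0 : V d) m)).card < t) ∧ 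
          Disjoint (S (XS K m (A ∩ eb (0 : V d) m))) A)
      ≤ Pr (eb (0 : V d) (m+1)) (fun _ => p) (fun A => (XS K m (A ∩ eb (0 : V d) m)).Nonempty) := by
    refine Pr_add_le hp ?_ ?_ ?_
    · intro A hA h
      obtain ⟨u, hu, -⟩ := hexit A hA h
      exact ⟨u, hu⟩
    · rintro A hA ⟨⟨h, -⟩, -⟩; exact h
    · rintro A hA h ⟨-, h2⟩
      obtain ⟨u, hu, e, he, he2⟩ := hexit A hA h
      exact Finset.disjoint_left.1 h2 he2 he
  rw [Pr_inter hsub (fun _ => p) (fun A => (XS K m A).Nonempty)] at hadd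
  have hU : (1 - p) ^ (2 * d * t) * Pr (eb (0 : V d) m) (fun _ => p)
        (fun A => (XS K m A).Nonempty ∧ (XS K m A).card < t) ≤
      Pr (eb (0 : V d) (m+1)) (fun _ => p) (fun A =>
        ((XS K m (A ∩ eb (0 : V d) m)).Nonempty ∧ (XS K m (A ∩ eb (0 : V d) m)).card < t) ∧ 
          Disjoint (S (XS K m (A ∩ eb (0 : V d) m))) A) := by
    have hun : eb (0 : V d) (m+1) = eb (0 : V d) m ∪ G := by
      rw [hG]; exact (Finset.union_sdiff_of_subset hsub).symm
    have hdis : Disjoint (eb (0 : V d) m) G := Finset.disjoint_sdiff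
    unfold Pr
    rw [hun, Ex_union hdis, ← Ex_mul_left]
    refine Ex_mono hp fun A hA => ?_
    have hAB : ∀ B, B ⊆ G → (A ∪ B) ∩ eb (0 : V d) m = A := by
      intro B hB
      rw [Finset.union_inter_distrib_right, Finset.inter_eq_left.2 hA]
      have : B ∩ eb (0 : V d) m = ∅ := by
        rw [← Finset.disjoint_iff_inter_eq_empty]
        exact (hdis.mono_right hB).symm
      simp [this]
    by_cases hX : (XS K m A).Nonempty ∧ (XS K m A).card < t
    · have e : Ex G (fun _ => p) (fun B => Set.indicator {A |
          ((XS K m (A ∩ eb (0 : V d) m)).Nonempty ∧ (XS K m (A ∩ eb (0 : V d) m)).card < t) ∧ 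
          Disjoint (S (XS K m (A ∩ eb (0 : V d) m))) A} (fun _ => (1:ℝ)) (A ∪ B))
          = Pr G (fun _ => p) (fun B => Disjoint (S (XS K m A)) B) := by
        refine Ex_congr fun B hB => ?_
        simp only [Set.indicator, Set.mem_ofPred_eq]
        rw [hAB B hB]
        refine if_congr ?_ rfl rfl
        rw [Finset.disjoint_union_right]
        have : Disjoint (S (XS K m A)) A := (hdis.mono hA (Finset.filter_subset _ _)).symm
        exact ⟨fun h => h.2.2, fun h => ⟨hX, this, h⟩⟩
      rw [e, Pr_disjoint (Finset.filter_subset _ _)]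
      simp only [Set.indicator, Set.mem_ofPred_eq, hX, and_self, if_true, mul_one, Finset.prod_const]
      refine pow_le_pow_of_le_one (by linarith) (by linarith) ?_
      exact (hScard _).trans (Nat.mul_le_mul_left _ hX.2.le)
    · have : Set.indicator {A | (XS K m A).Nonempty ∧ (XS K m A).card < t} (fun _ => (1:ℝ)) A = 0 := by
        simp only [Set.indicator, Set.mem_ofPred_eq, hX, if_false]
      rw [this, mul_zero]
      exact Ex_nonneg hp fun B _ => Set.indicator_nonneg (fun _ _ => zero_le_one) _
  linarith

/-- most of the time many boundary points are connected to a big box -/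
lemma A12 {p : ℝ} (h0 : 0 < p) (h1 : p < 1) {θ : ℝ} (hθ : 0 < θ) (hth : ∀ n, θ ≤ th d p n)
    (hinf : ∀ δ > 0, ∃ n, th d p n < θ + δ) {η : ℝ} (hη : 0 < η) :
    ∃ K : ℕ, ∀ t : ℕ, ∃ n0, ∀ n ≥ n0, 
      Pr (eb (0 : V d) n) (fun _ => p) (fun A => (XS K n A).card < t) ≤ η := by
  have hp : IsP (fun _ : E d => p) := isP_const h0.le h1.le
  obtain ⟨K, hK⟩ := hinf (θ * (η / 2)) (by positivity)
  refine ⟨K, fun t => ?_⟩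
  set a : ℕ → ℝ := fun m => Pr (eb (0 : V d) m) (fun _ => p) (fun A => (XS K m A).Nonempty)
  have ha0 : ∀ m, 0 ≤ a m := fun m => Pr_nonneg hp _
  have ha1 : ∀ m, K < m → 1 - a m ≤ η / 2 := by
    intro m hm
    have h2 := A1 (d := d) h0.le h1.le hm
    have h3 := hth m
    have h4 := hth K
    have h5 : a m ≤ 1 := Pr_le_one hp _
    change th d p m ≤ th d p K * a m at h2
    have : θ ≤ (θ + θ * (η/2)) * a m := by nlinarith [ha0 m]
    have : 1 ≤ (1 + η/2) * a m := by
      by_contra hcon; push Not at hcon; nlinarith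
    nlinarith
  have hdec : ∀ m, K < m → (1 - p) ^ (2 * d * t) * Pr (eb (0 : V d) m) (fun _ => p)
        (fun A => (XS K m A).Nonempty ∧ (XS K m A).card < t) ≤ a m - a (m+1) :=
    fun m hm => A2 h0.le h1.le hm t
  set c := (1 - p) ^ (2 * d * t) with hc
  have hc0 : 0 < c := pow_pos (by linarith) _
  -- antitone bounded sequence
  have hanti : Antitone (fun k => a (k + (K+1))) := by
    refine antitone_nat_of_succ_le fun k => ?_
    have := hdec (k + (K+1)) (by omega)
    have h5 : 0 ≤ c * Pr (eb (0 : V d) (k + (K+1))) (fun _ => p)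
        (fun A => (XS K (k + (K+1)) A).Nonempty ∧ (XS K (k + (K+1)) A).card < t) :=
      mul_nonneg hc0.le (Pr_nonneg hp _)
    have e : k + 1 + (K + 1) = k + (K+1) + 1 := by ring
    rw [e]; linarith
  have hlim := tendsto_atTop_ciInf hanti ⟨0, by rintro _ ⟨k, rfl⟩; exact ha0 _⟩
  have hlim2 := hlim.sub (hlim.comp (Filter.tendsto_add_atTop_nat 1))
  rw [sub_self] at hlim2
  have hev := hlim2.eventually (gt_mem_nhds (show (0:ℝ) < c * (η/2) by positivity))
  obtain ⟨n1, hn1⟩ := Filter.eventually_atTop.1 hev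
  refine ⟨n1 + (K+1), fun n hn => ?_⟩
  have h2 : a n - a (n+1) < c * (η/2) := by
    have := hn1 (n - (K+1)) (by omega)
    simp only [Function.comp] at this
    have e1 : n - (K+1) + (K+1) = n := by omega
    have e2 : n - (K+1) + 1 + (K+1) = n + 1 := by omega
    rwa [e1, e2] at this
  have h3 := hdec n (by omega)
  have h4 : Pr (eb (0 : V d) n) (fun _ => p)
        (fun A => (XS K n A).Nonempty ∧ (XS K n A).card < t) ≤ η/2 :=
    le_of_mul_le_mul_left (h3.trans h2.le) hc0
  have h5 := ha1 n (by omega)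
  have h6 : Pr (eb (0 : V d) n) (fun _ => p) (fun A => (XS K n A).card < t) ≤
      Pr (eb (0 : V d) n) (fun _ => p) (fun A => ¬ (XS K n A).Nonempty ∨ 
        ((XS K n A).Nonempty ∧ (XS K n A).card < t)) := by
    refine Pr_mono hp fun A _ h => ?_
    by_cases h' : (XS K n A).Nonempty
    · exact Or.inr ⟨h', h⟩
    · exact Or.inl h'
  have h7 := Pr_or_le (F := eb (0 : V d) n) hp (fun A => ¬ (XS K n A).Nonempty) 
    (fun A => (XS K n A).Nonempty ∧ (XS K n A).card < t)
  rw [Pr_not] at h7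
  change _ ≤ 1 - a n + _ at h7
  linarith

end PartA

end TP

namespace TP

open TorusPerc (stdVec)

section PartA3

variable {d : ℕ}

/-- a quarter of a face of the box -/
noncomputable def TT (n : ℕ) (i : Fin d) (τ : Fin d → ℤˣ) : Finset (V d) :=
  (bx 0 n).filter (fun v => (τ i : ℤ) * v i = n ∧ ∀ k, 0 ≤ (τ k : ℤ) * v k)

lemma mem_TT {n : ℕ} {i : Fin d} {τ : Fin d → ℤˣ} {v : V d} : v ∈ TT n i τ ↔
    v ∈ bx 0 n ∧ (τ i : ℤ) * v i = n ∧ ∀ k, 0 ≤ (τ k : ℤ) * v k := by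
  simp [TT]

lemma TT_sph {n : ℕ} {i : Fin d} {τ : Fin d → ℤˣ} {v : V d} (h : v ∈ TT n i τ) : v ∈ sph d n := by
  rw [mem_TT] at h
  refine mem_sph.2 ⟨h.1, i, ?_⟩
  have := h.2.1
  rcases Int.units_eq_one_or (τ i) with h1 | h1 <;> rw [h1] at this <;> simp at this
  · rw [this]; simp
  · have : v i = -n := by omega
    rw [this]; simp

/-- signed permutation -/
def sg (σ : Fin d → ℤˣ) (s : Equiv.Perm (Fin d)) (x : V d) : V d := fun k => (σ k : ℤ) * x (s k)

lemma sg_inj (σ : Fin d → ℤˣ) (s : Equiv.Perm (Fin d)) : Function.Injective (sg σ s) := by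
  intro x y h
  ext k
  have := congrFun h (s.symm k)
  simpa [sg] using this

lemma sg_bx (σ : Fin d → ℤˣ) (s : Equiv.Perm (Fin d)) {n : ℕ} {x : V d} (h : x ∈ bx 0 n) :
    sg σ s x ∈ bx 0 n := by
  rw [mem_bx] at *
  intro k
  have := h (s k)
  simp only [Pi.zero_apply, sub_zero, sg, abs_mul] at *
  rcases Int.units_eq_one_or (σ k) with h1 | h1 <;> simpa [h1] using this

lemma sg_add (σ : Fin d → ℤˣ) (s : Equiv.Perm (Fin d)) (x : V d) (l : Fin d) :
    sg σ s (x + stdVec d l) = sg σ s x + (σ (s.symm l) : ℤ) • stdVec d (s.symm l) := by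
  ext k
  simp only [sg, Pi.add_apply, Pi.smul_apply, stdVec, mul_add, smul_eq_mul]
  by_cases h : s k = l
  · subst h; simp
  · have : k ≠ s.symm l := fun e => h (by rw [e]; simp)
    simp [h, this]

/-- action on edges -/
def sgE (σ : Fin d → ℤˣ) (s : Equiv.Perm (Fin d)) (e : E d) : E d :=
  if σ (s.symm e.2) = 1 then (sg σ s e.1, s.symm e.2)
  else (sg σ s e.1 - stdVec d (s.symm e.2), s.symm e.2)

lemma sgE_inj (σ : Fin d → ℤˣ) (s : Equiv.Perm (Fin d)) : Function.Injective (sgE σ s) := by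
  rintro ⟨x, l⟩ ⟨y, m⟩ h
  unfold sgE at h
  have h2 : l = m := by
    have := congrArg Prod.snd h
    split_ifs at this <;> simpa using this
  subst h2
  have h1 := congrArg Prod.fst h
  have : x = y := by
    apply sg_inj σ s
    split_ifs at h1 <;> simpa using h1
  rw [this]

lemma sgE_eb (σ : Fin d → ℤˣ) (s : Equiv.Perm (Fin d)) (n : ℕ) :
    (eb (0 : V d) n).image (sgE σ s) = eb 0 n := by
  apply Finset.eq_of_subset_of_card_le
  · intro e he
    obtain ⟨⟨x, l⟩, h1, rfl⟩ := Finset.mem_image.1 he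
    rw [mem_eb] at *
    have a1 := sg_bx σ s h1.1
    have a2 := sg_bx σ s h1.2
    dsimp only at a1 a2
    rw [sg_add] at a2
    unfold sgE
    rcases Int.units_eq_one_or (σ (s.symm l)) with h | h
    · simp only [h, if_true]
      refine ⟨a1, ?_⟩
      simpa [h] using a2
    · have hne : ((-1 : ℤˣ) = 1) = False := by simp
      simp only [h, hne, if_false]
      constructor
      · rw [sub_eq_add_neg]; simpa [h] using a2
      · simpa using a1
  · rw [Finset.card_image_of_injective _ (sgE_inj σ s)]

lemma sg_stp (σ : Fin d → ℤˣ) (s : Equiv.Perm (Fin d)) {A : Set (E d)} {x y : V d}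
    (h : stp A x y) : stp (sgE σ s '' A) (sg σ s x) (sg σ s y) := by
  have key : ∀ x i, (x, i) ∈ A → stp (sgE σ s '' A) (sg σ s x) (sg σ s (x + stdVec d i)) := by
    intro x i hx
    have hm : sgE σ s (x, i) ∈ sgE σ s '' A := ⟨_, hx, rfl⟩
    rw [sg_add]
    generalize hB : sgE σ s '' A = B at hm ⊢
    unfold sgE at hm
    rcases Int.units_eq_one_or (σ (s.symm i)) with h | h
    · simp only [h, if_true] at hm
      exact Or.inl ⟨s.symm i, by simp [h], hm⟩
    · have hne : ((-1 : ℤˣ) = 1) = False := by simp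
      simp only [h, hne, if_false] at hm
      refine Or.inr ⟨s.symm i, by simp [h], ?_⟩
      rw [sub_eq_add_neg] at hm
      simpa [h] using hm
  rcases h with ⟨i, rfl, h⟩ | ⟨i, rfl, h⟩
  · exact key _ _ h
  · exact stp_symm (key _ _ h)

lemma sg_cn (σ : Fin d → ℤˣ) (s : Equiv.Perm (Fin d)) {A : Set (E d)} {x y : V d}
    (h : cn A x y) : cn (sgE σ s '' A) (sg σ s x) (sg σ s y) := by
  induction h with
  | refl => exact cn_refl _ _
  | tail _ h ih => exact Relation.ReflTransGen.tail ih (sg_stp σ s h)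

open Classical in
/-- points of the quarter face connected to the small box -/
noncomputable def XT (K n : ℕ) (i : Fin d) (τ : Fin d → ℤˣ) (A : Set (E d)) : Finset (V d) :=
  (TT n i τ).filter (fun v => ∃ x ∈ bx (0 : V d) K, cn A x v)

lemma mem_XT {K n : ℕ} {i : Fin d} {τ : Fin d → ℤˣ} {A : Set (E d)} {v : V d} :
    v ∈ XT K n i τ A ↔ v ∈ TT n i τ ∧ ∃ x ∈ bx (0 : V d) K, cn A x v := by
  simp [XT]

lemma XT_sym {p : ℝ} (h0 : 0 ≤ p) (h1 : p ≤ 1) (K n t : ℕ) (i i' : Fin d) (τ τ' : Fin d → ℤˣ) :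
    Pr (eb (0 : V d) n) (fun _ => p) (fun A => (XT K n i' τ' (A : Set (E d))).card < t) ≤
    Pr (eb (0 : V d) n) (fun _ => p) (fun A => (XT K n i τ (A : Set (E d))).card < t) := by
  have hp : IsP (fun _ : E d => p) := isP_const h0 h1
  set s := Equiv.swap i i'
  set σ : Fin d → ℤˣ := fun k => τ' k * τ (s k) with hσ
  conv_lhs => rw [← sgE_eb σ s n]
  unfold Pr
  rw [Ex_image (sgE_inj σ s).injOn]
  refine Pr_mono (S := fun A => (XT K n i' τ' ((A.image (sgE σ s) : Finset (E d)) : Set (E d))).card < t)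
    hp fun A hA h => ?_
  refine lt_of_le_of_lt ?_ h
  rw [← Finset.card_image_of_injective (XT K n i τ (A : Set (E d))) (sg_inj σ s)]
  refine Finset.card_le_card fun v hv => ?_
  obtain ⟨w, hw, rfl⟩ := Finset.mem_image.1 hv
  obtain ⟨hw1, x, hx, hc⟩ := mem_XT.1 hw
  rw [mem_TT] at hw1
  have hk : ∀ k, (τ' k : ℤ) * sg σ s w k = (τ (s k) : ℤ) * w (s k) := by
    intro k
    simp only [sg, hσ, Units.val_mul]
    have : (τ' k : ℤ) * (τ' k : ℤ) = 1 := by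
      rcases Int.units_eq_one_or (τ' k) with h1 | h1 <;> simp [h1]
    rw [← mul_assoc, ← mul_assoc, this, one_mul]
  refine mem_XT.2 ⟨mem_TT.2 ⟨sg_bx σ s hw1.1, ?_, ?_⟩, sg σ s x, sg_bx σ s hx, ?_⟩
  · rw [hk]; simp only [s, Equiv.swap_apply_right]; exact hw1.2.1
  · intro k; rw [hk]; exact hw1.2.2 _
  · rw [Finset.coe_image]; exact sg_cn σ s hc

lemma XT_mono {K n : ℕ} {i : Fin d} {τ : Fin d → ℤˣ} {A B : Set (E d)} (h : A ⊆ B) :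
    XT K n i τ A ⊆ XT K n i τ B := fun v hv => by
  rw [mem_XT] at *
  obtain ⟨h1, x, hx, h2⟩ := hv
  exact ⟨h1, x, hx, cn_mono h h2⟩

lemma partA {p : ℝ} (h0 : 0 < p) (h1 : p < 1) {θ : ℝ} (hθ : 0 < θ) (hth : ∀ n, θ ≤ th d p n)
    (hinf : ∀ δ > 0, ∃ n, th d p n < θ + δ) {η : ℝ} (hη : 0 < η) :
    ∃ K : ℕ, ∀ t : ℕ, ∃ n0, ∀ n ≥ n0, ∀ (i : Fin d) (τ : Fin d → ℤˣ),
      Pr (eb (0 : V d) n) (fun _ => p) (fun A => (XT K n i τ (A : Set (E d))).card < t) ≤ η := by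
  have hp : IsP (fun _ : E d => p) := isP_const h0.le h1.le
  set J := Fintype.card (Fin d × (Fin d → ℤˣ)) with hJ
  obtain ⟨K, hK⟩ := A12 h0 h1 hθ hth hinf (η := η ^ J) (by positivity)
  refine ⟨K, fun t => ?_⟩
  obtain ⟨n0, hn0⟩ := hK (J * t)
  refine ⟨n0, fun n hn i τ => ?_⟩
  have hJ0 : J ≠ 0 := by
    have : Nonempty (Fin d × (Fin d → ℤˣ)) := ⟨(i, τ)⟩
    exact Fintype.card_ne_zero
  have h2 := hn0 n hn
  set q := Pr (eb (0 : V d) n) (fun _ => p) (fun A => (XT K n i τ (A : Set (E d))).card < t) with hq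
  have hq0 : 0 ≤ q := Pr_nonneg hp _
  refine le_of_pow_le_pow_left₀ hJ0 hη.le ?_
  refine le_trans ?_ h2
  have e1 : q ^ J = ∏ k ∈ (Finset.univ : Finset (Fin d × (Fin d → ℤˣ))), q := by
    simp [hJ, Finset.card_univ]
  rw [e1]
  set f : Fin d × (Fin d → ℤˣ) → Finset (E d) → ℝ := fun k => 
    Set.indicator {A : Finset (E d) | (XT K n k.1 k.2 (A : Set (E d))).card < t} (fun _ => (1:ℝ)) with hf
  have hprod : ∏ k ∈ (Finset.univ : Finset (Fin d × (Fin d → ℤˣ))), q ≤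
      ∏ k ∈ (Finset.univ : Finset (Fin d × (Fin d → ℤˣ))), Ex (eb (0 : V d) n) (fun _ => p) (f k) := by
    refine Finset.prod_le_prod (fun _ _ => hq0) fun k _ => ?_
    exact XT_sym h0.le h1.le K n t k.1 i k.2 τ
  refine hprod.trans ((harris_prod Finset.univ hp ?_ ?_).trans ?_)
  · intro k A B hAB
    simp only [hf, Set.indicator, Set.mem_ofPred_eq]
    by_cases hB : (XT K n k.1 k.2 (B : Set (E d))).card < t
    · have : (XT K n k.1 k.2 (A : Set (E d))).card < t :=
        lt_of_le_of_lt (Finset.card_le_card (XT_mono (by exact_mod_cast hAB))) hB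
      simp [this, hB]
    · simp only [hB, if_false]; split_ifs <;> norm_num
  · intro k A; exact Set.indicator_nonneg (fun _ _ => zero_le_one) _
  · refine Ex_mono hp fun A _ => ?_
    by_cases hall : ∀ k : Fin d × (Fin d → ℤˣ), (XT K n k.1 k.2 (A : Set (E d))).card < t
    · have : (XS K n A).card < J * t := by
        have hsub : XS K n A ⊆ (Finset.univ : Finset (Fin d × (Fin d → ℤˣ))).biUnion
            (fun k => XT K n k.1 k.2 (A : Set (E d))) := by
          intro y hy
          obtain ⟨hy1, hy2⟩ := mem_XS.1 hy
          obtain ⟨hyb, j, hj⟩ := mem_sph.1 hy1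
          rw [Finset.mem_biUnion]
          have habs : ∀ k, (((if 0 ≤ y k then 1 else -1 : ℤˣ)) : ℤ) * y k = |y k| := by
            intro k; split_ifs with h
            · simp [abs_of_nonneg h]
            · simp [abs_of_neg (not_le.1 h)]
          refine ⟨(j, fun k => if 0 ≤ y k then 1 else -1), Finset.mem_univ _, 
            mem_XT.2 ⟨mem_TT.2 ⟨hyb, ?_, ?_⟩, hy2⟩⟩
          · rw [habs, hj]
          · intro k; rw [habs]; exact abs_nonneg _
        refine lt_of_le_of_lt (Finset.card_le_card hsub) (lt_of_le_of_lt Finset.card_biUnion_le ?_)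
        have : ∑ k : Fin d × (Fin d → ℤˣ), (XT K n k.1 k.2 (A : Set (E d))).card <
            ∑ k : Fin d × (Fin d → ℤˣ), t :=
          Finset.sum_lt_sum_of_nonempty ⟨(i, τ), Finset.mem_univ _⟩ fun k _ => hall k
        simpa [hJ] using this
      rw [Set.indicator_of_mem (show A ∈ {A | (XS K n A).card < J * t} from this)]
      refine Finset.prod_le_one (fun k _ => Set.indicator_nonneg (fun _ _ => zero_le_one) _) 
        fun k _ => ?_
      simp only [hf, Set.indicator]; split_ifs <;> norm_num
    · push Not at hall
      obtain ⟨k, hk⟩ := hall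
      have : f k A = 0 := by
        simp only [hf, Set.indicator, Set.mem_ofPred_eq, not_lt.2 hk, if_false]
      rw [Finset.prod_eq_zero (Finset.mem_univ k) this]
      exact Set.indicator_nonneg (fun _ _ => zero_le_one) _

end PartA3

end TP

namespace TP

open TorusPerc (stdVec)

section PartB

variable {d : ℕ}

/-- translated quarter face -/
noncomputable def Tg (z : V d) (n : ℕ) (i : Fin d) (τ : Fin d → ℤˣ) : Finset (V d) :=
  (TT n i τ).image (fun v => v + z)

lemma mem_Tg {z : V d} {n : ℕ} {i : Fin d} {τ : Fin d → ℤˣ} {v : V d} :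
    v ∈ Tg z n i τ ↔ v - z ∈ TT n i τ := by
  unfold Tg
  rw [Finset.mem_image]
  constructor
  · rintro ⟨w, hw, rfl⟩; simpa using hw
  · intro h; exact ⟨v - z, h, by simp⟩

/-- translate an edge -/
def trE (z : V d) (e : E d) : E d := (e.1 + z, e.2)

lemma trE_inj (z : V d) : Function.Injective (trE z) := by
  rintro ⟨x, l⟩ ⟨y, m⟩ h
  simpa [trE] using h

lemma bx_tr {z v : V d} {n : ℕ} : v + z ∈ bx z n ↔ v ∈ bx 0 n := by
  simp [mem_bx]

lemma trE_eb (z : V d) (n : ℕ) : (eb (0 : V d) n).image (trE z) = eb z n := by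
  ext ⟨x, l⟩
  rw [Finset.mem_image, mem_eb]
  constructor
  · rintro ⟨⟨y, m⟩, h, h2⟩
    simp only [trE, Prod.mk.injEq] at h2
    obtain ⟨rfl, rfl⟩ := h2
    rw [mem_eb] at h
    dsimp only at *
    rw [show y + z + stdVec d m = (y + stdVec d m) + z by abel, bx_tr, bx_tr]
    exact h
  · intro h
    refine ⟨(x - z, l), ?_, by simp [trE]⟩
    rw [mem_eb]
    dsimp only at *
    rw [← bx_tr (z := z), ← bx_tr (z := z)]
    rw [show x - z + stdVec d l + z = x + stdVec d l by abel, show x - z + z = x by abel]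
    exact h

lemma tr_stp (z : V d) {A : Set (E d)} {x y : V d} (h : stp A x y) :
    stp (trE z '' A) (x + z) (y + z) := by
  rcases h with ⟨i, rfl, h⟩ | ⟨i, rfl, h⟩
  · exact Or.inl ⟨i, by abel, ⟨_, h, rfl⟩⟩
  · exact Or.inr ⟨i, by abel, ⟨_, h, rfl⟩⟩

lemma tr_cn (z : V d) {A : Set (E d)} {x y : V d} (h : cn A x y) :
    cn (trE z '' A) (x + z) (y + z) := by
  induction h with
  | refl => exact cn_refl _ _
  | tail _ h ih => exact Relation.ReflTransGen.tail ih (tr_stp z h)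

open Classical in
/-- points of `T` in the set `S` -/
noncomputable def cf (T : Finset (V d)) (S : Set (V d)) : Finset (V d) := T.filter (· ∈ S)

lemma mem_cf {T : Finset (V d)} {S : Set (V d)} {v : V d} : v ∈ cf T S ↔ v ∈ T ∧ v ∈ S := by
  simp [cf]

/-- number of points of `T` in the set `S` -/
noncomputable def cnt (T : Finset (V d)) (S : Set (V d)) : ℕ := (cf T S).card

lemma cnt_mono {T : Finset (V d)} {S S' : Set (V d)} (h : ∀ v ∈ T, v ∈ S → v ∈ S') :
    cnt T S ≤ cnt T S' := by
  classical
  unfold cnt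
  refine Finset.card_le_card fun v hv => ?_
  rw [mem_cf] at *
  exact ⟨hv.1, h v hv.1 hv.2⟩

lemma cnt_union (T : Finset (V d)) (S S' : Set (V d)) : cnt T (S ∪ S') ≤ cnt T S + cnt T S' := by
  classical
  unfold cnt
  refine le_trans (Finset.card_le_card ?_) (Finset.card_union_le _ _)
  intro v hv
  simp only [mem_cf, Finset.mem_union, Set.mem_union] at *
  tauto

/-- statement of the conclusion of part A, translated -/
lemma partA_tr {p : ℝ} (h0 : 0 ≤ p) (h1 : p ≤ 1) {K n t : ℕ} {i : Fin d} {τ : Fin d → ℤˣ} {η : ℝ}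
    (h : Pr (eb (0 : V d) n) (fun _ => p) (fun A => (XT K n i τ (A : Set (E d))).card < t) ≤ η)
    (z : V d) :
    Pr (eb z n) (fun _ => p) (fun A => cnt (Tg z n i τ)
      {v | ∃ x ∈ bx z K, cn (A : Set (E d)) x v} < t) ≤ η := by
  classical
  have hp : IsP (fun _ : E d => p) := isP_const h0 h1
  refine le_trans ?_ h
  conv_lhs => rw [← trE_eb z n]
  unfold Pr
  rw [Ex_image (trE_inj z).injOn]
  refine Pr_mono (S := fun A => cnt (Tg z n i τ)
      {v | ∃ x ∈ bx z K, cn ((A.image (trE z) : Finset (E d)) : Set (E d)) x v} < t)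
    hp fun A hA h => ?_
  refine lt_of_le_of_lt ?_ h
  rw [← Finset.card_image_of_injective (XT K n i τ (A : Set (E d))) (add_left_injective z)]
  unfold cnt
  refine Finset.card_le_card fun v hv => ?_
  obtain ⟨w, hw, rfl⟩ := Finset.mem_image.1 hv
  obtain ⟨hw1, x, hx, hc⟩ := mem_XT.1 hw
  rw [mem_cf]
  refine ⟨mem_Tg.2 (by simpa using hw1), x + z, bx_tr.2 hx, ?_⟩
  rw [Finset.coe_image]; exact tr_cn z hc

/-- points reached from `R` by one edge of `Z` followed by `B`-edges off `R` -/
def Nb (R : Set (V d)) (B Z : Set (E d)) : Set (V d) :=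
  {v | ∃ x ∈ R, ∃ y, stp Z x y ∧ cn (B ∩ inn Rᶜ) y v}

lemma Nb_mono {R : Set (V d)} {B B' Z Z' : Set (E d)} (hB : B ∩ inn Rᶜ ⊆ B') (hZ : Z ⊆ Z') :
    Nb R B Z ⊆ Nb R B' Z' := by
  rintro v ⟨x, hx, y, h1, h2⟩
  exact ⟨x, hx, y, stp_mono hZ h1, cn_mono (fun e (he : e ∈ B ∩ inn Rᶜ) => Set.mem_inter (hB he) he.2) h2⟩

lemma stp_union {A B : Set (E d)} {x y : V d} (h : stp (A ∪ B) x y) : stp A x y ∨ stp B x y := by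
  rcases h with ⟨i, h1, h2 | h2⟩ | ⟨i, h1, h2 | h2⟩
  · exact Or.inl (Or.inl ⟨i, h1, h2⟩)
  · exact Or.inr (Or.inl ⟨i, h1, h2⟩)
  · exact Or.inl (Or.inr ⟨i, h1, h2⟩)
  · exact Or.inr (Or.inr ⟨i, h1, h2⟩)

lemma Nb_union {R : Set (V d)} {B Z Z' : Set (E d)} :
    Nb R B (Z ∪ Z') ⊆ Nb R B Z ∪ Nb R B Z' := by
  rintro v ⟨x, hx, y, h1, h2⟩
  rcases stp_union h1 with h | h
  · exact Or.inl ⟨x, hx, y, h, h2⟩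
  · exact Or.inr ⟨x, hx, y, h, h2⟩

lemma Pr_anti_p {α : Type*} [DecidableEq α] {F : Finset α} {p q : α → ℝ} (hp : IsP p) (hq : IsP q)
    (hpq : ∀ a ∈ F, p a ≤ q a) {S : Finset α → Prop} (hS : ∀ A B, A ⊆ B → S B → S A) :
    Pr F q S ≤ Pr F p S := by
  have h := Ex_mono_p (F := F) hp hq hpq (f := Set.indicator {A | ¬ S A} (fun _ => (1:ℝ))) (by
    intro A B hAB
    by_cases h : S B
    · have := hS A B hAB h
      simp [h, this]
    · have : Set.indicator {A | ¬ S A} (fun _ => (1:ℝ)) B = 1 := by simp [h]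
      rw [this]
      simp only [Set.indicator]; split_ifs <;> norm_num)
  change Pr F p (fun A => ¬ S A) ≤ Pr F q (fun A => ¬ S A) at h
  rw [Pr_not, Pr_not] at h
  linarith

/-- subadditivity: many independent copies -/
lemma subadd {α : Type*} [DecidableEq α] {F : Finset α} {ε : ℝ} (h0 : 0 ≤ ε) (h1 : ε ≤ 1)
    {g : Finset α → ℕ} (hg : ∀ A B, g (A ∪ B) ≤ g A + g B) (t : ℕ) (a : ℕ) :
    (Pr F (fun _ => ε) (fun Z => g Z < t)) ^ (a + 1)
      ≤ Pr F (fun _ => 1 - (1 - ε) ^ (a + 1)) (fun Z => g Z < (a + 1) * t) := by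
  have hp : IsP (fun _ : α => ε) := isP_const h0 h1
  induction a with
  | zero => simp
  | succ a ih =>
    have hb0 : 0 ≤ (1 - ε) ^ (a+1) := pow_nonneg (by linarith) _
    have hb1 : (1 - ε) ^ (a+1) ≤ 1 := pow_le_one₀ (by linarith) (by linarith)
    have hp2 : IsP (fun _ : α => 1 - (1 - ε) ^ (a + 1)) := isP_const (by linarith) (by linarith)
    have e : (fun _ : α => 1 - (1 - ε) ^ (a + 1 + 1)) 
        = (fun _ : α => 1 - (1 - (1 - (1 - ε) ^ (a + 1))) * (1 - ε)) := by
      funext _; ring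
    rw [e]
    have := Ex_or F (fun _ => 1 - (1 - ε) ^ (a + 1)) (fun _ => ε)
      (Set.indicator {Z | g Z < (a + 1 + 1) * t} (fun _ => (1:ℝ)))
    unfold Pr at *
    rw [this, pow_succ]
    refine (mul_le_mul_of_nonneg_right ih (Pr_nonneg hp _)).trans ?_
    rw [← Ex_mul_right]
    refine Ex_mono hp2 fun A _ => ?_
    by_cases hA : g A < (a+1) * t
    · rw [Set.indicator_of_mem (show A ∈ {Z | g Z < (a+1) * t} from hA), one_mul]
      refine Pr_mono (S := fun B => g B < t) (T := fun B => g (A ∪ B) < (a+1+1) * t) hp ?_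
      intro B _ hB
      have := hg A B
      have : (a+1+1) * t = (a+1) * t + t := by ring
      omega
    · rw [Set.indicator_of_notMem (show A ∉ {Z | g Z < (a+1) * t} from hA), zero_mul]
      exact Ex_nonneg hp fun B _ => Set.indicator_nonneg (fun _ _ => zero_le_one) _

lemma B1 {p ε η η' : ℝ} (hp0 : 0 ≤ p) (hp1 : p ≤ 1) (he0 : 0 ≤ ε) (he1 : ε ≤ 1) {a : ℕ}
    (hea : p ≤ 1 - (1 - ε) ^ (a+1)) (hη : 0 < η)
    {K n t : ℕ} {i : Fin d} {τ : Fin d → ℤˣ} {z : V d}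
    (hA : Pr (eb z n) (fun _ => p) (fun A => cnt (Tg z n i τ)
      {v | ∃ x ∈ bx z K, cn (A : Set (E d)) x v} < (a+1) * t) ≤ η')
    {R : Set (V d)} (hR : (bx z K : Set (V d)) ⊆ R) {F : Finset (E d)} (hF : eb z n ⊆ F) :
    Ex F (fun _ => p) (fun B => Pr (eb z n) (fun _ => ε) (fun Z => cnt (Tg z n i τ)
      (R ∪ Nb R (B : Set (E d)) (Z : Set (E d))) < t)) ≤ η + η' / η ^ (a+1) := by
  classical
  have hp : IsP (fun _ : E d => p) := isP_const hp0 hp1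
  have he : IsP (fun _ : E d => ε) := isP_const he0 he1
  set T := Tg z n i τ
  set g : Finset (E d) → Finset (E d) → ℕ := fun B Z =>
    cnt T (R ∪ Nb R (B : Set (E d)) (Z : Set (E d))) with hg
  have gmono : ∀ B B' Z Z' : Finset (E d), ((B : Set (E d)) ∩ inn Rᶜ ⊆ B') → Z ⊆ Z' →
      g B Z ≤ g B' Z' := by
    intro B B' Z Z' h1 h2
    exact cnt_mono fun v _ => Set.union_subset_union_right R (Nb_mono h1 (by exact_mod_cast h2)) 
      (a := v)
  set q : Finset (E d) → ℝ := fun B => Pr (eb z n) (fun _ => ε) (fun Z => g B Z < t) with hq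
  have hq0 : ∀ B, 0 ≤ q B := fun B => Pr_nonneg he _
  have hq1 : ∀ B, q B ≤ 1 := fun B => Pr_le_one he _
  have key : Ex F (fun _ => p) (fun B => q B ^ (a+1)) ≤ η' := by
    refine le_trans ?_ hA
    set G1 := (eb z n).filter (· ∈ inn Rᶜ) with hG1
    set G2 := (eb z n).filter (¬ · ∈ inn Rᶜ) with hG2
    have hun : eb z n = G1 ∪ G2 := by rw [Finset.filter_union_filter_not_eq]
    have hdis : Disjoint G1 G2 := Finset.disjoint_filter_filter_not _ _ _
    have s1 : ∀ B, q B ^ (a+1) ≤ Pr G2 (fun _ => p) (fun Z => g (B ∩ G1) Z < (a+1)*t) := by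
      intro B
      have r1 := subadd (F := eb z n) he0 he1 (g := g B) (by
        intro Z Z'
        refine le_trans (cnt_mono ?_) (cnt_union T _ _)
        rintro v - (hv | hv)
        · exact Or.inl (Or.inl hv)
        · rw [Finset.coe_union] at hv
          rcases Nb_union hv with h | h
          · exact Or.inl (Or.inr h)
          · exact Or.inr (Or.inr h)) t a
      have hb0 : 0 ≤ (1 - ε) ^ (a+1) := pow_nonneg (by linarith) _
      have hb1 : (1 - ε) ^ (a+1) ≤ 1 := pow_le_one₀ (by linarith) (by linarith)
      have r2 := Pr_anti_p (F := eb z n) (p := fun _ => p) (q := fun _ => 1 - (1 - ε) ^ (a+1)) hp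
        (isP_const (by linarith) (by linarith)) (fun _ _ => hea) (S := fun Z => g B Z < (a+1)*t) 
        (fun Z Z' h1 h2 => lt_of_le_of_lt (gmono B B Z Z' Set.inter_subset_left h1) h2)
      refine r1.trans (r2.trans ?_)
      rw [← Pr_inter (F := eb z n) (Finset.filter_subset _ _)]
      refine Pr_mono hp fun Z _ h => lt_of_le_of_lt (gmono _ _ _ _ ?_ Finset.inter_subset_left) h
      rintro e ⟨h1, -⟩
      exact Finset.mem_of_mem_inter_left h1
    have s2 : Ex F (fun _ => p) (fun B => q B ^ (a+1)) ≤ Ex G1 (fun _ => p) 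
        (fun B => Pr G2 (fun _ => p) (fun Z => g B Z < (a+1)*t)) := by
      rw [← Ex_inter ((Finset.filter_subset _ _).trans hF : G1 ⊆ F)]
      exact Ex_mono hp fun B _ => s1 B
    refine s2.trans ?_
    unfold Pr
    rw [hun, Ex_union hdis]
    refine Ex_mono hp fun B hB => Pr_mono (S := fun Z => g B Z < (a+1)*t) 
      (T := fun Z => cnt T {v | ∃ x ∈ bx z K, cn ((B ∪ Z : Finset (E d)) : Set (E d)) x v} < (a+1)*t) hp 
      fun Z hZ h => ?_
    refine lt_of_le_of_lt (cnt_mono ?_) h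
    rintro v - ⟨x, hx, hc⟩
    by_cases hv : v ∈ R
    · exact Or.inl hv
    right
    obtain ⟨u, w, hu, hw, h1, h2, -⟩ := last_exit hc (hR hx) hv
    refine ⟨u, hu, w, ?_, cn_mono ?_ h2⟩
    · rw [Finset.coe_union] at h1
      rcases stp_union h1 with h3 | h3
      · exfalso
        have hB' : (B : Set (E d)) ⊆ inn Rᶜ := fun e he => (Finset.mem_filter.1 (hB he)).2
        exact (stp_inn hB' h3).1 hu
      · exact h3
    · rintro e ⟨h3, h4⟩
      refine ⟨?_, h4⟩
      rcases Finset.mem_union.1 h3 with h5 | h5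
      · exact h5
      · exact absurd h4 (Finset.mem_filter.1 (hZ h5)).2
  calc Ex F (fun _ => p) q ≤ Ex F (fun _ => p) (fun B => η + q B ^ (a+1) * (1 / η ^ (a+1))) := by
        refine Ex_mono hp fun B _ => ?_
        by_cases h : q B ≤ η
        · have : 0 ≤ q B ^ (a+1) * (1 / η ^ (a+1)) := by have := hq0 B; positivity
          linarith
        · push Not at h
          have : 1 ≤ q B ^ (a+1) * (1 / η ^ (a+1)) := by
            rw [mul_one_div, le_div_iff₀ (by positivity), one_mul]
            exact pow_le_pow_left₀ hη.le h.le _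
          linarith [hq1 B]
    _ = η + Ex F (fun _ => p) (fun B => q B ^ (a+1)) * (1 / η ^ (a+1)) := by
        rw [Ex_add, Ex_const, Ex_mul_right]
    _ ≤ η + η' / η ^ (a+1) := by
        rw [div_eq_mul_one_div η']
        have : 0 ≤ 1 / η ^ (a+1) := by positivity
        have := mul_le_mul_of_nonneg_right key this
        linarith

end PartB

end TP

namespace TP

open TorusPerc (stdVec)

section PartC

variable {d : ℕ} {Λ : Type*}

/-- index set of all random bits: base percolation, boundary sprinkling, seed sprinkling -/
inductive Ix (d : ℕ) (Λ : Type*) where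
  | base (e : (Fin d → ℤ) × Fin d) : Ix d Λ
  | bd (σ : Λ) (e : (Fin d → ℤ) × Fin d) : Ix d Λ
  | sd (σ : Λ) (v : Fin d → ℤ) (e : (Fin d → ℤ) × Fin d) : Ix d Λ

noncomputable instance : DecidableEq (Ix d Λ) := Classical.decEq _

/-- parameters -/
def pI (p ε₁ ε₂ : ℝ) : Ix d Λ → ℝ
  | Ix.base _ => p
  | Ix.bd _ _ => ε₁
  | Ix.sd _ _ _ => ε₂

def bsS (ω : Finset (Ix d Λ)) : Set (E d) := {e | Ix.base e ∈ ω}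
def bdS (ω : Finset (Ix d Λ)) (σ : Λ) : Set (E d) := {e | Ix.bd σ e ∈ ω}
/-- fully open seeds -/
def sdS (K : ℕ) (ω : Finset (Ix d Λ)) (σ : Λ) : Set (V d) := {v | ∀ e ∈ eb v K, Ix.sd σ v e ∈ ω}

lemma isP_pI {p ε₁ ε₂ : ℝ} (h1 : 0 ≤ p) (h2 : p ≤ 1) (h3 : 0 ≤ ε₁) (h4 : ε₁ ≤ 1) (h5 : 0 ≤ ε₂)
    (h6 : ε₂ ≤ 1) : IsP (pI p ε₁ ε₂ : Ix d Λ → ℝ) := by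
  rintro (_ | _ | _)
  exacts [⟨h1, h2⟩, ⟨h3, h4⟩, ⟨h5, h6⟩]

/-- failure of one exploration step -/
def Fail (K : ℕ) (R : Set (V d)) (σ : Λ) (T : Finset (V d)) (ω : Finset (Ix d Λ)) : Prop :=
  ¬ ∃ v ∈ T, v ∈ R ∪ Nb R (bsS ω) (bdS ω σ) ∧ v ∈ sdS K ω σ

lemma Fail_anti {K : ℕ} {R : Set (V d)} {σ : Λ} {T : Finset (V d)} {ω ω' : Finset (Ix d Λ)}
    (h : ω ⊆ ω') (hf : Fail K R σ T ω') : Fail K R σ T ω := by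
  rintro ⟨v, hv, h1, h2⟩
  refine hf ⟨v, hv, ?_, fun e he => h (h2 e he)⟩
  rcases h1 with h1 | h1
  · exact Or.inl h1
  · exact Or.inr (Nb_mono (fun e he => h he.1) (fun e he => h he) h1)

lemma B2 {p ε₁ ε₂ η η' : ℝ} (hp0 : 0 ≤ p) (hp1 : p ≤ 1) (he0 : 0 ≤ ε₁) (he1 : ε₁ ≤ 1)
    (hs0 : 0 ≤ ε₂) (hs1 : ε₂ ≤ 1) {a : ℕ}
    (hea : p ≤ 1 - (1 - ε₁) ^ (a+1)) (hη : 0 < η)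
    {K n t D : ℕ} (hD : ∀ v : V d, (eb v K).card ≤ D) {i : Fin d} {τ : Fin d → ℤˣ} {z : V d}
    (hA : Pr (eb z n) (fun _ => p) (fun A => cnt (Tg z n i τ)
      {v | ∃ x ∈ bx z K, cn (A : Set (E d)) x v} < (a+1) * t) ≤ η')
    {R : Set (V d)} (hR : (bx z K : Set (V d)) ⊆ R) {F : Finset (E d)} (hF : eb z n ⊆ F)
    {σ : Λ} {Ω : Finset (Ix d Λ)} (h1 : ∀ e ∈ F, Ix.base e ∈ Ω) (h2 : ∀ e ∈ eb z n, Ix.bd σ e ∈ Ω)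
    (h3 : ∀ v ∈ Tg z n i τ, ∀ e ∈ eb v K, Ix.sd σ v e ∈ Ω) :
    Pr Ω (pI p ε₁ ε₂) (Fail K R σ (Tg z n i τ)) ≤ η + η' / η ^ (a+1) + (1 - ε₂ ^ D) ^ t := by
  have hP : IsP (pI p ε₁ ε₂ : Ix d Λ → ℝ) := isP_pI hp0 hp1 he0 he1 hs0 hs1
  set T := Tg z n i τ with hT
  set Gb : Finset (Ix d Λ) := F.image Ix.base with hGb
  set Gd : Finset (Ix d Λ) := (eb z n).image (Ix.bd σ) with hGd
  set Gs : Finset (Ix d Λ) := T.biUnion (fun v => (eb v K).image (Ix.sd σ v)) with hGs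
  have hsub : Gb ∪ (Gd ∪ Gs) ⊆ Ω := by
    refine Finset.union_subset ?_ (Finset.union_subset ?_ ?_)
    · intro x hx; obtain ⟨e, he, rfl⟩ := Finset.mem_image.1 hx; exact h1 e he
    · intro x hx; obtain ⟨e, he, rfl⟩ := Finset.mem_image.1 hx; exact h2 e he
    · intro x hx
      obtain ⟨v, hv, hx⟩ := Finset.mem_biUnion.1 hx
      obtain ⟨e, he, rfl⟩ := Finset.mem_image.1 hx
      exact h3 v hv e he
  have hd1 : Disjoint Gb (Gd ∪ Gs) := by
    rw [Finset.disjoint_left]; intro x hx hx'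
    obtain ⟨e, he, rfl⟩ := Finset.mem_image.1 hx
    simp [hGd, hGs] at hx'
  have hd2 : Disjoint Gd Gs := by
    rw [Finset.disjoint_left]; intro x hx hx'
    obtain ⟨e, he, rfl⟩ := Finset.mem_image.1 hx
    simp [hGs] at hx'
  have e1 : Pr Ω (pI p ε₁ ε₂) (Fail K R σ T) ≤ Pr (Gb ∪ (Gd ∪ Gs)) (pI p ε₁ ε₂) (Fail K R σ T) := by
    rw [← Pr_inter hsub]
    exact Pr_mono hP fun ω _ h => Fail_anti Finset.inter_subset_left h
  refine e1.trans ?_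
  unfold Pr
  rw [Ex_union hd1]
  have c0 : 0 ≤ ε₂ ^ D := by positivity
  have c1 : ε₂ ^ D ≤ 1 := pow_le_one₀ hs0 hs1
  -- inner bound
  have inner : ∀ B : Finset (E d), B ⊆ F → ∀ Z : Finset (E d), Z ⊆ eb z n →
      Ex Gs (pI p ε₁ ε₂) (fun X => Set.indicator {ω | Fail K R σ T ω} (fun _ => (1:ℝ))
        (B.image Ix.base ∪ (Z.image (Ix.bd σ) ∪ X))) ≤
      Set.indicator {Z : Finset (E d) | cnt T (R ∪ Nb R (B : Set (E d)) (Z : Set (E d))) < t} (fun _ => (1:ℝ)) Z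
        + (1 - ε₂ ^ D) ^ t := by
    intro B hB Z hZ
    by_cases hc : cnt T (R ∪ Nb R (B : Set (E d)) (Z : Set (E d))) < t
    · rw [Set.indicator_of_mem (show Z ∈ {Z : Finset (E d) | 
        cnt T (R ∪ Nb R (B : Set (E d)) (Z : Set (E d))) < t} from hc)]
      have : Ex Gs (pI p ε₁ ε₂) (fun X => Set.indicator {ω | Fail K R σ T ω} (fun _ => (1:ℝ))
        (B.image Ix.base ∪ (Z.image (Ix.bd σ) ∪ X))) ≤ 1 := by
        refine (Ex_mono (g := fun _ => (1:ℝ)) hP fun A _ => ?_).trans (Ex_const Gs (pI p ε₁ ε₂) 1).le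
        simp only [Set.indicator]; split_ifs <;> norm_num
      have := pow_nonneg (sub_nonneg.2 c1) t
      linarith
    · rw [Set.indicator_of_notMem (show Z ∉ {Z : Finset (E d) | 
        cnt T (R ∪ Nb R (B : Set (E d)) (Z : Set (E d))) < t} from hc), zero_add]
      push Not at hc
      set I := cf T (R ∪ Nb R (B : Set (E d)) (Z : Set (E d))) with hI
      have hIT : ∀ v ∈ I, v ∈ T := fun v hv => (mem_cf.1 hv).1
      have hnf := Pr_none_full I (F := Gs) hP (fun v => (eb v K).image (Ix.sd σ v))
        (fun v hv x hx => Finset.mem_biUnion.2 ⟨v, hIT v hv, hx⟩)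
        (by
          intro v _ w _ hne
          rw [Finset.disjoint_left]; intro x hx hx'
          obtain ⟨e, he, rfl⟩ := Finset.mem_image.1 hx
          obtain ⟨e', he', h⟩ := Finset.mem_image.1 hx'
          injection h with _ h _
          exact hne h.symm) (c := ε₂ ^ D)
        (by
          intro v hv
          rw [Finset.prod_image (by intro x _ y _ h; injection h)]
          simp only [pI, Finset.prod_const]
          exact pow_le_pow_of_le_one hs0 hs1 (hD v)) c1
      refine le_trans ?_ (hnf.trans (pow_le_pow_of_le_one (by linarith) (by linarith) hc))
      refine Pr_mono (S := fun X => Fail K R σ T (B.image Ix.base ∪ (Z.image (Ix.bd σ) ∪ X))) hP ?_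
      intro X hX hf v hv hsub
      refine hf ⟨v, hIT v hv, ?_, ?_⟩
      · have := (mem_cf.1 hv).2
        rcases this with h | h
        · exact Or.inl h
        · refine Or.inr (Nb_mono ?_ ?_ h)
          · intro e he; simpa [bsS] using Or.inl he.1
          · intro e he; simpa [bdS] using Or.inl he
      · intro e he
        have := hsub (Finset.mem_image_of_mem _ he)
        simp [this]
  have outer : ∀ B : Finset (E d), B ⊆ F → 
      Ex (Gd ∪ Gs) (pI p ε₁ ε₂) (fun Y => Set.indicator {ω | Fail K R σ T ω} (fun _ => (1:ℝ))
        (B.image Ix.base ∪ Y)) ≤ 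
      Pr (eb z n) (fun _ => ε₁) (fun Z => cnt T (R ∪ Nb R (B : Set (E d)) (Z : Set (E d))) < t)
        + (1 - ε₂ ^ D) ^ t := by
    intro B hB
    rw [Ex_union hd2, hGd, Ex_image (by intro x _ y _ h; injection h)]
    rw [← Ex_const (eb z n) (fun _ => ε₁) ((1 - ε₂ ^ D) ^ t)]
    unfold Pr
    rw [← Ex_add]
    exact Ex_mono (isP_const he0 he1) fun Z hZ => inner B hB Z hZ
  rw [hGb, Ex_image (by intro x _ y _ h; injection h)]
  have hb := B1 hp0 hp1 he0 he1 hea hη hA hR hF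
  have : Ex F (fun _ => p) (fun B => Pr (eb z n) (fun _ => ε₁) 
      (fun Z => cnt T (R ∪ Nb R (B : Set (E d)) (Z : Set (E d))) < t) + (1 - ε₂ ^ D) ^ t)
      ≤ η + η' / η ^ (a+1) + (1 - ε₂ ^ D) ^ t := by
    rw [Ex_add, Ex_const]
    linarith
  refine le_trans ?_ this
  exact Ex_mono (isP_const hp0 hp1) fun B hB => outer B hB

end PartC

section Explore

variable {α : Type*} [DecidableEq α] {St : Type*}

/-- iterate a random step -/
def run (step : St → Finset α → St) : ℕ → St → Finset α → St
  | 0, s, _ => s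
  | k+1, s, ω => run step k (step s ω) ω

lemma run_dep {step : St → Finset α → St} {Inv : St → Prop} {Fr : St → Set α}
    (ha : ∀ s, Inv s → DepOn (Fr s) (step s)) (hc : ∀ s ω, Inv s → Inv (step s ω))
    (hd : ∀ s ω, Inv s → Fr (step s ω) ⊆ Fr s) (k : ℕ) :
    ∀ s, Inv s → DepOn (Fr s) (run step k s) := by
  induction k with
  | zero => intro s _ A B _; rfl
  | succ k ih =>
    intro s hs A B hAB
    simp only [run]
    rw [← ha s hs A B hAB]
    exact ih _ (hc s A hs) A B fun x hx => hAB x (hd s A hs hx)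

lemma run_inv {step : St → Finset α → St} {Inv : St → Prop} {ω : Finset α}
    (hc : ∀ s, Inv s → Inv (step s ω)) (k : ℕ) : ∀ s, Inv s → Inv (run step k s ω) := by
  induction k with
  | zero => intro s h; exact h
  | succ k ih => intro s h; exact ih _ (hc s h)

lemma run_super {G : Finset α} {p : α → ℝ} (hp : IsP p)
    {step : St → Finset α → St} {Inv : St → Prop} {Fr : St → Set α} {W : St → ℝ}
    (ha : ∀ s, Inv s → DepOn (Fr s) (step s)) 
    (hb : ∀ s s1, Inv s → DepOn (Fr s1)ᶜ (fun ω => step s ω = s1))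
    (hc : ∀ s ω, Inv s → Inv (step s ω))
    (hd : ∀ s ω, Inv s → Fr (step s ω) ⊆ Fr s)
    (he : ∀ s, Inv s → Ex G p (fun ω => W (step s ω)) ≤ W s) (k : ℕ) :
    ∀ s, Inv s → Ex G p (fun ω => W (run step k s ω)) ≤ W s := by
  classical
  induction k with
  | zero => intro s _; simp [run, Ex_const]
  | succ k ih =>
    intro s hs
    set I : Finset St := G.powerset.image (step s) with hI
    have split : ∀ (f : St → Finset α → ℝ), Ex G p (fun ω => f (step s ω) ω)
        = ∑ s1 ∈ I, Ex G p (fun ω => (if step s ω = s1 then 1 else 0) * f s1 ω) := by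
      intro f
      rw [← Ex_sum]
      refine Ex_congr fun ω hω => ?_
      rw [Finset.sum_eq_single (step s ω)]
      · simp
      · intro b _ hb; simp [hb.symm]
      · intro h; exact absurd (Finset.mem_image_of_mem _ (Finset.mem_powerset.2 hω)) h
    refine le_trans ?_ (he s hs)
    have l1 := split (fun s1 ω => W (run step k s1 ω))
    have l2 := split (fun s1 _ => W s1)
    simp only [run]
    rw [l1, l2]
    refine Finset.sum_le_sum fun s1 hs1 => ?_
    obtain ⟨ω0, -, rfl⟩ := Finset.mem_image.1 hs1
    have hinv := hc s ω0 hs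
    rw [Ex_indep (Fr (step s ω0))ᶜ, Ex_mul_right]
    · refine mul_le_mul_of_nonneg_left (ih _ hinv) (Ex_nonneg hp fun A _ => ?_)
      split_ifs <;> norm_num
    · intro A B hAB
      have := hb s (step s ω0) hs A B hAB
      simp only [eq_iff_iff] at this
      exact if_congr this rfl rfl
    · rw [compl_compl]
      intro A B hAB
      dsimp only
      rw [run_dep ha hc hd k _ hinv A B hAB]

end Explore

end TP

namespace TP

open TorusPerc (stdVec)

section Nbhd
variable {d : ℕ}

lemma Nb_agree {R : Set (V d)} {B B' Z : Set (E d)}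
    (h : ∀ e : E d, (e.1 ∈ Nb R B Z ∨ e.1 + stdVec d e.2 ∈ Nb R B Z) → (e ∈ B ↔ e ∈ B')) :
    Nb R B Z = Nb R B' Z := by
  have key : ∀ u w, u ∈ Nb R B Z → (stp (B ∩ inn Rᶜ) u w ↔ stp (B' ∩ inn Rᶜ) u w) := by
    intro u w hu
    unfold stp
    refine or_congr (exists_congr fun i => and_congr_right fun hi => ?_)
      (exists_congr fun i => and_congr_right fun hi => ?_)
    · have := h (u, i) (Or.inl hu)
      simp only [Set.mem_inter_iff, this]
    · have := h (w, i) (Or.inr (by dsimp only; rw [← hi]; exact hu))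
      simp only [Set.mem_inter_iff, this]
  ext v
  constructor
  · rintro ⟨x, hx, y, h1, h2⟩
    refine ⟨x, hx, y, h1, ?_⟩
    have : v ∈ Nb R B Z ∧ cn (B' ∩ inn Rᶜ) y v := by
      unfold cn at h2 ⊢
      induction h2 with
      | refl => exact ⟨⟨x, hx, y, h1, cn_refl _ _⟩, cn_refl _ _⟩
      | tail h3 h4 ih => 
        exact ⟨⟨x, hx, y, h1, h3.tail h4⟩, ih.2.tail ((key _ _ ih.1).1 h4)⟩
    exact this.2
  · rintro ⟨x, hx, y, h1, h2⟩
    unfold cn at h2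
    induction h2 with
    | refl => exact ⟨x, hx, y, h1, cn_refl _ _⟩
    | tail h3 h4 ih => 
      have := (key _ _ ih).2 h4
      obtain ⟨x', hx', y', h1', h2'⟩ := ih
      exact ⟨x', hx', y', h1', h2'.tail this⟩

end Nbhd

section Expl

variable {d : ℕ} {Λ S : Type*} [DecidableEq Λ] [DecidableEq S]

/-- exploration state -/
structure XSt (d : ℕ) (Λ S : Type*) where
  R : Set (Fin d → ℤ)
  act : S → Option (Fin d → ℤ)
  tried : Finset Λ
  failed : Finset Λ

variable (all : Finset Λ) (src dst : Λ → S) (tgt : Λ → V d → Finset (V d)) (K : ℕ)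

/-- candidate for next exploration step -/
def Cand (s : XSt d Λ S) (q : Λ × V d) : Prop :=
  q.1 ∈ all ∧ q.1 ∉ s.tried ∧ s.act (src q.1) = some q.2 ∧ s.act (dst q.1) = none

open Classical in
noncomputable def nxt (s : XSt d Λ S) : Option (Λ × V d) :=
  if h : ∃ q, Cand all src dst s q then some h.choose else none

lemma nxt_some {s : XSt d Λ S} {q : Λ × V d} (h : nxt all src dst s = some q) :
    Cand all src dst s q := by
  unfold nxt at h
  split_ifs at h with h1
  injection h with h
  rw [← h]; exact h1.choose_spec

lemma nxt_none {s : XSt d Λ S} (h : nxt all src dst s = none) (q : Λ × V d) :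
    ¬ Cand all src dst s q := by
  unfold nxt at h
  split_ifs at h with h1
  exact fun h2 => h1 ⟨q, h2⟩

open Classical in
noncomputable def stepAux (s : XSt d Λ S) (q : Λ × V d) (N Q : Set (V d)) : XSt d Λ S :=
  if h : ∃ v ∈ tgt q.1 q.2, v ∈ s.R ∪ N ∧ v ∈ Q then
    { R := s.R ∪ N ∪ bx h.choose K
      act := Function.update s.act (dst q.1) (some h.choose)
      tried := insert q.1 s.tried
      failed := s.failed }
  else
    { R := s.R ∪ N
      act := s.act
      tried := insert q.1 s.tried
      failed := insert q.1 s.failed }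

noncomputable def xstep (s : XSt d Λ S) (ω : Finset (Ix d Λ)) : XSt d Λ S :=
  match nxt all src dst s with
  | none => s
  | some q => stepAux dst tgt K s q (Nb s.R (bsS ω) (bdS ω q.1)) (sdS K ω q.1)

def Fr (s : XSt d Λ S) : Set (Ix d Λ)
  | Ix.base e => e ∈ inn s.Rᶜ
  | Ix.bd σ _ => σ ∉ s.tried
  | Ix.sd σ _ _ => σ ∉ s.tried

structure XInv (Good : S → V d → Prop) (s : XSt d Λ S) : Prop where
  box : ∀ x z, s.act x = some z → (bx z K : Set (V d)) ⊆ s.R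
  good : ∀ x z, s.act x = some z → Good x z
  sub : s.failed ⊆ s.tried
  suball : s.tried ⊆ all
  res : ∀ σ ∈ s.tried, σ ∈ s.failed ∨ s.act (dst σ) ≠ none

lemma stepAux_tried (s : XSt d Λ S) (q : Λ × V d) (N Q : Set (V d)) :
    (stepAux dst tgt K s q N Q).tried = insert q.1 s.tried := by
  unfold stepAux; split_ifs <;> rfl

lemma stepAux_R (s : XSt d Λ S) (q : Λ × V d) (N Q : Set (V d)) :
    s.R ∪ N ⊆ (stepAux dst tgt K s q N Q).R := by
  unfold stepAux; split_ifs
  · exact Set.subset_union_left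
  · exact subset_rfl

lemma mem_Fr_base {s : XSt d Λ S} {e : E d} : (Ix.base e ∈ Fr s) ↔ e ∈ inn s.Rᶜ := Iff.rfl
lemma mem_Fr_bd {s : XSt d Λ S} {σ : Λ} {e : E d} : (Ix.bd σ e ∈ Fr s) ↔ σ ∉ s.tried := Iff.rfl
lemma mem_Fr_sd {s : XSt d Λ S} {σ : Λ} {v : V d} {e : E d} : (Ix.sd σ v e ∈ Fr s) ↔ σ ∉ s.tried := Iff.rfl

lemma xstep_dep (s : XSt d Λ S) : DepOn (Fr s) (xstep all src dst tgt K s) := by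
  intro A B hAB
  unfold xstep
  rcases hq : nxt all src dst s with _ | q
  · rfl
  · have hc := nxt_some all src dst hq
    have e1 : bdS A q.1 = bdS B q.1 := by
      ext e; exact hAB (Ix.bd q.1 e) hc.2.1
    have e2 : sdS K A q.1 = sdS K B q.1 := by
      ext v
      exact forall_congr' fun e => imp_congr_right fun _ => hAB (Ix.sd q.1 v e) hc.2.1
    have e3 : Nb s.R (bsS A) (bdS B q.1) = Nb s.R (bsS B) (bdS B q.1) := by
      refine Set.Subset.antisymm (Nb_mono ?_ subset_rfl) (Nb_mono ?_ subset_rfl)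
      · rintro e ⟨h1, h2⟩; exact (hAB (Ix.base e) h2).1 h1
      · rintro e ⟨h1, h2⟩; exact (hAB (Ix.base e) h2).2 h1
    dsimp only
    rw [e1, e2, e3]

lemma xstep_dep' (s s1 : XSt d Λ S) :
    DepOn (Fr s1)ᶜ (fun ω => xstep all src dst tgt K s ω = s1) := by
  have one : ∀ A B : Finset (Ix d Λ), (∀ x ∈ (Fr s1)ᶜ, x ∈ A ↔ x ∈ B) →
      xstep all src dst tgt K s A = s1 → xstep all src dst tgt K s B = s1 := by
    intro A B hAB h
    unfold xstep at h ⊢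
    rcases hq : nxt all src dst s with _ | q
    · rw [hq] at h; exact h
    · rw [hq] at h
      dsimp only at h ⊢
      have ht : q.1 ∈ s1.tried := by
        rw [← h, stepAux_tried]; exact Finset.mem_insert_self _ _
      have hR : s.R ∪ Nb s.R (bsS A) (bdS A q.1) ⊆ s1.R := by
        rw [← h]; exact stepAux_R dst tgt K _ _ _ _
      have e1 : bdS A q.1 = bdS B q.1 := by
        ext e; exact hAB (Ix.bd q.1 e) (by rw [Set.mem_compl_iff, mem_Fr_bd, not_not]; exact ht)
      have e2 : sdS K A q.1 = sdS K B q.1 := by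
        ext v
        exact forall_congr' fun e => imp_congr_right fun _ => 
          hAB (Ix.sd q.1 v e) (by rw [Set.mem_compl_iff, mem_Fr_sd, not_not]; exact ht)
      have e3 : Nb s.R (bsS A) (bdS A q.1) = Nb s.R (bsS B) (bdS A q.1) := by
        refine Nb_agree fun e he => hAB (Ix.base e) ?_
        rw [Set.mem_compl_iff, mem_Fr_base, mem_inn]
        rintro ⟨h1, h2⟩
        rcases he with he | he
        · exact h1 (hR (Or.inr he))
        · exact h2 (hR (Or.inr he))
      rw [← e1, ← e2, ← e3]
      exact h
  intro A B hAB
  simp only [eq_iff_iff]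
  exact ⟨one A B hAB, one B A fun x hx => (hAB x hx).symm⟩

lemma xstep_Fr (s : XSt d Λ S) (ω : Finset (Ix d Λ)) :
    Fr (xstep all src dst tgt K s ω) ⊆ Fr s := by
  unfold xstep
  rcases hq : nxt all src dst s with _ | q
  · exact subset_rfl
  · have hR := stepAux_R dst tgt K s q (Nb s.R (bsS ω) (bdS ω q.1)) (sdS K ω q.1)
    have hT := stepAux_tried dst tgt K s q (Nb s.R (bsS ω) (bdS ω q.1)) (sdS K ω q.1)
    rintro (e | ⟨σ, e⟩ | ⟨σ, v, e⟩) h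
    · rw [mem_Fr_base] at h ⊢
      exact inn_mono (Set.compl_subset_compl.2 (Set.subset_union_left.trans hR)) h
    · rw [mem_Fr_bd] at h ⊢
      dsimp only at h
      rw [hT] at h
      exact fun h' => h (Finset.mem_insert_of_mem h')
    · rw [mem_Fr_sd] at h ⊢
      dsimp only at h
      rw [hT] at h
      exact fun h' => h (Finset.mem_insert_of_mem h')

lemma xstep_inv {Good : S → V d → Prop} (hg : ∀ σ ∈ all, ∀ z, Good (src σ) z → 
    ∀ v ∈ tgt σ z, Good (dst σ) v) (s : XSt d Λ S) (ω : Finset (Ix d Λ))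
    (hs : XInv all dst K Good s) : XInv all dst K Good (xstep all src dst tgt K s ω) := by
  unfold xstep
  rcases hq : nxt all src dst s with _ | q
  · exact hs
  · have hc := nxt_some all src dst hq
    dsimp only
    unfold stepAux
    split_ifs with h
    · obtain ⟨h1, h2, h3⟩ := h.choose_spec
      set v := h.choose
      constructor
      · intro x z hz
        dsimp only at hz ⊢
        by_cases hx : x = dst q.1
        · rw [hx, Function.update_self] at hz
          injection hz with hz
          rw [← hz]; exact Set.subset_union_right
        · rw [Function.update_of_ne hx] at hz
          exact (hs.box x z hz).trans (Set.subset_union_left.trans Set.subset_union_left)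
      · intro x z hz
        dsimp only at hz ⊢
        by_cases hx : x = dst q.1
        · rw [hx, Function.update_self] at hz
          injection hz with hz
          rw [← hz, hx]
          exact hg q.1 hc.1 q.2 (hs.good _ _ hc.2.2.1) _ h1
        · rw [Function.update_of_ne hx] at hz
          exact hs.good x z hz
      · exact hs.sub.trans (Finset.subset_insert _ _)
      · exact Finset.insert_subset hc.1 hs.suball
      · intro σ hσ
        dsimp only at hσ ⊢
        by_cases hx : dst σ = dst q.1
        · right; rw [hx, Function.update_self]; simp
        · rw [Function.update_of_ne hx]
          rcases Finset.mem_insert.1 hσ with rfl | hσ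
          · exact absurd rfl hx
          · exact hs.res σ hσ
    · constructor
      · intro x z hz
        exact (hs.box x z hz).trans Set.subset_union_left
      · exact hs.good
      · exact Finset.insert_subset_insert _ hs.sub
      · exact Finset.insert_subset hc.1 hs.suball
      · intro σ hσ
        dsimp only at hσ ⊢
        rcases Finset.mem_insert.1 hσ with rfl | hσ
        · left; exact Finset.mem_insert_self _ _
        · rcases hs.res σ hσ with h | h
          · left; exact Finset.mem_insert_of_mem h
          · right; exact h

/-- forget levels -/
def flat (ω : Finset (Ix d Λ)) : Set (E d) :=
  {e | Ix.base e ∈ ω ∨ (∃ σ, Ix.bd σ e ∈ ω) ∨ ∃ σ v, Ix.sd σ v e ∈ ω}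

lemma xstep_cn {z0 : V d} {Z : Set (E d)} (ω : Finset (Ix d Λ)) (s : XSt d Λ S)
    (hs : ∀ x ∈ s.R, cn (flat ω ∪ Z) z0 x) :
    ∀ x ∈ (xstep all src dst tgt K s ω).R, cn (flat ω ∪ Z) z0 x := by
  unfold xstep
  rcases hq : nxt all src dst s with _ | q
  · exact hs
  · dsimp only
    have h1 : ∀ x ∈ s.R ∪ Nb s.R (bsS ω) (bdS ω q.1), cn (flat ω ∪ Z) z0 x := by
      rintro x (hx | ⟨u, hu, y, hy, hx⟩)
      · exact hs x hx
      · refine cn_trans (hs u hu) (cn_trans (cn_of_stp (stp_mono ?_ hy)) (cn_mono ?_ hx))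
        · intro e he; exact Or.inl (Or.inr (Or.inl ⟨_, he⟩))
        · intro e he; exact Or.inl (Or.inl he.1)
    unfold stepAux
    split_ifs with h
    · obtain ⟨h2, h3, h4⟩ := h.choose_spec
      set v := h.choose
      rintro x (hx | hx)
      · exact h1 x hx
      · refine cn_trans (h1 v h3) (cn_mono ?_ (cn_bx (bx_self v K) hx))
        intro e he; exact Or.inl (Or.inr (Or.inr ⟨_, _, h4 e he⟩))
    · exact h1

lemma run_card (s : XSt d Λ S) (hs : s.tried ⊆ all) (ω : Finset (Ix d Λ)) (k : ℕ) :
    nxt all src dst (run (xstep all src dst tgt K) k s ω) = none ∨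
    (run (xstep all src dst tgt K) k s ω).tried.card = s.tried.card + k := by
  induction k generalizing s with
  | zero => right; rfl
  | succ k ih =>
    simp only [run]
    rcases hq : nxt all src dst s with _ | q
    · left
      have hst : xstep all src dst tgt K s ω = s := by unfold xstep; rw [hq]
      have : ∀ m, run (xstep all src dst tgt K) m s ω = s := by
        intro m; induction m with
        | zero => rfl
        | succ m ihm => simp only [run]; rw [hst]; exact ihm
      rw [hst, this]; exact hq
    · have hc := nxt_some all src dst hq
      have ht : (xstep all src dst tgt K s ω).tried = insert q.1 s.tried := by
        unfold xstep; rw [hq]; dsimp only; rw [stepAux_tried]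
      rcases ih (xstep all src dst tgt K s ω) (by rw [ht]; exact Finset.insert_subset hc.1 hs) with h | h
      · exact Or.inl h
      · right; rw [h, ht, Finset.card_insert_of_notMem hc.2.1]; ring

lemma run_stuck (s : XSt d Λ S) {Good : S → V d → Prop} (hg : ∀ σ ∈ all, ∀ z, Good (src σ) z → 
    ∀ v ∈ tgt σ z, Good (dst σ) v) (hs : XInv all dst K Good s) (ω : Finset (Ix d Λ)) :
    nxt all src dst (run (xstep all src dst tgt K) (all.card) s ω) = none := by
  rcases run_card all src dst tgt K s hs.suball ω all.card with h | h
  · exact h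
  · have hi := run_inv (ω := ω) (fun s hs => xstep_inv all src dst tgt K hg s ω hs) all.card s hs
    have : (run (xstep all src dst tgt K) (all.card) s ω).tried = all :=
      Finset.eq_of_subset_of_card_le hi.suball (by omega)
    rcases hq : nxt all src dst (run (xstep all src dst tgt K) (all.card) s ω) with _ | q
    · rfl
    · have hc := nxt_some all src dst hq
      exact absurd hc.1 (this ▸ hc.2.1)

/-- supermartingale weight -/
noncomputable def Wt (η : ℝ) (B : Finset Λ) (s : XSt d Λ S) : ℝ :=
  if ∀ b ∈ B, b ∈ s.tried → b ∈ s.failed then η ^ (B \ s.failed).card else 0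

lemma Wt_step {Good : S → V d → Prop} {Ω : Finset (Ix d Λ)} {pp : Ix d Λ → ℝ} (hP : IsP pp) {η : ℝ}
    (hη : 0 ≤ η)
    (hf : ∀ σ ∈ all, ∀ z, Good (src σ) z → ∀ R : Set (V d), (bx z K : Set (V d)) ⊆ R → 
      Pr Ω pp (Fail K R σ (tgt σ z)) ≤ η) (B : Finset Λ) (s : XSt d Λ S)
    (hs : XInv all dst K Good s) :
    Ex Ω pp (fun ω => Wt η B (xstep all src dst tgt K s ω)) ≤ Wt η B s := by
  rcases hq : nxt all src dst s with _ | q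
  · have : (fun ω => Wt η B (xstep all src dst tgt K s ω)) = fun _ => Wt η B s := by
      ext ω; unfold xstep; rw [hq]
    rw [this, Ex_const]
  obtain ⟨c1, c2, c3, c4⟩ := nxt_some all src dst hq
  have hst : ∀ ω, xstep all src dst tgt K s ω = 
      stepAux dst tgt K s q (Nb s.R (bsS ω) (bdS ω q.1)) (sdS K ω q.1) := by
    intro ω; unfold xstep; rw [hq]
  have hfail : ∀ ω, Fail K s.R q.1 (tgt q.1 q.2) ω → 
      (xstep all src dst tgt K s ω).failed = insert q.1 s.failed ∧ 
      (xstep all src dst tgt K s ω).tried = insert q.1 s.tried := by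
    intro ω h; rw [hst]; unfold stepAux; rw [dif_neg h]; exact ⟨rfl, rfl⟩
  have hsucc : ∀ ω, ¬ Fail K s.R q.1 (tgt q.1 q.2) ω → 
      (xstep all src dst tgt K s ω).failed = s.failed ∧ 
      (xstep all src dst tgt K s ω).tried = insert q.1 s.tried := by
    intro ω h; unfold Fail at h; rw [not_not] at h; rw [hst]; unfold stepAux; rw [dif_pos h]; exact ⟨rfl, rfl⟩
  by_cases hcond : ∀ b ∈ B, b ∈ s.tried → b ∈ s.failed
  swap
  · have : ∀ ω, Wt η B (xstep all src dst tgt K s ω) = 0 := by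
      intro ω
      unfold Wt
      rw [if_neg]
      push Not at hcond ⊢
      obtain ⟨b, hb, h1, h2⟩ := hcond
      have hne : b ≠ q.1 := fun h => c2 (h ▸ h1)
      refine ⟨b, hb, ?_, ?_⟩
      · by_cases h : Fail K s.R q.1 (tgt q.1 q.2) ω
        · rw [(hfail ω h).2]; exact Finset.mem_insert_of_mem h1
        · rw [(hsucc ω h).2]; exact Finset.mem_insert_of_mem h1
      · by_cases h : Fail K s.R q.1 (tgt q.1 q.2) ω
        · rw [(hfail ω h).1, Finset.mem_insert]; rintro (h' | h'); exacts [hne h', h2 h']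
        · rw [(hsucc ω h).1]; exact h2
    simp only [this]
    rw [Ex_const]
    unfold Wt; rw [if_neg hcond]
  by_cases hqB : q.1 ∈ B
  · have hqf : q.1 ∉ s.failed := fun h => c2 (hs.sub h)
    have hmem : q.1 ∈ B \ s.failed := Finset.mem_sdiff.2 ⟨hqB, hqf⟩
    obtain ⟨m, hm⟩ : ∃ m, (B \ s.failed).card = m + 1 :=
      Nat.exists_eq_succ_of_ne_zero (Finset.card_ne_zero_of_mem hmem)
    have hW : ∀ ω, Wt η B (xstep all src dst tgt K s ω) ≤ 
        η ^ m * Set.indicator {ω | Fail K s.R q.1 (tgt q.1 q.2) ω} (fun _ => (1:ℝ)) ω := by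
      intro ω
      by_cases h : Fail K s.R q.1 (tgt q.1 q.2) ω
      · rw [Set.indicator_of_mem (show ω ∈ {ω | Fail K s.R q.1 (tgt q.1 q.2) ω} from h), mul_one]
        unfold Wt
        split_ifs
        · rw [(hfail ω h).1, Finset.sdiff_insert, Finset.card_erase_of_mem hmem, hm]; rfl
        · positivity
      · rw [Set.indicator_of_notMem (show ω ∉ {ω | Fail K s.R q.1 (tgt q.1 q.2) ω} from h), mul_zero]
        unfold Wt
        rw [if_neg]
        push Not
        refine ⟨q.1, hqB, ?_, ?_⟩
        · rw [(hsucc ω h).2]; exact Finset.mem_insert_self _ _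
        · rw [(hsucc ω h).1]; exact hqf
    refine (Ex_mono hP fun ω _ => hW ω).trans ?_
    rw [Ex_mul_left]
    unfold Wt
    rw [if_pos hcond, hm, pow_succ]
    exact mul_le_mul_of_nonneg_left (hf q.1 c1 q.2 (hs.good _ _ c3) s.R (hs.box _ _ c3)) (by positivity)
  · have : ∀ ω, Wt η B (xstep all src dst tgt K s ω) ≤ Wt η B s := by
      intro ω
      have h1 : B \ (xstep all src dst tgt K s ω).failed = B \ s.failed := by
        by_cases h : Fail K s.R q.1 (tgt q.1 q.2) ω
        · rw [(hfail ω h).1, Finset.sdiff_insert, Finset.erase_eq_of_notMem]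
          simp [hqB]
        · rw [(hsucc ω h).1]
      unfold Wt
      rw [if_pos hcond, h1]
      split_ifs
      · exact le_rfl
      · positivity
    refine (Ex_mono hP fun ω _ => this ω).trans ?_
    rw [Ex_const]

/-- initial state -/
def st0 (r : S) (z0 : V d) : XSt d Λ S where
  R := bx z0 K
  act := Function.update (fun _ => none) r (some z0)
  tried := ∅
  failed := ∅

/-- the result of the exploration -/
theorem explore {Good : S → V d → Prop} {Ω : Finset (Ix d Λ)} {pp : Ix d Λ → ℝ} (hP : IsP pp) {η : ℝ}
    (hη : 0 ≤ η)
    (hf : ∀ σ ∈ all, ∀ z, Good (src σ) z → ∀ R : Set (V d), (bx z K : Set (V d)) ⊆ R → 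
      Pr Ω pp (Fail K R σ (tgt σ z)) ≤ η)
    (hg : ∀ σ ∈ all, ∀ z, Good (src σ) z → ∀ v ∈ tgt σ z, Good (dst σ) v)
    (r : S) (z0 : V d) (hr : Good r z0) :
    ∃ (act : Finset (Ix d Λ) → Set S) (failed : Finset (Ix d Λ) → Finset Λ),
      (∀ B, Pr Ω pp (fun ω => B ⊆ failed ω) ≤ η ^ B.card) ∧
      (∀ ω, r ∈ act ω) ∧
      (∀ ω, ∀ σ ∈ all, src σ ∈ act ω → dst σ ∈ act ω ∨ σ ∈ failed ω) ∧
      (∀ ω, ∀ x ∈ act ω, ∃ v, Good x v ∧ cn (flat ω ∪ (eb z0 K : Set (E d))) z0 v) := by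
  set s0 : XSt d Λ S := st0 K r z0 with hs0
  have hinv0 : XInv all dst K Good s0 := by
    have hact : ∀ x z, s0.act x = some z → x = r ∧ z = z0 := by
      intro x z h
      simp only [hs0, st0] at h
      by_cases hx : x = r
      · rw [hx, Function.update_self] at h; injection h with h; exact ⟨hx, h.symm⟩
      · rw [Function.update_of_ne hx] at h; cases h
    constructor
    · intro x z h; obtain ⟨rfl, rfl⟩ := hact x z h; exact subset_rfl
    · intro x z h; obtain ⟨rfl, rfl⟩ := hact x z h; exact hr
    · exact subset_rfl
    · exact Finset.empty_subset _
    · intro σ hσ; exact absurd hσ (Finset.notMem_empty _)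
  set fin : Finset (Ix d Λ) → XSt d Λ S := fun ω => run (xstep all src dst tgt K) all.card s0 ω with hfin
  have hinv : ∀ ω, XInv all dst K Good (fin ω) := fun ω => 
    run_inv (ω := ω) (fun s hs => xstep_inv all src dst tgt K hg s ω hs) all.card s0 hinv0
  refine ⟨fun ω => {x | (fin ω).act x ≠ none}, fun ω => (fin ω).failed, ?_, ?_, ?_, ?_⟩
  · intro B
    have h := run_super (G := Ω) hP (Inv := XInv all dst K Good) (W := Wt η B)
      (fun s _ => xstep_dep all src dst tgt K s) (fun s s1 _ => xstep_dep' all src dst tgt K s s1)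
      (fun s ω hs => xstep_inv all src dst tgt K hg s ω hs)
      (fun s ω _ => xstep_Fr all src dst tgt K s ω)
      (fun s hs => Wt_step all src dst tgt K hP hη hf B s hs) all.card s0 hinv0
    have h0 : Wt η B s0 = η ^ B.card := by
      simp [Wt, hs0, st0]
    rw [h0] at h
    refine le_trans (Ex_mono hP fun ω _ => ?_) h
    by_cases hb : B ⊆ (fin ω).failed
    · rw [Set.indicator_of_mem (show ω ∈ {ω | B ⊆ (fin ω).failed} from hb)]
      change 1 ≤ Wt η B (fin ω)
      unfold Wt
      rw [if_pos (fun b hb' _ => hb hb'), Finset.sdiff_eq_empty_iff_subset.2 hb]; simp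
    · rw [Set.indicator_of_notMem (show ω ∉ {ω | B ⊆ (fin ω).failed} from hb)]
      unfold Wt; split_ifs
      · positivity
      · exact le_rfl
  · intro ω
    have hstep : ∀ s : XSt d Λ S, s.act r ≠ none → (xstep all src dst tgt K s ω).act r ≠ none := by
      intro s hs
      unfold xstep
      rcases hq : nxt all src dst s with _ | q
      · exact hs
      · dsimp only; unfold stepAux
        split_ifs with h
        · dsimp only
          by_cases hx : r = dst q.1
          · rw [hx, Function.update_self]; simp
          · rw [Function.update_of_ne hx]; exact hs
        · exact hs
    refine run_inv (Inv := fun s => s.act r ≠ none) (ω := ω) hstep all.card s0 ?_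
    simp [hs0, st0]
  · intro ω σ hσ hsrc
    by_contra hcon
    push Not at hcon
    obtain ⟨h1, h2⟩ := hcon
    have h1' : (fin ω).act (dst σ) = none := by
      by_contra h; exact h1 h
    obtain ⟨z, hz⟩ := Option.ne_none_iff_exists'.1 hsrc
    refine nxt_none all src dst (run_stuck all src dst tgt K s0 hg hinv0 ω) (σ, z) ⟨hσ, ?_, hz, h1'⟩
    intro ht
    rcases (hinv ω).res σ ht with h | h
    · exact h2 h
    · exact h h1'
  · intro ω x hx
    obtain ⟨v, hv⟩ := Option.ne_none_iff_exists'.1 hx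
    refine ⟨v, (hinv ω).good x v hv, ?_⟩
    refine run_inv (Inv := fun s => ∀ x ∈ s.R, cn (flat ω ∪ (eb z0 K : Set (E d))) z0 x) (ω := ω)
      (fun s hs => xstep_cn all src dst tgt K ω s hs) all.card s0 ?_ v ((hinv ω).box x v hv (bx_self v K))
    intro y hy
    exact cn_mono Set.subset_union_right (cn_bx (bx_self z0 K) hy)

end Expl

end TP

namespace TP

section Peierls

/-- coarse grid adjacency -/
def nb (x y : ℕ × ℕ) : Prop :=
  (x.1 = y.1 ∧ (x.2 + 1 = y.2 ∨ y.2 + 1 = x.2)) ∨ (x.2 = y.2 ∧ (x.1 + 1 = y.1 ∨ y.1 + 1 = x.1))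

lemma nb_symm {x y : ℕ × ℕ} (h : nb x y) : nb y x := by
  unfold nb at *; omega

def grd (M : ℕ) (x : ℕ × ℕ) : Prop := x.1 < M ∧ x.2 < M

/-- closeness of coarse points -/
def near (x y : ℕ × ℕ) : Prop :=
  x.1 ≤ y.1 + 1 ∧ y.1 ≤ x.1 + 1 ∧ x.2 ≤ y.2 + 1 ∧ y.2 ≤ x.2 + 1

lemma near_symm {x y : ℕ × ℕ} (h : near x y) : near y x := by
  unfold near at *; omega

lemma pot (M : ℕ) (ch cv : ℕ → ℕ → ZMod 2)
    (h : ∀ a b, a + 1 < M → b + 1 < M → ch a b + cv (a+1) b + ch a (b+1) + cv a b = 0) :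
    ∃ g : ℕ → ℕ → ZMod 2, (∀ a b, g a (b+1) = g a b + cv a b) ∧
      (∀ a b, a + 1 < M → b < M → g (a+1) b = g a b + ch a b) := by
  refine ⟨fun a b => ∑ i ∈ Finset.range a, ch i 0 + ∑ j ∈ Finset.range b, cv a j, ?_, ?_⟩
  · intro a b; simp only [Finset.sum_range_succ]; ring
  · intro a b ha hb
    induction b with
    | zero => simp [Finset.sum_range_succ]
    | succ b ih =>
      have ih := ih (by omega)
      have h := h a b ha hb
      have two0 : (2 : ZMod 2) = 0 := rfl
      simp only [Finset.sum_range_succ] at ih ⊢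
      linear_combination ih + h - (cv a b + ch a (b+1)) * two0

/-- active component -/
def Acomp (M : ℕ) (act : Set (ℕ × ℕ)) (r : ℕ × ℕ) : Set (ℕ × ℕ) :=
  {x | Relation.ReflTransGen (fun x y => nb x y ∧ grd M y ∧ y ∈ act) r x}

def Qcomp (M : ℕ) (A : Set (ℕ × ℕ)) (v : ℕ × ℕ) : Set (ℕ × ℕ) :=
  {x | Relation.ReflTransGen (fun x y => nb x y ∧ grd M y ∧ y ∉ A) v x}

def cutE (A Q : Set (ℕ × ℕ)) : Set ((ℕ × ℕ) × (ℕ × ℕ)) := {σ | σ.1 ∈ A ∧ σ.2 ∈ Q ∧ nb σ.1 σ.2}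

section
variable {M : ℕ} {act : Set (ℕ × ℕ)} {r v : ℕ × ℕ}

lemma Acomp_sub (hr : r ∈ act) (gr : grd M r) {x : ℕ × ℕ} (h : x ∈ Acomp M act r) : x ∈ act ∧ grd M x := by
  unfold Acomp at h
  rcases Relation.ReflTransGen.cases_tail h with h | ⟨y, _, h⟩
  · rw [h]; exact ⟨hr, gr⟩
  · exact ⟨h.2.2, h.2.1⟩

lemma Qcomp_sub {A : Set (ℕ × ℕ)} (hv : v ∉ A) (gv : grd M v) {x : ℕ × ℕ} (h : x ∈ Qcomp M A v) : x ∉ A ∧ grd M x := by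
  unfold Qcomp at h
  rcases Relation.ReflTransGen.cases_tail h with h | ⟨y, _, h⟩
  · rw [h]; exact ⟨hv, gv⟩
  · exact ⟨h.2.2, h.2.1⟩

lemma Qcomp_bd {A : Set (ℕ × ℕ)} {x y : ℕ × ℕ} (gx : grd M x) (hx : x ∉ Qcomp M A v)
    (hy : y ∈ Qcomp M A v) (h : nb x y) : x ∈ A := by
  by_contra hxa
  exact hx (Relation.ReflTransGen.tail hy ⟨nb_symm h, gx, hxa⟩)

lemma cut_dst (hr : r ∈ act) (gr : grd M r) (hv : v ∉ act) (gv : grd M v)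
    {σ : (ℕ × ℕ) × (ℕ × ℕ)} (h : σ ∈ cutE (Acomp M act r) (Qcomp M (Acomp M act r) v)) :
    σ.2 ∉ act := by
  intro ha
  have h2 := Qcomp_sub (fun h => hv (Acomp_sub hr gr h).1) gv h.2.1
  exact h2.1 (Relation.ReflTransGen.tail h.1 ⟨h.2.2, h2.2, ha⟩)

theorem cut_conn (hr : r ∈ act) (gr : grd M r) (hv : v ∉ act) (gv : grd M v)
    {σ₀ σ : (ℕ × ℕ) × (ℕ × ℕ)} (h0 : σ₀ ∈ cutE (Acomp M act r) (Qcomp M (Acomp M act r) v))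
    (h1 : σ ∈ cutE (Acomp M act r) (Qcomp M (Acomp M act r) v)) :
    Relation.ReflTransGen (fun σ τ : (ℕ × ℕ) × (ℕ × ℕ) => near σ.1 τ.1 ∧
      τ ∈ cutE (Acomp M act r) (Qcomp M (Acomp M act r) v)) σ₀ σ := by
  classical
  set A := Acomp M act r with hA
  set Q := Qcomp M A v with hQ
  set Pi := cutE A Q with hPi
  have hvA : v ∉ A := fun h => hv (Acomp_sub hr gr h).1
  have hAg : ∀ x ∈ A, grd M x := fun x h => (Acomp_sub hr gr h).2
  have hQA : ∀ x ∈ Q, x ∉ A := fun x h => (Qcomp_sub hvA gv h).1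
  have hQg : ∀ x ∈ Q, grd M x := fun x h => (Qcomp_sub hvA gv h).2
  set P1 : Set ((ℕ × ℕ) × (ℕ × ℕ)) := {σ | σ ∈ Pi ∧ Relation.ReflTransGen (fun σ τ : (ℕ × ℕ) × (ℕ × ℕ) => near σ.1 τ.1 ∧ τ ∈ Pi) σ₀ σ} with hP1
  set c : ℕ × ℕ → ℕ × ℕ → ZMod 2 := fun x y => if (x, y) ∈ P1 ∨ (y, x) ∈ P1 then 1 else 0 with hc
  set χ : ℕ × ℕ → ZMod 2 := fun x => if x ∈ Q then 1 else 0 with hχ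
  have csymm : ∀ x y, c x y = c y x := by
    intro x y; exact if_congr or_comm rfl rfl
  have hPi' : ∀ x y, nb x y → grd M x → grd M y → 
      (if (x, y) ∈ Pi ∨ (y, x) ∈ Pi then (1 : ZMod 2) else 0) = χ x + χ y := by
    intro x y hn gx gy
    by_cases hx : x ∈ Q <;> by_cases hy : y ∈ Q
    · rw [if_neg]
      · simp [hχ, hx, hy]; rfl
      · rintro (h | h)
        · exact hQA x hx h.1
        · exact hQA y hy h.1
    · rw [if_pos]
      · simp [hχ, hx, hy]
      · exact Or.inr ⟨Qcomp_bd gy hy hx (nb_symm hn), hx, nb_symm hn⟩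
    · rw [if_pos]
      · simp [hχ, hx, hy]
      · exact Or.inl ⟨Qcomp_bd gx hx hy hn, hy, hn⟩
    · rw [if_neg]
      · simp [hχ, hx, hy]
      · rintro (h | h)
        · exact hy h.2.1
        · exact hx h.2.1
  -- plaquette relation
  have plaq : ∀ a b, a + 1 < M → b + 1 < M → c (a,b) (a+1,b) + c (a+1,b) (a+1,b+1) + 
      c (a,b+1) (a+1,b+1) + c (a,b) (a,b+1) = 0 := by
    intro a b ha hb
    set co : ℕ × ℕ → Prop := fun x => (x.1 = a ∨ x.1 = a + 1) ∧ (x.2 = b ∨ x.2 = b + 1) with hco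
    by_cases hex : ∃ σ ∈ P1, co σ.1 ∧ co σ.2
    · obtain ⟨σ', hσ', hc1, hc2⟩ := hex
      have key : ∀ x y, co x → co y → nb x y → c x y = χ x + χ y := by
        intro x y hx hy hn
        rw [← hPi' x y hn (by unfold grd; simp only [hco] at hx; omega) (by unfold grd; simp only [hco] at hy; omega)]
        have up : ∀ τ : (ℕ × ℕ) × (ℕ × ℕ), co τ.1 → (τ ∈ P1 ↔ τ ∈ Pi) := by
          intro τ hτ
          refine ⟨fun h => h.1, fun h => ⟨h, hσ'.2.tail ⟨?_, h⟩⟩⟩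
          simp only [hco] at hτ hc1; unfold near; omega
        simp only [hc]
        refine if_congr (or_congr (up _ hx) (up _ hy)) rfl rfl
      rw [key (a,b) (a+1,b) (by simp [hco]) (by simp [hco]) (by simp [nb]),
        key (a+1,b) (a+1,b+1) (by simp [hco]) (by simp [hco]) (by simp [nb]),
        key (a,b+1) (a+1,b+1) (by simp [hco]) (by simp [hco]) (by simp [nb]),
        key (a,b) (a,b+1) (by simp [hco]) (by simp [hco]) (by simp [nb])]
      have two0 : (2 : ZMod 2) = 0 := rfl
      linear_combination (χ (a,b) + χ (a+1,b) + χ (a,b+1) + χ (a+1,b+1)) * two0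
    · have key : ∀ x y, co x → co y → c x y = 0 := by
        intro x y hx hy
        simp only [hc]
        rw [if_neg]
        rintro (h | h)
        · exact hex ⟨_, h, hx, hy⟩
        · exact hex ⟨_, h, hy, hx⟩
      rw [key (a,b) (a+1,b) (by simp [hco]) (by simp [hco]),
        key (a+1,b) (a+1,b+1) (by simp [hco]) (by simp [hco]),
        key (a,b+1) (a+1,b+1) (by simp [hco]) (by simp [hco]),
        key (a,b) (a,b+1) (by simp [hco]) (by simp [hco])]
      simp
  obtain ⟨g, g1, g2⟩ := pot M (fun a b => c (a,b) (a+1,b)) (fun a b => c (a,b) (a,b+1)) plaq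
  have two0 : (2 : ZMod 2) = 0 := rfl
  have hg : ∀ x y, nb x y → grd M x → grd M y → g y.1 y.2 = g x.1 x.2 + c x y := by
    rintro ⟨a, b⟩ ⟨a', b'⟩ hn gx gy
    simp only [nb, grd] at hn gx gy ⊢
    rcases hn with ⟨rfl, rfl | rfl⟩ | ⟨rfl, rfl | rfl⟩
    · exact g1 a b
    · rw [g1, csymm (a, b'+1)]; linear_combination -c (a,b') (a,b'+1) * two0
    · exact g2 a b gy.1 gy.2
    · rw [g2 _ _ gx.1 gx.2, csymm (a'+1, b)]; linear_combination -c (a',b) (a'+1,b) * two0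
  have gA : ∀ x ∈ A, g x.1 x.2 = g r.1 r.2 := by
    intro x hx
    have hx' : Relation.ReflTransGen (fun x y => nb x y ∧ grd M y ∧ y ∈ act) r x := hx
    clear hx
    induction hx' with
    | refl => rfl
    | @tail y z h3 h4 ih =>
      have hy : y ∈ A := h3
      have hz : z ∈ A := h3.tail h4
      rw [hg y z h4.1 (hAg y hy) (hAg z hz), ih]
      simp only [hc]
      rw [if_neg, add_zero]
      rintro (h | h)
      · exact hQA _ h.1.2.1 hz
      · exact hQA _ h.1.2.1 hy
  have gQ : ∀ x ∈ Q, g x.1 x.2 = g v.1 v.2 := by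
    intro x hx
    have hx' : Relation.ReflTransGen (fun x y => nb x y ∧ grd M y ∧ y ∉ A) v x := hx
    clear hx
    induction hx' with
    | refl => rfl
    | @tail y z h3 h4 ih =>
      have hy : y ∈ Q := h3
      have hz : z ∈ Q := h3.tail h4
      rw [hg y z h4.1 (hQg y hy) (hQg z hz), ih]
      simp only [hc]
      rw [if_neg, add_zero]
      rintro (h | h)
      · exact hQA _ hy h.1.1
      · exact hQA _ hz h.1.1
  have cP : ∀ τ ∈ Pi, g v.1 v.2 = g r.1 r.2 + c τ.1 τ.2 := by
    intro τ hτ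
    rw [← gQ τ.2 hτ.2.1, ← gA τ.1 hτ.1]
    exact hg _ _ hτ.2.2 (hAg _ hτ.1) (hQg _ hτ.2.1)
  have e0 : c σ₀.1 σ₀.2 = 1 := by
    simp only [hc]
    rw [if_pos]
    exact Or.inl ⟨h0, Relation.ReflTransGen.refl⟩
  have e1 : c σ.1 σ.2 = 1 := by
    have := cP σ h1
    rw [cP σ₀ h0, e0] at this
    exact (add_left_cancel this).symm
  simp only [hc] at e1
  split_ifs at e1 with h
  · rcases h with h | h
    · exact h.2
    · exact absurd h1.1 (hQA _ h.1.2.1)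
  · exact absurd e1 (by decide)

end

end Peierls

end TP

namespace TP

section Count
variable {α : Type*} [DecidableEq α]

lemma cover {R : α → α → Prop} (hR : ∀ a b, R a b → R b a) {P : Finset α} {x : α} (hx : x ∈ P)
    (conn : ∀ y ∈ P, Relation.ReflTransGen (fun a b => R a b ∧ b ∈ P) x y) (k : ℕ) (hk : k + 1 ≤ P.card) :
    ∃ l : List α, l.IsChain R ∧ l.head? = some x ∧ l.length = 2 * k + 1 ∧ l.toFinset ⊆ P ∧
      l.toFinset.card = k + 1 := by
  induction k with
  | zero => exact ⟨[x], by simp, by simp, by simp, by simpa using hx, by simp⟩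
  | succ k ih =>
    obtain ⟨l, h1, h2, h3, h4, h5⟩ := ih (by omega)
    obtain ⟨y, hy, hyl⟩ := Finset.exists_mem_notMem_of_card_lt_card (s := l.toFinset) (t := P) (by omega)
    have hxl : x ∈ l.toFinset := by
      rw [List.mem_toFinset]; exact List.mem_of_mem_head? h2
    have : ∃ t s, t ∈ l.toFinset ∧ s ∉ l.toFinset ∧ s ∈ P ∧ R t s := by
      have hc := conn y hy
      clear hy
      induction hc with
      | refl => exact absurd hxl hyl
      | @tail b c hb hbc ihc =>
        by_cases hbl : b ∈ l.toFinset
        · exact ⟨b, c, hbl, hyl, hbc.2, hbc.1⟩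
        · exact ihc hbl
    obtain ⟨t, s, ht, hs, hsP, hts⟩ := this
    obtain ⟨l1, l2, rfl⟩ := List.append_of_mem (List.mem_toFinset.1 ht)
    refine ⟨l1 ++ t :: s :: t :: l2, ?_, ?_, ?_, ?_, ?_⟩
    · rw [List.isChain_split] at h1 ⊢
      refine ⟨h1.1, ?_⟩
      rw [List.isChain_cons_cons, List.isChain_cons_cons]
      exact ⟨hts, hR _ _ hts, h1.2⟩
    · cases l1 with
      | nil => simpa using h2
      | cons a l => simpa using h2
    · simp at h3 ⊢; omega
    · intro u hu
      by_cases hus : u = s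
      · rw [hus]; exact hsP
      · apply h4; simp at hu ⊢; tauto
    · have : (l1 ++ t :: s :: t :: l2).toFinset = insert s (l1 ++ t :: l2).toFinset := by
        ext u; simp
      rw [this, Finset.card_insert_of_notMem hs, h5]

/-- lists that are chains for the neighbour function -/
def chs (nbf : α → Finset α) : ℕ → α → Finset (List α)
  | 0, x => {[x]}
  | n+1, x => (nbf x).biUnion fun y => (chs nbf n y).image (fun l => x :: l)

lemma chs_card {nbf : α → Finset α} {D : ℕ} (hD : ∀ x, (nbf x).card ≤ D) (n : ℕ) (x : α) :
    (chs nbf n x).card ≤ D ^ n := by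
  induction n generalizing x with
  | zero => simp [chs]
  | succ n ih =>
    simp only [chs]
    refine Finset.card_biUnion_le.trans ?_
    calc _ ≤ ∑ y ∈ nbf x, D ^ n := Finset.sum_le_sum fun y _ => Finset.card_image_le.trans (ih y)
      _ = (nbf x).card * D ^ n := by simp
      _ ≤ D * D ^ n := Nat.mul_le_mul_right _ (hD x)
      _ = _ := by ring

lemma mem_chs {R : α → α → Prop} {nbf : α → Finset α} (h : ∀ a b, R a b → b ∈ nbf a) (n : ℕ) (x : α)
    (l : List α) (h1 : l.IsChain R) (h2 : l.head? = some x) (h3 : l.length = n + 1) :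
    l ∈ chs nbf n x := by
  induction n generalizing x l with
  | zero =>
    cases l with
    | nil => simp at h3
    | cons a l => 
      simp at h2 h3
      subst h2 h3
      simp [chs]
  | succ n ih =>
    cases l with
    | nil => simp at h3
    | cons a l =>
      cases l with
      | nil => simp at h3
      | cons b l =>
        simp only [List.head?_cons, Option.some.injEq] at h2
        subst h2
        rw [List.isChain_cons_cons] at h1
        simp only [chs, Finset.mem_biUnion, Finset.mem_image]
        exact ⟨b, h _ _ h1.1, b :: l, ih b (b :: l) h1.2 rfl (by simpa using h3), rfl⟩

end Count

section Anchor

/-- sup-distance at most `L` -/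
def cl (L : ℕ) (x y : ℕ × ℕ) : Prop :=
  x.1 ≤ y.1 + L ∧ y.1 ≤ x.1 + L ∧ x.2 ≤ y.2 + L ∧ y.2 ≤ x.2 + L

lemma clean (f : (ℕ × ℕ) × (ℕ × ℕ) → ℕ) (P : Finset ((ℕ × ℕ) × (ℕ × ℕ))) (M w : ℕ) (hM : P.card < M)
    (hw : w < M) : ∃ x, x < M ∧ x ≤ w + P.card ∧ w ≤ x + P.card ∧ ∀ σ ∈ P, f σ ≠ x := by
  obtain ⟨x, hx, hx'⟩ := Finset.exists_mem_notMem_of_card_lt_card (s := P.image f)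
    (t := Finset.Icc (min w (M - 1 - P.card)) (min w (M - 1 - P.card) + P.card))
    (by
      have := Finset.card_image_le (s := P) (f := f)
      rw [Nat.card_Icc]; omega)
  rw [Finset.mem_Icc] at hx
  refine ⟨x, by omega, by omega, by omega, fun σ hσ h => hx' ?_⟩
  rw [← h]; exact Finset.mem_image_of_mem _ hσ

lemma anchor {M : ℕ} {A : Set (ℕ × ℕ)} {r v : ℕ × ℕ} (gr : grd M r) (gv : grd M v) (hrA : r ∈ A)
    (hAg : ∀ x ∈ A, grd M x) (hvA : v ∉ A) (P : Finset ((ℕ × ℕ) × (ℕ × ℕ)))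
    (hP : ∀ σ, σ ∈ P ↔ σ ∈ cutE A (Qcomp M A v)) :
    ∃ σ ∈ P, cl P.card v σ.1 ∨ cl P.card r σ.1 := by
  set Q := Qcomp M A v with hQ
  have hrQ : r ∉ Q := fun h => (Qcomp_sub hvA gv h).1 hrA
  have hvQ : v ∈ Q := Relation.ReflTransGen.refl
  by_cases hL : M ≤ P.card
  · have : 0 < P.card := by have := gr.1; omega
    obtain ⟨σ, hσ⟩ := Finset.card_pos.1 this
    refine ⟨σ, hσ, Or.inl ?_⟩
    have h1 := hAg _ ((hP σ).1 hσ).1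
    unfold grd at h1 gv; unfold cl; omega
  push Not at hL
  by_contra hcon
  push Not at hcon
  have nocross : ∀ p q, nb p q → grd M p → grd M q → (p, q) ∉ P → (q, p) ∉ P → (p ∈ Q ↔ q ∈ Q) := by
    intro p q hn gp gq h1 h2
    constructor
    · intro hp
      by_contra hq
      exact h2 ((hP _).2 ⟨Qcomp_bd gq hq hp (nb_symm hn), hp, nb_symm hn⟩)
    · intro hq
      by_contra hp
      exact h1 ((hP _).2 ⟨Qcomp_bd gp hp hq hn, hq, hn⟩)
  have rowseg : ∀ b s k, b < M → s + k < M → (∀ σ ∈ P, σ.1.2 = b → s ≤ σ.1.1 → σ.1.1 ≤ s + k → False) →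
      ((s, b) ∈ Q ↔ (s + k, b) ∈ Q) := by
    intro b s k hb
    induction k with
    | zero => intro _ _; rfl
    | succ k ih =>
      intro hk h
      rw [ih (by omega) (fun σ hσ h1 h2 h3 => h σ hσ h1 h2 (by omega))]
      refine nocross _ _ (Or.inr ⟨rfl, Or.inl rfl⟩) ⟨by dsimp only; omega, hb⟩ ⟨hk, hb⟩ ?_ ?_
      · intro h1; exact h _ h1 rfl (by dsimp only; omega) (by dsimp only; omega)
      · intro h1; exact h _ h1 rfl (by dsimp only; omega) (by dsimp only; omega)
  have colseg : ∀ a k, a < M → k < M → (∀ σ ∈ P, σ.1.1 ≠ a) →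
      ((a, 0) ∈ Q ↔ (a, k) ∈ Q) := by
    intro a k ha
    induction k with
    | zero => intro _ _; rfl
    | succ k ih =>
      intro hk h
      rw [ih (by omega) h]
      refine nocross _ _ (Or.inl ⟨rfl, Or.inl rfl⟩) ⟨ha, by dsimp only; omega⟩ ⟨ha, hk⟩ ?_ ?_
      · intro h1; exact h _ h1 rfl
      · intro h1; exact h _ h1 rfl
  have rowseg' : ∀ b s t, b < M → s < M → t < M → 
      (∀ σ ∈ P, σ.1.2 = b → min s t ≤ σ.1.1 → σ.1.1 ≤ max s t → False) →
      ((s, b) ∈ Q ↔ (t, b) ∈ Q) := by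
    intro b s t hb hs ht h
    rcases le_total s t with hst | hst
    · obtain ⟨k, rfl⟩ := Nat.exists_eq_add_of_le hst
      exact rowseg b s k hb ht (fun σ hσ h1 h2 h3 => h σ hσ h1 (by omega) (by omega))
    · obtain ⟨k, rfl⟩ := Nat.exists_eq_add_of_le hst
      exact (rowseg b t k hb hs (fun σ hσ h1 h2 h3 => h σ hσ h1 (by omega) (by omega))).symm
  obtain ⟨x, x1, x2, x3, x4⟩ := clean (fun σ => σ.1.1) P M v.1 hL gv.1
  obtain ⟨x', x1', x2', x3', x4'⟩ := clean (fun σ => σ.1.1) P M r.1 hL gr.1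
  obtain ⟨y, y1, -, -, y4⟩ := clean (fun σ => σ.1.2) P M r.1 hL gr.1
  have a1 : v ∈ Q ↔ (x, v.2) ∈ Q := by
    refine rowseg' v.2 v.1 x gv.2 gv.1 x1 fun σ hσ h1 h2 h3 => (hcon σ hσ).1 ?_
    unfold cl; omega
  have a2 : r ∈ Q ↔ (x', r.2) ∈ Q := by
    refine rowseg' r.2 r.1 x' gr.2 gr.1 x1' fun σ hσ h1 h2 h3 => (hcon σ hσ).2 ?_
    unfold cl; omega
  have a3 := (colseg x v.2 x1 gv.2 x4).symm.trans (colseg x y x1 y1 x4)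
  have a4 := (colseg x' r.2 x1' gr.2 x4').symm.trans (colseg x' y x1' y1 x4')
  have a5 := rowseg' y x x' y1 x1 x1' fun σ hσ h1 _ _ => y4 σ hσ h1
  exact hrQ (a2.2 (a4.2 (a5.1 (a3.1 (a1.1 hvQ)))))

def nbS (x : ℕ × ℕ) (L : ℕ) : Finset (ℕ × ℕ) :=
  Finset.Icc (x.1 - L) (x.1 + L) ×ˢ Finset.Icc (x.2 - L) (x.2 + L)

lemma mem_nbS {x y : ℕ × ℕ} {L : ℕ} : y ∈ nbS x L ↔ cl L x y := by
  simp only [nbS, Finset.mem_product, Finset.mem_Icc, cl]; omega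

lemma nbS_card (x : ℕ × ℕ) (L : ℕ) : (nbS x L).card ≤ (2 * L + 1) ^ 2 := by
  simp only [nbS, Finset.card_product, Nat.card_Icc, sq]
  exact Nat.mul_le_mul (by omega) (by omega)

/-- directed edges whose tail is at distance at most `L` -/
def nbG (x : ℕ × ℕ) (L : ℕ) : Finset ((ℕ × ℕ) × (ℕ × ℕ)) :=
  (nbS x L).biUnion fun y => (nbS y 1).image (fun z => (y, z))

lemma mem_nbG {x : ℕ × ℕ} {L : ℕ} {σ : (ℕ × ℕ) × (ℕ × ℕ)} (h1 : cl L x σ.1) (h2 : cl 1 σ.1 σ.2) :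
    σ ∈ nbG x L := by
  simp only [nbG, Finset.mem_biUnion, Finset.mem_image]
  exact ⟨σ.1, mem_nbS.2 h1, σ.2, mem_nbS.2 h2, rfl⟩

lemma nbG_card (x : ℕ × ℕ) (L : ℕ) : (nbG x L).card ≤ (2 * L + 1) ^ 2 * 9 := by
  unfold nbG
  refine Finset.card_biUnion_le.trans ?_
  calc _ ≤ ∑ y ∈ nbS x L, 9 := Finset.sum_le_sum fun y _ => 
        Finset.card_image_le.trans (nbS_card y 1)
    _ ≤ _ := by
      rw [Finset.sum_const, smul_eq_mul]
      exact Nat.mul_le_mul_right _ (nbS_card x L)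

end Anchor

theorem peierls {α : Type*} [DecidableEq α] {Ω : Finset α} {pp : α → ℝ} (hP : IsP pp) {η : ℝ} (hη : 0 ≤ η)
    (hη' : 1062882 * η ≤ 1/2)
    {act : Finset α → Set (ℕ × ℕ)} {failed : Finset α → Finset ((ℕ × ℕ) × (ℕ × ℕ))}
    (hB : ∀ B, Pr Ω pp (fun ω => B ⊆ failed ω) ≤ η ^ B.card) {M : ℕ} {r v : ℕ × ℕ}
    (gr : grd M r) (gv : grd M v) (hr : ∀ ω, r ∈ act ω)
    (hs : ∀ ω, ∀ σ : (ℕ × ℕ) × (ℕ × ℕ), nb σ.1 σ.2 → grd M σ.1 → grd M σ.2 → σ.1 ∈ act ω → 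
      σ.2 ∈ act ω ∨ σ ∈ failed ω) :
    Pr Ω pp (fun ω => v ∉ act ω) ≤ 2 * (1062882 * η) := by
  classical
  set G : Finset ((ℕ × ℕ) × (ℕ × ℕ)) := (Finset.range M ×ˢ Finset.range M) ×ˢ (Finset.range M ×ˢ Finset.range M)
    with hG
  set q : ℝ := 1062882 * η with hq
  have hq0 : 0 ≤ q := by positivity
  set nbf : (ℕ × ℕ) × (ℕ × ℕ) → Finset ((ℕ × ℕ) × (ℕ × ℕ)) := fun σ => nbG σ.1 1 with hnbf
  set anc : ℕ → Finset ((ℕ × ℕ) × (ℕ × ℕ)) := fun L => nbG v L ∪ nbG r L with hanc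
  -- deterministic part
  have det : ∀ ω, v ∉ act ω → ∃ k ∈ Finset.range G.card, ∃ σ ∈ anc (k+1), ∃ l ∈ chs nbf (2*k) σ,
      l.toFinset.card = k + 1 ∧ l.toFinset ⊆ failed ω := by
    intro ω hv
    set A := Acomp M (act ω) r with hA
    set Q := Qcomp M A v with hQ
    have hvA : v ∉ A := fun h => hv (Acomp_sub (hr ω) gr h).1
    have hAg : ∀ x ∈ A, grd M x := fun x h => (Acomp_sub (hr ω) gr h).2
    have hQg : ∀ x ∈ Q, grd M x := fun x h => (Qcomp_sub hvA gv h).2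
    set P := G.filter (fun σ => σ ∈ cutE A Q) with hPdef
    have hPm : ∀ σ, σ ∈ P ↔ σ ∈ cutE A Q := by
      intro σ
      rw [hPdef, Finset.mem_filter]
      refine ⟨fun h => h.2, fun h => ⟨?_, h⟩⟩
      have h1 := hAg _ h.1
      have h2 := hQg _ h.2.1
      simp only [hG, Finset.mem_product, Finset.mem_range]
      exact ⟨h1, h2⟩
    have hPf : P ⊆ failed ω := by
      intro σ hσ
      have h := (hPm σ).1 hσ
      rcases hs ω σ h.2.2 (hAg _ h.1) (hQg _ h.2.1) (Acomp_sub (hr ω) gr h.1).1 with h' | h'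
      · exact absurd h' (cut_dst (hr ω) gr hv gv h)
      · exact h'
    obtain ⟨σ, hσ, hcl⟩ := anchor gr gv (show r ∈ A from Relation.ReflTransGen.refl) hAg hvA P hPm
    have hpos : 0 < P.card := Finset.card_pos.2 ⟨σ, hσ⟩
    have hnear : ∀ τ ∈ P, cl 1 τ.1 τ.2 := by
      intro τ hτ
      have := ((hPm τ).1 hτ).2.2
      unfold nb at this; unfold cl; omega
    obtain ⟨k, hk⟩ : ∃ k, P.card = k + 1 := Nat.exists_eq_succ_of_ne_zero hpos.ne'
    have hconn := cover (R := fun σ τ : (ℕ × ℕ) × (ℕ × ℕ) => near σ.1 τ.1 ∧ cl 1 σ.1 σ.2 ∧ cl 1 τ.1 τ.2)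
      (P := P) (x := σ) (fun a b h => ⟨near_symm h.1, h.2.2, h.2.1⟩) hσ
      (by
        intro τ hτ
        have hc := cut_conn (hr ω) gr hv gv ((hPm σ).1 hσ) ((hPm τ).1 hτ)
        clear hτ
        induction hc with
        | refl => exact Relation.ReflTransGen.refl
        | @tail b c h3 h4 ih =>
          have hc' : c ∈ P := (hPm c).2 h4.2
          have hb' : b ∈ P := by
            rcases Relation.ReflTransGen.cases_tail h3 with h | ⟨e, _, h⟩
            · rw [h]; exact hσ
            · exact (hPm b).2 h.2
          exact ih.tail ⟨⟨h4.1, hnear b hb', hnear c hc'⟩, hc'⟩) k hk.ge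
    obtain ⟨l, h1, h2, h3, h4, h5⟩ := hconn
    refine ⟨k, ?_, σ, ?_, l, ?_, h5, h4.trans hPf⟩
    · rw [Finset.mem_range]
      have := Finset.card_filter_le G (fun σ => σ ∈ cutE A Q)
      rw [← hPdef] at this; omega
    · rw [hanc, Finset.mem_union, ← hk]
      rcases hcl with h | h
      · exact Or.inl (mem_nbG h (hnear σ hσ))
      · exact Or.inr (mem_nbG h (hnear σ hσ))
    · refine mem_chs ?_ (2*k) σ l h1 h2 h3
      rintro a b ⟨n1, n2, n3⟩
      refine mem_nbG ?_ n3
      unfold near at n1; unfold cl; omega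
  refine (Pr_mono (T := fun ω => ∃ k ∈ Finset.range G.card, ∃ σ ∈ anc (k+1), ∃ l ∈ chs nbf (2*k) σ,
      l.toFinset.card = k + 1 ∧ l.toFinset ⊆ failed ω) hP fun ω _ h => det ω h).trans ?_
  refine (Pr_exists_le _ hP (fun k ω => ∃ σ ∈ anc (k+1), ∃ l ∈ chs nbf (2*k) σ,
      l.toFinset.card = k + 1 ∧ l.toFinset ⊆ failed ω)).trans ?_
  have term : ∀ k, Pr Ω pp (fun ω => ∃ σ ∈ anc (k+1), ∃ l ∈ chs nbf (2*k) σ,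
      l.toFinset.card = k + 1 ∧ l.toFinset ⊆ failed ω) ≤ q ^ (k+1) := by
    intro k
    refine (Pr_exists_le _ hP (fun σ ω => ∃ l ∈ chs nbf (2*k) σ,
      l.toFinset.card = k + 1 ∧ l.toFinset ⊆ failed ω)).trans ?_
    have t1 : ∀ σ, Pr Ω pp (fun ω => ∃ l ∈ chs nbf (2*k) σ,
      l.toFinset.card = k + 1 ∧ l.toFinset ⊆ failed ω) ≤ (81:ℝ) ^ (2*k) * η ^ (k+1) := by
      intro σ
      refine (Pr_exists_le _ hP (fun (l : List ((ℕ × ℕ) × (ℕ × ℕ))) ω => l.toFinset.card = k + 1 ∧ l.toFinset ⊆ failed ω)).trans ?_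
      have t2 : ∀ l ∈ chs nbf (2*k) σ, Pr Ω pp (fun ω => l.toFinset.card = k + 1 ∧ l.toFinset ⊆ failed ω) ≤ η ^ (k+1) := by
        intro l _
        by_cases hl : l.toFinset.card = k + 1
        · rw [← hl]
          exact (Pr_mono hP fun ω _ h => h.2).trans (hB _)
        · refine (Pr_mono (T := fun _ => False) hP fun ω _ h => hl h.1).trans ?_
          have : Pr Ω pp (fun _ => False) = 0 := by
            unfold Pr; simp [Ex_const]
          rw [this]; positivity
      refine (Finset.sum_le_sum t2).trans ?_
      rw [Finset.sum_const, nsmul_eq_mul]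
      refine mul_le_mul_of_nonneg_right ?_ (by positivity)
      have := chs_card (nbf := nbf) (D := 81) (fun σ => nbG_card σ.1 1) (2*k) σ
      exact_mod_cast this
    refine (Finset.sum_le_sum fun σ _ => t1 σ).trans ?_
    rw [Finset.sum_const, nsmul_eq_mul]
    have t3 : ((anc (k+1)).card : ℝ) ≤ 18 * 9 ^ (k+1) := by
      have h1 := nbG_card v (k+1)
      have h2 := nbG_card r (k+1)
      have h3 := Finset.card_union_le (nbG v (k+1)) (nbG r (k+1))
      have h4 : 2 * (k+1) + 1 ≤ 3 ^ (k+1) := by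
        clear h1 h2 h3 t1
        induction k with
        | zero => norm_num
        | succ k ih => rw [pow_succ]; omega
      have h5 : (2 * (k+1) + 1) ^ 2 ≤ 9 ^ (k+1) := by
        calc _ ≤ (3 ^ (k+1)) ^ 2 := Nat.pow_le_pow_left h4 2
          _ = 9 ^ (k+1) := by rw [← pow_mul, mul_comm, pow_mul]; norm_num
      have : (anc (k+1)).card ≤ 18 * 9 ^ (k+1) := by
        simp only [hanc]; omega
      exact_mod_cast this
    calc ((anc (k+1)).card : ℝ) * (81 ^ (2*k) * η ^ (k+1)) 
        ≤ (18 * 9 ^ (k+1)) * (81 ^ (2*k) * η ^ (k+1)) := mul_le_mul_of_nonneg_right t3 (by positivity)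
      _ ≤ (18 ^ (k+1) * 9 ^ (k+1)) * (81 ^ (2*(k+1)) * η ^ (k+1)) := by
        refine mul_le_mul (mul_le_mul_of_nonneg_right ?_ (by positivity)) 
          (mul_le_mul_of_nonneg_right ?_ (by positivity)) (by positivity) (by positivity)
        · calc (18:ℝ) = 18 ^ 1 := by norm_num
            _ ≤ 18 ^ (k+1) := pow_le_pow_right₀ (by norm_num) (by omega)
        · exact pow_le_pow_right₀ (by norm_num) (by omega)
      _ = q ^ (k+1) := by
        rw [pow_mul, hq, mul_pow, ← mul_pow, ← mul_assoc, ← mul_pow]; norm_num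
  refine (Finset.sum_le_sum fun k _ => term k).trans ?_
  have geo : ∀ n : ℕ, ∑ k ∈ Finset.range n, q ^ (k+1) ≤ 2 * q - 2 * q * q ^ n := by
    intro n
    induction n with
    | zero => simp
    | succ n ih =>
      rw [Finset.sum_range_succ]
      have h1 : 0 ≤ q ^ n := by positivity
      have h2 : 0 ≤ q * q ^ n := by positivity
      have : 2 * q * q ^ (n+1) ≤ q * q ^ n := by
        rw [pow_succ]; nlinarith
      rw [pow_succ] at this ⊢
      nlinarith
  have h1 : 0 ≤ 2 * q * q ^ G.card := by positivity
  linarith [geo G.card]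

end TP

namespace TP

open TorusPerc (stdVec)

lemma epsel {c c' : ℝ} (hc : 0 < c) (h : c' < c) (C : ℕ) : ∃ ε : ℝ, 0 < ε ∧ ε < 1 ∧ c' ≤ c * (1 - ε) ^ C := by
  set ε := min (1/2) ((c - c') / (c * (C + 1))) with hε
  have hpos : 0 < c * ((C:ℝ) + 1) := by positivity
  have h1 : 0 < ε := lt_min (by norm_num) (div_pos (by linarith) hpos)
  have h2 : ε ≤ 1/2 := min_le_left _ _
  have h3 : ε * (c * (C + 1)) ≤ c - c' := by
    rw [← le_div_iff₀ hpos]; exact min_le_right _ _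
  refine ⟨ε, h1, by linarith, ?_⟩
  have h4 := one_add_mul_le_pow (a := -ε) (by linarith) C
  have h5 : c * (1 + C * -ε) ≤ c * (1 + -ε) ^ C := mul_le_mul_of_nonneg_left h4 hc.le
  have : (1 + -ε) = 1 - ε := by ring
  rw [this] at h5
  have : 0 < ε * c := by positivity
  nlinarith

section Geo2
variable {d : ℕ}

lemma bx_card (z : V d) (n : ℕ) : (bx z n).card = (2 * n + 1) ^ d := by
  unfold bx
  rw [Pi.card_Icc]
  have : ∀ k, (Finset.Icc (z k - n) (z k + n)).card = 2 * n + 1 := by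
    intro k; rw [Int.card_Icc]; omega
  simp [this]

lemma eb_card (z : V d) (n : ℕ) : (eb z n).card ≤ (2 * n + 1) ^ d * d := by
  unfold eb ew
  refine (Finset.card_filter_le _ _).trans ?_
  rw [Finset.card_product, bx_card]; simp

/-- edges of the box `[0,N)^d` -/
noncomputable def FB (d N : ℕ) : Finset (E d) := ew (Finset.Icc (0 : V d) (fun _ => (N : ℤ) - 1))

lemma mem_FB {N : ℕ} {e : E d} : e ∈ FB d N ↔ (∀ k, 0 ≤ e.1 k ∧ e.1 k ≤ (N:ℤ) - 1) ∧
    ∀ k, 0 ≤ (e.1 + stdVec d e.2) k ∧ (e.1 + stdVec d e.2) k ≤ (N:ℤ) - 1 := by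
  simp only [FB, mem_ew, Finset.mem_Icc, Pi.le_def, forall_and]; rfl

/-- centres of the coarse cells -/
def cen (n : ℕ) (i j : Fin d) (x : ℕ × ℕ) : V d :=
  fun k => 2 * n + (if k = i then (n:ℤ) * x.1 else if k = j then (n:ℤ) * x.2 else 0)

lemma bx_sub {z w : V d} {m k l : ℕ} (h : z ∈ bx w m) (hl : k + m ≤ l) : bx z k ⊆ bx w l := by
  intro v hv
  rw [mem_bx] at *
  intro q
  have h1 := h q
  have h2 := hv q
  rw [abs_le] at *
  have : (k:ℤ) + m ≤ l := by exact_mod_cast hl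
  constructor <;> linarith [h1.1, h1.2, h2.1, h2.2]

lemma cen_bd {n M : ℕ} {i j : Fin d} {x : ℕ × ℕ} (gx : grd M x) (k : Fin d) :
    2 * (n:ℤ) ≤ cen n i j x k ∧ cen n i j x k ≤ n * (M + 1) := by
  have h1 : (x.1 : ℤ) + 1 ≤ M := by exact_mod_cast gx.1
  have h2 : (x.2 : ℤ) + 1 ≤ M := by exact_mod_cast gx.2
  have hn : (0:ℤ) ≤ n := by positivity
  have hx1 : (0:ℤ) ≤ x.1 := by positivity
  have hx2 : (0:ℤ) ≤ x.2 := by positivity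
  unfold cen
  constructor
  · split_ifs <;> nlinarith
  · split_ifs <;> nlinarith

lemma eb_FB {n M N : ℕ} (hn : 1 ≤ n) (hN : n * (M + 4) ≤ N) {i j : Fin d} {x : ℕ × ℕ} (gx : grd M x) :
    eb (cen n i j x) (2 * n) ⊆ FB d N := by
  have key : ∀ w ∈ bx (cen n i j x) (2*n), ∀ k, 0 ≤ w k ∧ w k ≤ (N:ℤ) - 1 := by
    intro w hw k
    have h1 := mem_bx.1 hw k
    have h2 := cen_bd (n := n) (i := i) (j := j) gx k
    rw [abs_le] at h1
    push_cast at h1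
    have h3 : (n:ℤ) * (M + 4) ≤ N := by exact_mod_cast hN
    have h4 : (1:ℤ) ≤ n := by exact_mod_cast hn
    constructor <;> nlinarith [h1.1, h1.2, h2.1, h2.2]
  intro e he
  rw [mem_eb] at he
  rw [mem_FB]
  exact ⟨key _ he.1, key _ he.2⟩

/-- axis and sign of a coarse directed edge -/
def axs (i j : Fin d) (σ : (ℕ × ℕ) × (ℕ × ℕ)) : Fin d := if σ.1.1 = σ.2.1 then j else i

def sgn (σ : (ℕ × ℕ) × (ℕ × ℕ)) : ℤˣ := if σ.1.1 < σ.2.1 ∨ σ.1.2 < σ.2.2 then 1 else -1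

def tau (n : ℕ) (i j : Fin d) (σ : (ℕ × ℕ) × (ℕ × ℕ)) (z : V d) : Fin d → ℤˣ :=
  fun k => if k = axs i j σ then sgn σ else if cen n i j σ.1 k ≤ z k then -1 else 1

noncomputable def tgt (n : ℕ) (i j : Fin d) (σ : (ℕ × ℕ) × (ℕ × ℕ)) (z : V d) : Finset (V d) :=
  Tg z n (axs i j σ) (tau n i j σ z)

lemma tgt_good {n : ℕ} {i j : Fin d} (hij : i ≠ j) {σ : (ℕ × ℕ) × (ℕ × ℕ)} (hσ : nb σ.1 σ.2) {z v : V d}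
    (hz : z ∈ bx (cen n i j σ.1) n) (hv : v ∈ tgt n i j σ z) : v ∈ bx (cen n i j σ.2) n := by
  rw [tgt, mem_Tg, mem_TT] at hv
  obtain ⟨h1, h2, h3⟩ := hv
  rw [mem_bx] at h1 hz ⊢
  intro k
  have h1 := h1 k
  have h3 := h3 k
  have hz := hz k
  simp only [Pi.sub_apply, Pi.zero_apply, sub_zero] at h1 h2 h3
  by_cases hk : k = axs i j σ
  · rw [← hk] at h2
    have hc : cen n i j σ.2 k = cen n i j σ.1 k + sgn σ * n := by
      rw [hk]
      obtain ⟨⟨a, b⟩, ⟨a', b'⟩⟩ := σ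
      simp only [nb] at hσ
      rcases hσ with ⟨rfl, rfl | rfl⟩ | ⟨rfl, rfl | rfl⟩ <;>
        simp [cen, axs, sgn, hij, hij.symm] <;> ring
    have ht : tau n i j σ z k = sgn σ := by simp [tau, hk]
    rw [ht] at h2
    rw [hc]
    have : v k = z k + sgn σ * n := by
      rcases Int.units_eq_one_or (sgn σ) with h | h <;> rw [h] at h2 ⊢ <;> simp at h2 ⊢ <;> linarith
    rw [this]
    have e : z k + ↑(sgn σ) * (n:ℤ) - (cen n i j σ.1 k + ↑(sgn σ) * n) = z k - cen n i j σ.1 k := by ring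
    rw [e]; exact hz
  · have hc : cen n i j σ.2 k = cen n i j σ.1 k := by
      obtain ⟨⟨a, b⟩, ⟨a', b'⟩⟩ := σ
      simp only [nb] at hσ
      rcases hσ with ⟨rfl, h⟩ | ⟨rfl, h⟩
      · have : k ≠ j := by simpa [axs] using hk
        simp [cen, this]
      · have : a ≠ a' := by omega
        have : k ≠ i := by simpa [axs, this] using hk
        simp [cen, this]
    rw [hc]
    have ht : tau n i j σ z k = if cen n i j σ.1 k ≤ z k then -1 else 1 := by simp [tau, hk]
    rw [ht] at h3
    rw [abs_le] at *
    split_ifs at h3 with h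
    · simp at h3; constructor <;> linarith
    · simp at h3; constructor <;> linarith

/-- all coarse directed edges -/
noncomputable def allE (M : ℕ) : Finset ((ℕ × ℕ) × (ℕ × ℕ)) := by
  classical
  exact ((Finset.range M ×ˢ Finset.range M) ×ˢ (Finset.range M ×ˢ Finset.range M)).filter
    (fun σ => nb σ.1 σ.2)

lemma mem_allE {M : ℕ} {σ : (ℕ × ℕ) × (ℕ × ℕ)} : σ ∈ allE M ↔ grd M σ.1 ∧ grd M σ.2 ∧ nb σ.1 σ.2 := by
  simp [allE, grd, and_assoc]

/-- all random bits -/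
noncomputable def bits (n K M N : ℕ) (i j : Fin d) : Finset (Ix d ((ℕ × ℕ) × (ℕ × ℕ))) :=
  (FB d N).image Ix.base ∪ 
  ((allE M).biUnion (fun σ => (eb (cen n i j σ.1) (2*n)).image (Ix.bd σ)) ∪
  (allE M).biUnion (fun σ => (bx (cen n i j σ.2) n).biUnion fun v => (eb v K).image (Ix.sd σ v)))

/-- underlying edge -/
def und {Λ : Type*} : Ix d Λ → E d
  | Ix.base e => e
  | Ix.bd _ e => e
  | Ix.sd _ _ e => e

lemma mem_bits {n K M N : ℕ} {i j : Fin d} {b : Ix d ((ℕ × ℕ) × (ℕ × ℕ))} : b ∈ bits n K M N i j ↔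
    (∃ e ∈ FB d N, b = Ix.base e) ∨ (∃ σ ∈ allE M, ∃ e ∈ eb (cen n i j σ.1) (2*n), b = Ix.bd σ e) ∨
    (∃ σ ∈ allE M, ∃ v ∈ bx (cen n i j σ.2) n, ∃ e ∈ eb v K, b = Ix.sd σ v e) := by
  simp only [bits, Finset.mem_union, Finset.mem_image, Finset.mem_biUnion, eq_comm (a := b)]

lemma cen_cl {n : ℕ} (hn : 1 ≤ n) {i j : Fin d} (hij : i ≠ j) {x y : ℕ × ℕ} {w : V d}
    (hx : w ∈ bx (cen n i j x) (2*n)) (hy : w ∈ bx (cen n i j y) (2*n)) : cl 4 x y := by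
  have key : ∀ (a b : ℕ) (c : ℤ), |c - (2 * n + (n:ℤ) * a)| ≤ (2 * n : ℕ) → |c - (2 * n + (n:ℤ) * b)| ≤ (2*n : ℕ) →
      a ≤ b + 4 := by
    intro a b c ha hb
    rw [abs_le] at ha hb
    push_cast at ha hb
    by_contra hcon
    have h1 : (b:ℤ) + 5 ≤ a := by omega
    have h2 : (1:ℤ) ≤ n := by exact_mod_cast hn
    nlinarith [ha.1, ha.2, hb.1, hb.2]
  rw [mem_bx] at hx hy
  have hxi := hx i
  have hyi := hy i
  have hxj := hx j
  have hyj := hy j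
  simp only [cen, if_true, hij.symm, if_false] at hxi hyi hxj hyj
  exact ⟨key _ _ _ hxi hyi, key _ _ _ hyi hxi, key _ _ _ hxj hyj, key _ _ _ hyj hxj⟩

lemma prod_sub_le {α : Type*} [DecidableEq α] {X U : Finset α} (h : X ⊆ U) {f : α → ℝ}
    (h0 : ∀ a, 0 ≤ f a) (h1 : ∀ a, f a ≤ 1) : ∏ a ∈ U, f a ≤ ∏ a ∈ X, f a := by
  rw [← Finset.prod_sdiff h]
  exact mul_le_of_le_one_left (Finset.prod_nonneg fun a _ => h0 a) (Finset.prod_le_one (fun a _ => h0 a) fun a _ => h1 a)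

lemma fib_prod {p ε₁ ε₂ : ℝ} (hp0 : 0 ≤ p) (hp1 : p ≤ 1) (he0 : 0 ≤ ε₁) (he1 : ε₁ ≤ 1)
    (hs0 : 0 ≤ ε₂) (hs1 : ε₂ ≤ 1) {n K M N : ℕ} (hn : 1 ≤ n) (hK : K ≤ n) {i j : Fin d} (hij : i ≠ j) (e : E d) :
    (1 - p) * (1 - ε₁) ^ 729 * (1 - ε₂) ^ (1089 * (2 * K + 1) ^ d) ≤
      ∏ a ∈ bits n K M N i j with und a = e, (1 - pI p ε₁ ε₂ a) := by
  classical
  obtain ⟨x0, hx0⟩ : ∃ x0, ∀ x, e.1 ∈ bx (cen n i j x) (2*n) → cl 4 x0 x := by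
    by_cases h : ∃ x0, e.1 ∈ bx (cen n i j x0) (2*n)
    · obtain ⟨x0, h0⟩ := h
      exact ⟨x0, fun x hx => cen_cl hn hij h0 hx⟩
    · exact ⟨(0,0), fun x hx => absurd ⟨x, hx⟩ h⟩
  set I0 : Finset (Ix d ((ℕ × ℕ) × (ℕ × ℕ))) := {Ix.base e} with hI0
  set I1 : Finset (Ix d ((ℕ × ℕ) × (ℕ × ℕ))) := (nbG x0 4).image (fun σ => Ix.bd σ e) with hI1
  set I2 : Finset (Ix d ((ℕ × ℕ) × (ℕ × ℕ))) := (nbG x0 5 ×ˢ bx e.1 K).image (fun q => Ix.sd q.1 q.2 e) with hI2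
  have hP : IsP (pI p ε₁ ε₂ : Ix d ((ℕ × ℕ) × (ℕ × ℕ)) → ℝ) := isP_pI hp0 hp1 he0 he1 hs0 hs1
  have hnb : ∀ σ : (ℕ × ℕ) × (ℕ × ℕ), nb σ.1 σ.2 → cl 1 σ.1 σ.2 := by
    intro σ h; unfold nb at h; unfold cl; omega
  have hsub : (bits n K M N i j).filter (fun a => und a = e) ⊆ I0 ∪ (I1 ∪ I2) := by
    intro a ha
    rw [Finset.mem_filter, mem_bits] at ha
    obtain ⟨ha, hae⟩ := ha
    rcases ha with ⟨e', he', rfl⟩ | ⟨σ, hσ, e', he', rfl⟩ | ⟨σ, hσ, v, hv, e', he', rfl⟩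
    · simp only [und] at hae; subst hae; simp [hI0]
    · simp only [und] at hae; subst hae
      refine Finset.mem_union_right _ (Finset.mem_union_left _ (Finset.mem_image.2 ⟨σ, ?_, rfl⟩))
      exact mem_nbG (hx0 _ (mem_eb.1 he').1) (hnb _ (mem_allE.1 hσ).2.2)
    · simp only [und] at hae; subst hae
      refine Finset.mem_union_right _ (Finset.mem_union_right _ (Finset.mem_image.2 ⟨(σ, v), ?_, rfl⟩))
      rw [Finset.mem_product]
      have h1 := (mem_eb.1 he').1
      have h2 := hx0 σ.2 (bx_sub hv (by omega) h1)
      have h3 := hnb _ (mem_allE.1 hσ).2.2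
      refine ⟨mem_nbG ?_ h3, ?_⟩
      · change cl 5 x0 σ.1
        unfold cl at *; omega
      · dsimp only
        rw [mem_bx] at h1 ⊢
        intro k; rw [abs_sub_comm]; exact h1 k
  refine le_trans ?_ (prod_sub_le hsub (fun a => sub_nonneg.2 (hP a).2) (fun a => by linarith [(hP a).1]))
  rw [Finset.prod_union, Finset.prod_union]
  · rw [mul_assoc]
    refine mul_le_mul ?_ (mul_le_mul ?_ ?_ (pow_nonneg (by linarith) _) (Finset.prod_nonneg fun a _ => sub_nonneg.2 (hP a).2)) (mul_nonneg (pow_nonneg (by linarith) _) (pow_nonneg (by linarith) _)) 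
      (Finset.prod_nonneg fun a _ => sub_nonneg.2 (hP a).2)
    · simp [hI0, pI]
    · have : ∏ a ∈ I1, (1 - pI p ε₁ ε₂ a) = ∏ a ∈ I1, (1 - ε₁) := by
        refine Finset.prod_congr rfl fun a ha => ?_
        obtain ⟨σ, -, rfl⟩ := Finset.mem_image.1 ha
        rfl
      rw [this, Finset.prod_const]
      refine pow_le_pow_of_le_one (by linarith) (by linarith) ?_
      exact Finset.card_image_le.trans (nbG_card x0 4)
    · have : ∏ a ∈ I2, (1 - pI p ε₁ ε₂ a) = ∏ a ∈ I2, (1 - ε₂) := by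
        refine Finset.prod_congr rfl fun a ha => ?_
        obtain ⟨σ, -, rfl⟩ := Finset.mem_image.1 ha
        rfl
      rw [this, Finset.prod_const]
      refine pow_le_pow_of_le_one (by linarith) (by linarith) ?_
      refine Finset.card_image_le.trans ?_
      rw [Finset.card_product, bx_card]
      exact Nat.mul_le_mul_right _ (nbG_card x0 5)
  · rw [Finset.disjoint_left]; intro a ha ha'
    obtain ⟨σ, -, rfl⟩ := Finset.mem_image.1 ha
    simp [hI2] at ha'
  · rw [Finset.disjoint_left]; intro a ha ha'
    simp only [hI0, Finset.mem_singleton] at ha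
    subst ha
    simp [hI1, hI2] at ha'

set_option maxHeartbeats 2000000 in
theorem mainLemma {p0 : ℝ} (h0 : 0 < p0) (h1 : p0 < 1) {θ : ℝ} (hθ : 0 < θ) (hth : ∀ n, θ ≤ th d p0 n)
    (hinf : ∀ δ > 0, ∃ n, th d p0 n < θ + δ) {p1 : ℝ} (hp1 : p0 < p1) (hp1' : p1 ≤ 1) {ξ : ℝ} (hξ : 0 < ξ) :
    ∃ K n : ℕ, 1 ≤ n ∧ K ≤ n ∧ ∀ i j : Fin d, i ≠ j → ∀ M N : ℕ, n * (M + 4) ≤ N → 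
      ∀ r v, grd M r → grd M v → Pr (FB d N) (fun _ => p1) (fun A => ¬ ∃ w ∈ bx (cen n i j v) n,
        cn ((A : Set (E d)) ∪ (eb (cen n i j r) K : Set (E d))) (cen n i j r) w) ≤ ξ := by
  classical
  set ηs : ℝ := min (1/2) (ξ/2) / 1062882 with hηs
  have hηs0 : 0 < ηs := div_pos (lt_min (by norm_num) (by linarith)) (by norm_num)
  have e1 : 1062882 * ηs ≤ 1/2 := by
    rw [hηs, mul_div_cancel₀ _ (by norm_num)]; exact min_le_left _ _
  have e2 : 2 * (1062882 * ηs) ≤ ξ := by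
    have : 1062882 * ηs ≤ ξ/2 := by
      rw [hηs, mul_div_cancel₀ _ (by norm_num)]; exact min_le_right _ _
    linarith
  set η := ηs / 3 with hη
  have hη0 : 0 < η := by positivity
  set pa := (p0 + p1) / 2 with hpa
  obtain ⟨ε₁, he0, he1, hε₁⟩ := epsel (c := 1 - p0) (c' := 1 - pa) (by linarith) (by linarith) 729
  obtain ⟨a, ha⟩ : ∃ a : ℕ, (1 - ε₁) ^ a < 1 - p0 := exists_pow_lt_of_lt_one (by linarith) (by linarith)
  have hea : p0 ≤ 1 - (1 - ε₁) ^ (a+1) := by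
    have := pow_le_pow_of_le_one (by linarith) (by linarith : 1 - ε₁ ≤ 1) (Nat.le_succ a)
    rw [Nat.succ_eq_add_one] at this
    linarith
  obtain ⟨K, hK⟩ := partA h0 h1 hθ hth hinf (η := η ^ (a+2)) (by positivity)
  obtain ⟨ε₂, hs0, hs1, hε₂⟩ := epsel (c := 1 - pa) (c' := 1 - p1) (by linarith) (by linarith) (1089 * (2 * K + 1) ^ d)
  set D := (2 * K + 1) ^ d * d with hD
  have hεD : 0 < ε₂ ^ D := by positivity
  obtain ⟨t, ht⟩ : ∃ t : ℕ, (1 - ε₂ ^ D) ^ t < η := exists_pow_lt_of_lt_one hη0 (by linarith)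
  obtain ⟨n0, hn0⟩ := hK ((a+1) * t)
  set n := max n0 (max K 1) with hn
  have hn1 : 1 ≤ n := (le_max_right K 1).trans (le_max_right _ _)
  have hKn : K ≤ n := (le_max_left K 1).trans (le_max_right _ _)
  refine ⟨K, n, hn1, hKn, ?_⟩
  intro i j hij M N hN r v gr gv
  have hP : IsP (pI p0 ε₁ ε₂ : Ix d ((ℕ × ℕ) × (ℕ × ℕ)) → ℝ) := isP_pI h0.le h1.le he0.le he1.le hs0.le hs1.le
  have hP1 : IsP (fun _ : E d => p1) := isP_const (by linarith) hp1'
  set Ω := bits n K M N i j with hΩ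
  obtain ⟨act, failed, x1, x2, x3, x4⟩ := explore (d := d) (allE M) (fun σ => σ.1) (fun σ => σ.2) (tgt n i j) K
    (Good := fun x z => z ∈ bx (cen n i j x) n) (Ω := Ω) (pp := pI p0 ε₁ ε₂) hP hηs0.le
    (by
      intro σ hσ z hz R hR
      obtain ⟨g1, g2, hnb⟩ := mem_allE.1 hσ
      have hb2 := B2 (Λ := (ℕ × ℕ) × (ℕ × ℕ)) (d := d) (p := p0) (ε₁ := ε₁) (ε₂ := ε₂) (η := η) (η' := η ^ (a+2)) h0.le h1.le he0.le he1.le hs0.le hs1.le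
        (a := a) hea hη0 (K := K) (n := n) (t := t) (D := D) (fun v => eb_card v K)
        (i := axs i j σ) (τ := tau n i j σ z) (z := z)
        (partA_tr h0.le h1.le (hn0 n (le_max_left _ _) _ _) z) hR (F := FB d N)
        (by
          refine (ew_mono (bx_sub hz (by omega))).trans (eb_FB hn1 hN g1)) (σ := σ) (Ω := Ω)
        (by intro e he; rw [hΩ, mem_bits]; exact Or.inl ⟨e, he, rfl⟩)
        (by
          intro e he; rw [hΩ, mem_bits]
          exact Or.inr (Or.inl ⟨σ, hσ, e, ew_mono (bx_sub hz (by omega)) he, rfl⟩))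
        (by
          intro v hv e he; rw [hΩ, mem_bits]
          exact Or.inr (Or.inr ⟨σ, hσ, v, tgt_good hij hnb hz hv, e, he, rfl⟩))
      refine hb2.trans ?_
      have : η ^ (a+2) / η ^ (a+1) = η := by
        rw [pow_succ η (a+1)]; field_simp
      rw [this]
      linarith)
    (by
      intro σ hσ z hz v hv
      exact tgt_good hij (mem_allE.1 hσ).2.2 hz hv) r (cen n i j r) (bx_self _ _)
  have hpei := peierls hP hηs0.le e1 x1 gr gv x2 (fun ω σ hn g1 g2 hs => x3 ω σ (mem_allE.2 ⟨g1, g2, hn⟩) hs)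
  set Gd : Finset (E d) → Prop := fun A => ∃ w ∈ bx (cen n i j v) n,
        cn ((A : Set (E d)) ∪ (eb (cen n i j r) K : Set (E d))) (cen n i j r) w with hGd
  have hproj := Ex_proj (und (d := d) (Λ := (ℕ × ℕ) × (ℕ × ℕ))) (FB d N) Ω
    (by
      intro b hb
      rw [hΩ, mem_bits] at hb
      rcases hb with ⟨e', he', rfl⟩ | ⟨σ, hσ, e', he', rfl⟩ | ⟨σ, hσ, v, hv, e', he', rfl⟩
      · exact he'
      · exact eb_FB hn1 hN (mem_allE.1 hσ).1 he'
      · exact eb_FB hn1 hN (mem_allE.1 hσ).2.1 (ew_mono (bx_sub hv (by omega)) he')) hP hP1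
    (by
      intro e _
      refine le_trans ?_ (fib_prod h0.le h1.le he0.le he1.le hs0.le hs1.le hn1 hKn hij e)
      refine hε₂.trans (mul_le_mul_of_nonneg_right hε₁ (pow_nonneg (by linarith) _)))
    (f := Set.indicator {A | Gd A} (fun _ => (1:ℝ)))
    (by
      intro A B hAB
      by_cases h : Gd A
      · have h' : Gd B := by
          obtain ⟨w, hw, hc⟩ := h
          exact ⟨w, hw, cn_mono (Set.union_subset_union_left _ (Finset.coe_subset.2 hAB)) hc⟩
        rw [Set.indicator_of_mem (show A ∈ {A | Gd A} from h), Set.indicator_of_mem (show B ∈ {A | Gd A} from h')]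
      · rw [Set.indicator_of_notMem (show A ∉ {A | Gd A} from h)]
        exact Set.indicator_nonneg (fun _ _ => by norm_num) _)
  change Pr Ω (pI p0 ε₁ ε₂) (fun ω => Gd (ω.image und)) ≤ Pr (FB d N) (fun _ => p1) Gd at hproj
  have hle : Pr Ω (pI p0 ε₁ ε₂) (fun ω => ¬ Gd (ω.image und)) ≤ 2 * (1062882 * ηs) := by
    refine (Pr_mono hP fun ω _ h => ?_).trans hpei
    intro hv
    apply h
    obtain ⟨w, hw, hc⟩ := x4 ω v hv
    refine ⟨w, hw, cn_mono (Set.union_subset_union_left _ ?_) hc⟩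
    intro e he
    rw [Finset.mem_coe, Finset.mem_image]
    rcases he with he | ⟨σ, he⟩ | ⟨σ, v, he⟩
    · exact ⟨_, he, rfl⟩
    · exact ⟨_, he, rfl⟩
    · exact ⟨_, he, rfl⟩
  rw [Pr_not] at hle ⊢
  linarith

end Geo2

end TP

namespace TP

open TorusPerc (stdVec)

section Torus
variable {d : ℕ}

/-- the torus edge below a lattice edge -/
def psi (N : ℕ) (e : E d) : TorusPerc.Edge d N := (TorusPerc.proj d N e.1, e.2)

/-- the periodic lift of a set of torus edges -/
def lif {N : ℕ} (A : Finset (TorusPerc.Edge d N)) : Set (E d) := {e | psi N e ∈ A}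

lemma mem_lif {N : ℕ} {A : Finset (TorusPerc.Edge d N)} {e : E d} : e ∈ lif A ↔ psi N e ∈ A := Iff.rfl

lemma lif_mono {N : ℕ} {A B : Finset (TorusPerc.Edge d N)} (h : A ⊆ B) : lif A ⊆ lif B := fun _ he => h he

lemma connected_lif {N : ℕ} (A : Finset (TorusPerc.Edge d N)) {x y : V d}
    (h : cn (lif A) x y) :
    TorusPerc.connected d N (fun e => decide (e ∈ A)) x y := by
  refine Relation.ReflTransGen.mono ?_ _ _ h
  intro x y h
  rcases h with ⟨i, h1, h2⟩ | ⟨i, h1, h2⟩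
  · exact Or.inl ⟨i, h1, decide_eq_true h2⟩
  · exact Or.inr ⟨i, h1, decide_eq_true h2⟩

lemma psi_inj {N : ℕ} : Set.InjOn (psi (d := d) N) (FB d N : Set (E d)) := by
  intro e he f hf h
  rw [Finset.mem_coe, mem_FB] at he hf
  obtain ⟨h1, h2⟩ := Prod.ext_iff.1 h
  refine Prod.ext (funext fun k => ?_) h2
  have h3 : ((e.1 k : ℤ) : ZMod N) = ((f.1 k : ℤ) : ZMod N) := congrFun h1 k
  rw [ZMod.intCast_eq_intCast_iff] at h3
  have := he.1 k
  have := hf.1 k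
  have h4 := Int.emod_emod_of_dvd
  have e1 := Int.emod_eq_of_lt (he.1 k).1 (by linarith [(he.1 k).2] : e.1 k < N)
  have e2 := Int.emod_eq_of_lt (hf.1 k).1 (by linarith [(hf.1 k).2] : f.1 k < N)
  have h5 : e.1 k % (N:ℤ) = f.1 k % (N:ℤ) := h3
  rw [e1, e2] at h5
  exact h5

/-- seam region -/
noncomputable def seam (n M N : ℕ) (i j : Fin d) (k : ℕ) : Finset (V d) :=
  Finset.Icc (fun l => cen n i j (0, 3*k) l - n + (if l = i then (n:ℤ) * ((M:ℤ) - 1) else 0))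
    (fun l => cen n i j (0, 3*k) l + n + (if l = i then (N:ℤ) else 0))

lemma mem_seam {n M N : ℕ} {i j : Fin d} {k : ℕ} {v : V d} : v ∈ seam n M N i j k ↔
    ∀ l, cen n i j (0, 3*k) l - n + (if l = i then (n:ℤ) * ((M:ℤ) - 1) else 0) ≤ v l ∧
      v l ≤ cen n i j (0, 3*k) l + n + (if l = i then (N:ℤ) else 0) := by
  simp only [seam, Finset.mem_Icc, Pi.le_def, forall_and]

lemma seam_card {n M N : ℕ} {i j : Fin d} {k : ℕ} (hN : n * (M + 4) ≤ N) (hN' : N ≤ n * (M + 5)) :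
    (ew (seam n M N i j k)).card ≤ (8 * n + 1) ^ d * d := by
  unfold ew
  refine (Finset.card_filter_le _ _).trans ?_
  rw [Finset.card_product, seam, Pi.card_Icc]
  simp only [Finset.card_univ, Fintype.card_fin]
  refine Nat.mul_le_mul_right _ ?_
  refine (Finset.prod_le_pow_card _ _ (8 * n + 1) ?_).trans (by simp)
  intro l _
  rw [Int.card_Icc]
  have h1 : (n:ℤ) * (M + 4) ≤ N := by exact_mod_cast hN
  have h2 : (N:ℤ) ≤ n * (M + 5) := by exact_mod_cast hN'
  split_ifs
  · rw [Int.toNat_le]; push_cast; nlinarith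
  · rw [Int.toNat_le]; push_cast; linarith

/-- torus edges of the seam -/
noncomputable def seamT (n M N : ℕ) (i j : Fin d) (k : ℕ) : Finset (TorusPerc.Edge d N) :=
  (ew (seam n M N i j k)).image (psi N)

lemma mem_seamT {n M N : ℕ} {i j : Fin d} {k : ℕ} {f : TorusPerc.Edge d N} :
    f ∈ seamT n M N i j k ↔ ∃ e ∈ ew (seam n M N i j k), psi N e = f := by
  unfold seamT; simp only [Finset.mem_image]

lemma seamT_disj {n M N m : ℕ} (hn : 1 ≤ n) {i j : Fin d} (hij : i ≠ j) (hN : n * (M + 4) ≤ N) (hM : 3 * m ≤ M)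
    {k l : ℕ} (hk : k < m) (hl : l < m) (hkl : k ≠ l) :
    Disjoint (seamT n M N i j k) (seamT n M N i j l) := by
  rw [Finset.disjoint_left]
  intro f hf hf'
  obtain ⟨e, he, rfl⟩ := mem_seamT.1 hf
  obtain ⟨e', he', h⟩ := mem_seamT.1 hf'
  have h3 : ((e'.1 j : ℤ) : ZMod N) = ((e.1 j : ℤ) : ZMod N) := congrFun (Prod.ext_iff.1 h).1 j
  rw [ZMod.intCast_eq_intCast_iff] at h3
  have a1 := mem_seam.1 (mem_ew.1 he).1 j
  have a2 := mem_seam.1 (mem_ew.1 he').1 j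
  simp only [cen, hij.symm, if_false, if_true, add_zero] at a1 a2
  push_cast at a1 a2
  have hn0 : (1:ℤ) ≤ n := by exact_mod_cast hn
  have h1 : (n:ℤ) * (M + 4) ≤ N := by exact_mod_cast hN
  have hMz : 3 * (m:ℤ) ≤ M := by exact_mod_cast hM
  have hkz : (k:ℤ) + 1 ≤ m := by exact_mod_cast hk
  have hlz : (l:ℤ) + 1 ≤ m := by exact_mod_cast hl
  have b1 : (n:ℤ) * (3 * k) ≤ n * (M - 3) := mul_le_mul_of_nonneg_left (by linarith) (by linarith)
  have b2 : (n:ℤ) * (3 * l) ≤ n * (M - 3) := mul_le_mul_of_nonneg_left (by linarith) (by linarith)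
  have c1 : 0 ≤ (n:ℤ) * (3 * k) := by positivity
  have c2 : 0 ≤ (n:ℤ) * (3 * l) := by positivity
  have e1 := Int.emod_eq_of_lt (by linarith [a1.1] : 0 ≤ e.1 j) (by nlinarith [a1.2] : e.1 j < N)
  have e2 := Int.emod_eq_of_lt (by linarith [a2.1] : 0 ≤ e'.1 j) (by nlinarith [a2.2] : e'.1 j < N)
  have h5 : e'.1 j % (N:ℤ) = e.1 j % (N:ℤ) := h3
  rw [e1, e2] at h5
  rcases lt_or_gt_of_ne hkl with hlt | hlt
  · have : (k:ℤ) + 1 ≤ l := by exact_mod_cast hlt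
    nlinarith [a1.2, a2.1]
  · have : (l:ℤ) + 1 ≤ k := by exact_mod_cast hlt
    nlinarith [a2.2, a1.1]

lemma proj_add (N : ℕ) (x : V d) (i : Fin d) :
    TorusPerc.proj d N (x + (N:ℤ) • stdVec d i) = TorusPerc.proj d N x := by
  funext k
  simp [TorusPerc.proj]

lemma wrap {n K M N : ℕ} (hK : K ≤ n) (hM : 1 ≤ M) {i j : Fin d} (hN : n * (M + 4) ≤ N) {k : ℕ}
    {A B : Finset (TorusPerc.Edge d N)} (hB : seamT n M N i j k ⊆ B)
    (h : ∃ w ∈ bx (cen n i j (M - 1, 3*k)) n, 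
      cn (lif A ∪ (eb (cen n i j (0, 3*k)) K : Set (E d))) (cen n i j (0, 3*k)) w) :
    stdVec d i ∈ TorusPerc.winding d N (fun e => decide (e ∈ B ∪ A)) := by
  obtain ⟨w, hw, hc⟩ := h
  refine ⟨cen n i j (0, 3*k), connected_lif _ ?_⟩
  have h1 : (n:ℤ) * (M + 4) ≤ N := by exact_mod_cast hN
  have hn0 : (0:ℤ) ≤ n := by positivity
  have hM1 : (1:ℤ) ≤ M := by exact_mod_cast hM
  have hKz : (K:ℤ) ≤ n := by exact_mod_cast hK
  have hnM : 0 ≤ (n:ℤ) * (M - 1) := mul_nonneg hn0 (by linarith)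
  have hnM' : (n:ℤ) * (M - 1) ≤ N := by nlinarith
  have sub : ∀ v ∈ bx (cen n i j (0, 3*k)) K, v + (N:ℤ) • stdVec d i ∈ seam n M N i j k := by
    intro v hv
    rw [mem_seam]
    rw [mem_bx] at hv
    intro l
    have := abs_le.1 (hv l)
    by_cases hl : l = i
    · simp only [hl, if_true, Pi.add_apply, Pi.smul_apply, stdVec, smul_eq_mul, mul_one] at this ⊢
      constructor <;> linarith [this.1, this.2]
    · simp only [hl, if_false, Pi.add_apply, Pi.smul_apply, stdVec, smul_eq_mul, mul_zero] at this ⊢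
      constructor <;> linarith [this.1, this.2]
  have hws : w ∈ seam n M N i j k := by
    rw [mem_seam]
    rw [mem_bx] at hw
    intro l
    have := abs_le.1 (hw l)
    by_cases hl : l = i
    · simp only [hl, if_true, cen] at this ⊢
      push_cast [Nat.cast_sub hM] at this ⊢
      constructor <;> linarith [this.1, this.2]
    · simp only [hl, if_false, cen] at this ⊢
      constructor <;> linarith [this.1, this.2]
  refine cn_trans (cn_mono (Set.union_subset (lif_mono Finset.subset_union_right) ?_) hc)
    (cn_mono ?_ (cn_Icc _ _ w _ hws (sub _ (bx_self _ _))))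
  · intro e he
    rw [Finset.mem_coe, mem_eb] at he
    refine Finset.mem_union_left _ (hB (mem_seamT.2 ⟨(e.1 + (N:ℤ) • stdVec d i, e.2), ?_, ?_⟩))
    · rw [mem_ew]
      refine ⟨sub _ he.1, ?_⟩
      have := sub _ he.2
      dsimp only
      rw [add_right_comm]; exact this
    · exact Prod.ext (proj_add _ _ _) rfl
  · intro e he
    exact Finset.mem_union_left _ (hB (mem_seamT.2 ⟨e, he, rfl⟩))

/-- direction `i` winds with high probability -/
lemma dirBound {p1 ε p ξ : ℝ} (hp1 : 0 ≤ p1) (hp1' : p1 ≤ 1) (he0 : 0 < ε) (he1 : ε ≤ 1) (hp0 : 0 ≤ p) (hp : p ≤ 1)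
    (hpe : 1 - p ≤ (1 - p1) * (1 - ε)) {n K M N m : ℕ} [NeZero N]
    (hn : 1 ≤ n) (hK : K ≤ n) {i j : Fin d} (hij : i ≠ j)
    (hN : n * (M + 4) ≤ N) (hN' : N ≤ n * (M + 5)) (hM1 : 1 ≤ M) (hM : 3 * m ≤ M) (hξ : 0 ≤ ξ)
    (H : ∀ r v, grd M r → grd M v → Pr (FB d N) (fun _ => p1) (fun A => ¬ ∃ w ∈ bx (cen n i j v) n,
        cn ((A : Set (E d)) ∪ (eb (cen n i j r) K : Set (E d))) (cen n i j r) w) ≤ ξ) :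
    Pr (Finset.univ : Finset (TorusPerc.Edge d N)) (fun _ => p)
      (fun A => stdVec d i ∉ TorusPerc.winding d N (fun e => decide (e ∈ A))) ≤
      ξ + (1 - ε ^ ((8 * n + 1) ^ d * d)) ^ m := by
  set Q : Finset (TorusPerc.Edge d N) → Prop := 
    fun A => stdVec d i ∉ TorusPerc.winding d N (fun e => decide (e ∈ A)) with hQ
  have hQm : ∀ A B, A ⊆ B → Q B → Q A := by
    intro A B hAB hB hA
    apply hB
    obtain ⟨x, hx⟩ := hA
    refine ⟨x, Relation.ReflTransGen.mono ?_ _ _ hx⟩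
    intro x y h
    rcases h with ⟨i, h1, h2⟩ | ⟨i, h1, h2⟩
    · exact Or.inl ⟨i, h1, decide_eq_true (hAB (of_decide_eq_true h2))⟩
    · exact Or.inr ⟨i, h1, decide_eq_true (hAB (of_decide_eq_true h2))⟩
  have hPe : IsP (fun _ : TorusPerc.Edge d N => ε) := isP_const he0.le he1
  have hP1 : IsP (fun _ : TorusPerc.Edge d N => p1) := isP_const hp1 hp1'
  have hPp : IsP (fun _ : TorusPerc.Edge d N => p) := isP_const hp0 hp
  have hb0 : 0 ≤ (1 - ε) * (1 - p1) := mul_nonneg (by linarith) (by linarith)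
  have hPq : IsP (fun _ : TorusPerc.Edge d N => 1 - (1 - ε) * (1 - p1)) :=
    isP_const (by nlinarith) (by linarith)
  have step1 : Pr Finset.univ (fun _ : TorusPerc.Edge d N => p) Q ≤ 
      Pr Finset.univ (fun _ : TorusPerc.Edge d N => 1 - (1 - ε) * (1 - p1)) Q := 
    Pr_anti_p hPq hPp (fun _ _ => by linarith) hQm
  refine step1.trans ?_
  set Z : Finset (TorusPerc.Edge d N) → Prop := fun B => ∀ k ∈ Finset.range m, ¬ seamT n M N i j k ⊆ B with hZ
  have inner : ∀ B, ¬ Z B → Pr Finset.univ (fun _ : TorusPerc.Edge d N => p1) (fun A => Q (B ∪ A)) ≤ ξ := by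
    intro B hB
    simp only [hZ] at hB
    push Not at hB
    obtain ⟨k, hk, hkB⟩ := hB
    rw [Finset.mem_range] at hk
    set G : Finset (TorusPerc.Edge d N) → Prop := fun A => ¬ ∃ w ∈ bx (cen n i j (M - 1, 3*k)) n, 
      cn (lif A ∪ (eb (cen n i j (0, 3*k)) K : Set (E d))) (cen n i j (0, 3*k)) w with hG
    have s1 : Pr Finset.univ (fun _ : TorusPerc.Edge d N => p1) (fun A => Q (B ∪ A)) ≤ 
        Pr Finset.univ (fun _ : TorusPerc.Edge d N => p1) (fun A => G (A ∩ (FB d N).image (psi N))) := by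
      refine Pr_mono hP1 fun A _ hA hw => hA ?_
      refine wrap hK hM1 hN hkB ?_
      obtain ⟨w, hw, hc⟩ := hw
      exact ⟨w, hw, cn_mono (Set.union_subset_union_left _ (lif_mono Finset.inter_subset_left)) hc⟩
    refine s1.trans ?_
    rw [Pr_inter (Finset.subset_univ _) _ G]
    have s2 : Pr ((FB d N).image (psi N)) (fun _ => p1) G = Pr (FB d N) (fun _ => p1) (fun A => G (A.image (psi N))) := by
      unfold Pr
      rw [Ex_image psi_inj]
      rfl
    rw [s2]
    refine le_trans (Pr_mono (isP_const hp1 hp1') ?_) (H (0, 3*k) (M - 1, 3*k) ⟨by dsimp only; omega, by dsimp only; omega⟩ ⟨by dsimp only; omega, by dsimp only; omega⟩)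
    intro A _ hA hw
    apply hA
    obtain ⟨w, hw, hc⟩ := hw
    refine ⟨w, hw, cn_mono (Set.union_subset_union_left _ ?_) hc⟩
    intro e he
    rw [mem_lif]
    exact Finset.mem_image_of_mem _ he
  have step2 : Pr Finset.univ (fun _ : TorusPerc.Edge d N => 1 - (1 - ε) * (1 - p1)) Q ≤ 
      ξ + Pr Finset.univ (fun _ : TorusPerc.Edge d N => ε) Z := by
    have : Pr Finset.univ (fun _ : TorusPerc.Edge d N => 1 - (1 - ε) * (1 - p1)) Q = 
      Ex Finset.univ (fun _ : TorusPerc.Edge d N => ε) (fun B => Pr Finset.univ (fun _ : TorusPerc.Edge d N => p1) (fun A => Q (B ∪ A))) :=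
      Ex_or Finset.univ (fun _ => ε) (fun _ => p1) _
    rw [this]
    unfold Pr at inner ⊢
    rw [← Ex_const Finset.univ (fun _ : TorusPerc.Edge d N => ε) ξ, ← Ex_add]
    refine Ex_mono hPe fun B _ => ?_
    by_cases h : Z B
    · have e1 : Set.indicator {A | Z A} (fun _ => (1:ℝ)) B = 1 := Set.indicator_of_mem (show B ∈ {A | Z A} from h) _
      rw [e1]
      have := Pr_le_one (F := Finset.univ) hP1 (fun A => Q (B ∪ A))
      unfold Pr at this
      linarith
    · have e1 : Set.indicator {A | Z A} (fun _ => (1:ℝ)) B = 0 := Set.indicator_of_notMem (show B ∉ {A | Z A} from h) _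
      rw [e1]
      have := inner B h
      linarith
  refine step2.trans ?_
  have := Pr_none_full (Finset.range m) (F := Finset.univ) hPe (seamT n M N i j) (fun _ _ => Finset.subset_univ _)
    (fun k hk l hl hkl => seamT_disj hn hij hN hM (Finset.mem_range.1 hk) (Finset.mem_range.1 hl) hkl)
    (c := ε ^ ((8 * n + 1) ^ d * d)) (by
      intro k _
      rw [Finset.prod_const]
      refine pow_le_pow_of_le_one he0.le he1 ?_
      unfold seamT
      exact Finset.card_image_le.trans (seam_card hN hN')) (pow_le_one₀ he0.le he1)
  rw [Finset.card_range] at this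
  linarith

end Torus

end TP

namespace TP

open TorusPerc (stdVec)

lemma span_of {d N : ℕ} {ω : TorusPerc.Config d N} (h : ∀ i, stdVec d i ∈ TorusPerc.winding d N ω) :
    ω ∈ TorusPerc.spanEvent d N := by
  change Submodule.span ℚ (TorusPerc.windingQ d N ω) = ⊤
  rw [eq_top_iff, ← (Pi.basisFun ℚ (Fin d)).span_eq]
  refine Submodule.span_mono ?_
  rintro _ ⟨i, rfl⟩
  refine ⟨stdVec d i, h i, ?_⟩
  funext k
  by_cases hk : k = i
  · subst hk; simp [stdVec]
  · simp [stdVec, hk]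

lemma span_bound {d N : ℕ} [NeZero N] {p : ℝ} (h0 : 0 ≤ p) (h1 : p ≤ 1) {c : ℝ}
    (h : ∀ i : Fin d, Pr (Finset.univ : Finset (TorusPerc.Edge d N)) (fun _ => p)
      (fun A => stdVec d i ∉ TorusPerc.winding d N (fun e => decide (e ∈ A))) ≤ c) :
    1 - d * c ≤ TorusPerc.prob d N p (TorusPerc.spanEvent d N) ∧
      TorusPerc.prob d N p (TorusPerc.spanEvent d N) ≤ 1 := by
  have hP : IsP (fun _ : TorusPerc.Edge d N => p) := isP_const h0 h1
  have hb : TorusPerc.prob d N p (TorusPerc.spanEvent d N) = _ := bridge p (TorusPerc.spanEvent d N)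
  rw [hb]
  refine ⟨?_, Pr_le_one hP _⟩
  have hn := Pr_not Finset.univ (fun _ : TorusPerc.Edge d N => p)
    (fun A => (fun e => decide (e ∈ A)) ∈ TorusPerc.spanEvent d N)
  have hle : Pr Finset.univ (fun _ : TorusPerc.Edge d N => p)
      (fun A => ¬ (fun e => decide (e ∈ A)) ∈ TorusPerc.spanEvent d N) ≤ d * c := by
    have h2 := Pr_exists_le (Finset.univ : Finset (Fin d)) (F := Finset.univ) hP
      (fun i A => stdVec d i ∉ TorusPerc.winding d N (fun e => decide (e ∈ A)))
    have h3 : ∑ i : Fin d, Pr (Finset.univ : Finset (TorusPerc.Edge d N)) (fun _ => p)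
      (fun A => stdVec d i ∉ TorusPerc.winding d N (fun e => decide (e ∈ A))) ≤ d * c := by
      refine (Finset.sum_le_sum fun i _ => h i).trans ?_
      simp
    refine le_trans (Pr_mono hP ?_) (h2.trans h3)
    intro A _ hA
    by_contra hc
    apply hA
    apply span_of
    intro i
    by_contra hi
    exact hc ⟨i, Finset.mem_univ _, hi⟩
  linarith

theorem final (d : ℕ) (hd : 2 ≤ d) (p : ℝ) (hp1 : p ≤ 1)
    (hp : ZLattice.hatPc d < p) :
    Filter.Tendsto (fun N : ℕ => TorusPerc.prob d N p (TorusPerc.spanEvent d N))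
      Filter.atTop (nhds 1) := by
  have hpc : 0 ≤ ZLattice.hatPc d := Real.sSup_nonneg fun x hx => hx.1.1
  obtain ⟨p0, h0, h0p⟩ := exists_between hp
  obtain ⟨p1, h01, h1p⟩ := exists_between h0p
  have hp0 : 0 < p0 := lt_of_le_of_lt hpc h0
  have hp0' : p0 < 1 := lt_of_lt_of_le h0p hp1
  have hthe : ZLattice.theta d p0 = ⨅ M, th d p0 M := by
    unfold ZLattice.theta
    exact congrArg _ (funext fun M => theta_bridge M p0)
  have hth0 : ∀ n, 0 ≤ th d p0 n := fun n => Pr_nonneg (isP_const hp0.le hp0'.le) _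
  have hbdd : BddBelow (Set.range fun M => th d p0 M) := ⟨0, by rintro _ ⟨n, rfl⟩; exact hth0 n⟩
  have hθ : 0 < ZLattice.theta d p0 := by
    have hge : 0 ≤ ZLattice.theta d p0 := by rw [hthe]; exact Real.iInf_nonneg hth0
    refine lt_of_le_of_ne hge fun h => ?_
    have : p0 ≤ ZLattice.hatPc d := le_csSup ⟨1, fun x hx => hx.1.2⟩ ⟨⟨hp0.le, hp0'.le⟩, h.symm⟩
    linarith
  have hth : ∀ n, ZLattice.theta d p0 ≤ th d p0 n := fun n => by rw [hthe]; exact ciInf_le hbdd n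
  have hinf : ∀ δ > 0, ∃ n, th d p0 n < ZLattice.theta d p0 + δ := fun δ hδ => by
    refine exists_lt_of_ciInf_lt ?_
    rw [← hthe]; linarith
  obtain ⟨ε, he0, he1, hε⟩ := epsel (c := 1 - p1) (c' := 1 - p) (by linarith) (by linarith) 1
  rw [pow_one] at hε
  have hdpos : (0:ℝ) < d := by exact_mod_cast (by omega : 0 < d)
  rw [Metric.tendsto_atTop]
  intro δ hδ
  set ξ := δ / (4 * d) with hξdef
  have hξ : 0 < ξ := by positivity
  obtain ⟨K, n, hn, hK, H⟩ := mainLemma hp0 hp0' hθ hth hinf h01 (by linarith) hξ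
  have hc : 0 < ε ^ ((8 * n + 1) ^ d * d) := by positivity
  obtain ⟨m, hm⟩ : ∃ m : ℕ, (1 - ε ^ ((8 * n + 1) ^ d * d)) ^ m < ξ := exists_pow_lt_of_lt_one hξ (by linarith)
  refine ⟨n * (3 * m + 5), fun N hN => ?_⟩
  have hNn : 3 * m + 5 ≤ N / n := by rw [Nat.le_div_iff_mul_le (by omega), mul_comm]; exact hN
  have hdm := Nat.div_add_mod N n
  have hmod := Nat.mod_lt N (by omega : 0 < n)
  obtain ⟨M, hM⟩ : ∃ M, N / n = M + 4 := ⟨N / n - 4, by omega⟩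
  rw [hM] at hdm hNn
  have hN1 : n * (M + 4) ≤ N := by omega
  have hN2 : N ≤ n * (M + 5) := by
    have : n * (M + 5) = n * (M + 4) + n := by ring
    omega
  haveI : NeZero N := ⟨by
    have : 0 < n * (M + 4) := Nat.mul_pos (by omega) (by omega)
    omega⟩
  have key := span_bound (d := d) (N := N) (p := p) (by linarith) hp1 (c := 2 * ξ) (by
    intro i
    obtain ⟨j, hij⟩ : ∃ j : Fin d, i ≠ j := by
      haveI : Nontrivial (Fin d) := Fin.nontrivial_iff_two_le.2 hd
      obtain ⟨j, hj⟩ := exists_ne i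
      exact ⟨j, hj.symm⟩
    have := dirBound (p1 := p1) (by linarith) (by linarith) he0 he1.le (by linarith) hp1 hε (m := m) hn hK hij hN1 hN2
      (by omega) (by omega) hξ.le (H i j hij M N hN1)
    linarith)
  rw [Real.dist_eq, abs_sub_comm, abs_of_nonneg (by linarith [key.2])]
  have : (d:ℝ) * (2 * ξ) = δ / 2 := by rw [hξdef]; field_simp; norm_num
  linarith [key.1]

end TP

/-- Fix `d ≥ 2` and `p > p̂_c(d)`.  Then bond percolation on the torus `T^d_N`
satisfies `ℙ_p(S^□) → 1` as `N → ∞`. -/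
theorem torus_span_prob_supercritical_tendsto_one (d : ℕ) (hd : 2 ≤ d) (p : ℝ)
    (hp1 : p ≤ 1) (hp : ZLattice.hatPc d < p) :
    Filter.Tendsto (fun N : ℕ => TorusPerc.prob d N p (TorusPerc.spanEvent d N))
      Filter.atTop (nhds 1) := by
  exact TP.final d hd p hp1 hp
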